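/- Let {(S̃1(t),S̃2(t))} be an i.i.d. source with marginal pmf p_{S̃1,S̃2} on the finite alphabet S̃_1×S̃_2, transmitted over a discrete memoryless broadcast channel p_{Y1,Y2|X} with finite alphabets, where receiver 1 additionally observes S̃2^m (System Π̃). Let κ̃ ≥ 0, let 𝒬̃1 be a nonempty compact set of joint pmfs on S̃_1×S̃_2×Ŝ_1 with (S̃1,S̃2)-marginal p_{S̃1,S̃2}, and let 𝒬̃2 be a nonempty compact set of joint pmfs on S̃_2×Ŝ_2 with S̃2-marginal p_{S̃2}. Then (κ̃,𝒬̃1,𝒬̃2) is achievable for System Π̃ if and only if (R_{S̃1|S̃2}(𝒬̃1), R_{S̃2}(𝒬̃2)) ∈ κ̃·𝒞₁(p_{Y1,Y2|X}), where R_{S̃1|S̃2}(𝒬̃1) = min over pmfs in 𝒬̃1 of I(S̃1;Ŝ1|S̃2) and R_{S̃2}(𝒬̃2) = min over pmfs in 𝒬̃2 of I(S̃2;Ŝ2). -/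

import Mathlib

open scoped BigOperators Classical
open Finset

noncomputable section

/-- `p` is a probability mass function on the finite type `α`. -/
def IsPMF {α : Type} [Fintype α] (p : α → ℝ) : Prop :=
  (∀ a, 0 ≤ p a) ∧ ∑ a, p a = 1

/-- Shannon entropy (base 2) of a pmf on a finite type. -/
def Hent {α : Type} [Fintype α] (p : α → ℝ) : ℝ :=
  -∑ a, p a * Real.logb 2 (p a)

/-- Mutual information `I(A;B)` of a joint pmf on `α × β` (base-2 logarithms). -/
def MI {α β : Type} [Fintype α] [Fintype β] (p : α × β → ℝ) : ℝ :=
  Hent (fun a => ∑ b, p (a, b)) + Hent (fun b => ∑ a, p (a, b)) - Hent p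

/-- Conditional mutual information `I(A;B|C)` of a joint pmf on `α × β × γ`. -/
def CMI {α β γ : Type} [Fintype α] [Fintype β] [Fintype γ] (p : α × β × γ → ℝ) : ℝ :=
  Hent (fun ac : α × γ => ∑ b, p (ac.1, b, ac.2))
    + Hent (fun bc : β × γ => ∑ a, p (a, bc.1, bc.2))
    - Hent p
    - Hent (fun c : γ => ∑ a, ∑ b, p (a, b, c))

/-- A channel: every input letter gives a pmf on outputs. -/
def IsChannel {X Z : Type} [Fintype Z] (W : X → Z → ℝ) : Prop :=
  ∀ x, IsPMF (W x)

/-- Marginal channel to receiver 1 of a broadcast channel. -/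
def margW1 {X Y1 Y2 : Type} [Fintype Y2] (W : X → Y1 × Y2 → ℝ) : X → Y1 → ℝ :=
  fun x y1 => ∑ y2, W x (y1, y2)

/-- Marginal channel to receiver 2 of a broadcast channel. -/
def margW2 {X Y1 Y2 : Type} [Fintype Y1] (W : X → Y1 × Y2 → ℝ) : X → Y2 → ℝ :=
  fun x y2 => ∑ y1, W x (y1, y2)

/-- Memoryless `n`-fold extension of a broadcast channel. -/
def nFold {X Y1 Y2 : Type} (W : X → Y1 × Y2 → ℝ) (n : ℕ)
    (x : Fin n → X) (y : (Fin n → Y1) × (Fin n → Y2)) : ℝ :=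
  ∏ t, W (x t) (y.1 t, y.2 t)

section Channel

variable {X Y1 Y2 : Type} [Fintype Y1] [Fintype Y2]

/-- Average error probability; message `M2` known at receiver 1. -/
def errP1 (W : X → Y1 × Y2 → ℝ) (n k1 k2 : ℕ) (f : Fin k1 × Fin k2 → Fin n → X)
    (g1 : (Fin n → Y1) × Fin k2 → Fin k1) (g2 : (Fin n → Y2) → Fin k2) : ℝ :=
  (1 : ℝ) / ((k1 : ℝ) * (k2 : ℝ)) *
    ∑ m : Fin k1 × Fin k2, ∑ y : (Fin n → Y1) × (Fin n → Y2),
      nFold W n (f m) y * (if g1 (y.1, m.2) = m.1 ∧ g2 y.2 = m.2 then 0 else 1)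

/-- Average error probability; message `M1` known at receiver 2. -/
def errP2 (W : X → Y1 × Y2 → ℝ) (n k1 k2 : ℕ) (f : Fin k1 × Fin k2 → Fin n → X)
    (g1 : (Fin n → Y1) → Fin k1) (g2 : (Fin n → Y2) × Fin k1 → Fin k2) : ℝ :=
  (1 : ℝ) / ((k1 : ℝ) * (k2 : ℝ)) *
    ∑ m : Fin k1 × Fin k2, ∑ y : (Fin n → Y1) × (Fin n → Y2),
      nFold W n (f m) y * (if g1 y.1 = m.1 ∧ g2 (y.2, m.1) = m.2 then 0 else 1)

/-- Average error probability; no receiver side information. -/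
def errP0 (W : X → Y1 × Y2 → ℝ) (n k1 k2 : ℕ) (f : Fin k1 × Fin k2 → Fin n → X)
    (g1 : (Fin n → Y1) → Fin k1) (g2 : (Fin n → Y2) → Fin k2) : ℝ :=
  (1 : ℝ) / ((k1 : ℝ) * (k2 : ℝ)) *
    ∑ m : Fin k1 × Fin k2, ∑ y : (Fin n → Y1) × (Fin n → Y2),
      nFold W n (f m) y * (if g1 y.1 = m.1 ∧ g2 y.2 = m.2 then 0 else 1)

/-- Achievability of a rate pair with `M2` available at receiver 1. -/
def Ach1 (W : X → Y1 × Y2 → ℝ) (R : ℝ × ℝ) : Prop :=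
  0 ≤ R.1 ∧ 0 ≤ R.2 ∧ ∀ ε : ℝ, 0 < ε →
    ∃ (n k1 k2 : ℕ), 0 < n ∧ 0 < k1 ∧ 0 < k2 ∧
      ∃ (f : Fin k1 × Fin k2 → Fin n → X) (g1 : (Fin n → Y1) × Fin k2 → Fin k1)
        (g2 : (Fin n → Y2) → Fin k2),
        R.1 ≤ Real.logb 2 (k1 : ℝ) / (n : ℝ) ∧ R.2 ≤ Real.logb 2 (k2 : ℝ) / (n : ℝ) ∧
        errP1 W n k1 k2 f g1 g2 ≤ ε

/-- Achievability of a rate pair with `M1` available at receiver 2. -/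
def Ach2 (W : X → Y1 × Y2 → ℝ) (R : ℝ × ℝ) : Prop :=
  0 ≤ R.1 ∧ 0 ≤ R.2 ∧ ∀ ε : ℝ, 0 < ε →
    ∃ (n k1 k2 : ℕ), 0 < n ∧ 0 < k1 ∧ 0 < k2 ∧
      ∃ (f : Fin k1 × Fin k2 → Fin n → X) (g1 : (Fin n → Y1) → Fin k1)
        (g2 : (Fin n → Y2) × Fin k1 → Fin k2),
        R.1 ≤ Real.logb 2 (k1 : ℝ) / (n : ℝ) ∧ R.2 ≤ Real.logb 2 (k2 : ℝ) / (n : ℝ) ∧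
        errP2 W n k1 k2 f g1 g2 ≤ ε

/-- Achievability of a rate pair with no receiver side information. -/
def Ach0 (W : X → Y1 × Y2 → ℝ) (R : ℝ × ℝ) : Prop :=
  0 ≤ R.1 ∧ 0 ≤ R.2 ∧ ∀ ε : ℝ, 0 < ε →
    ∃ (n k1 k2 : ℕ), 0 < n ∧ 0 < k1 ∧ 0 < k2 ∧
      ∃ (f : Fin k1 × Fin k2 → Fin n → X) (g1 : (Fin n → Y1) → Fin k1)
        (g2 : (Fin n → Y2) → Fin k2),
        R.1 ≤ Real.logb 2 (k1 : ℝ) / (n : ℝ) ∧ R.2 ≤ Real.logb 2 (k2 : ℝ) / (n : ℝ) ∧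
        errP0 W n k1 k2 f g1 g2 ≤ ε

/-- Capacity region `𝒞₁`: side information `M2` at receiver 1. -/
def Cap1 (W : X → Y1 × Y2 → ℝ) : Set (ℝ × ℝ) := closure {R | Ach1 W R}

/-- Capacity region `𝒞₂`: side information `M1` at receiver 2. -/
def Cap2 (W : X → Y1 × Y2 → ℝ) : Set (ℝ × ℝ) := closure {R | Ach2 W R}

/-- Private-message capacity region `𝒞`. -/
def Cap (W : X → Y1 × Y2 → ℝ) : Set (ℝ × ℝ) := closure {R | Ach0 W R}

end Channel

/-- `κ·𝒜` for a set of rate pairs. -/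
def scaleSet (κ : ℝ) (A : Set (ℝ × ℝ)) : Set (ℝ × ℝ) :=
  (fun R : ℝ × ℝ => (κ * R.1, κ * R.2)) '' A

/-- Binary entropy function (base 2). -/
def Hb (x : ℝ) : ℝ := -(x * Real.logb 2 x) - (1 - x) * Real.logb 2 (1 - x)

/-- Binary convolution `a*b = a(1-b)+(1-a)b`. -/
def bconv (a b : ℝ) : ℝ := a * (1 - b) + (1 - a) * b

/-- The region `𝒞(BS-BC(d₁,d₂))`. -/
def CBSBC (d1 d2 : ℝ) : Set (ℝ × ℝ) :=
  {R | 0 ≤ R.1 ∧ 0 ≤ R.2 ∧ ∃ α ∈ Set.Icc (0:ℝ) (1/2),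
    R.1 ≤ Hb (bconv α d1) - Hb d1 ∧ R.2 ≤ 1 - Hb (bconv α d2)}

/-- The region `𝒞(BE-BC(ε₁,ε₂))`. -/
def CBEBC (e1 e2 : ℝ) : Set (ℝ × ℝ) :=
  {R | 0 ≤ R.1 ∧ 0 ≤ R.2 ∧ ∃ β ∈ Set.Icc (0:ℝ) 1,
    R.1 ≤ β * (1 - e1) ∧ R.2 ≤ (1 - β) * (1 - e2)}

/-- 1-norm distance between two functions on a finite type. -/
def l1dist {α : Type} [Fintype α] (p q : α → ℝ) : ℝ := ∑ a, |p a - q a|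

/-- Capacity `C(p_{Y|X}) = max_{p_X} I(X;Y)` of a point-to-point channel. -/
def Cmarg {X Y : Type} [Fintype X] [Fintype Y] (Wm : X → Y → ℝ) : ℝ :=
  sSup {r | ∃ pX : X → ℝ, IsPMF pX ∧ r = MI (fun a : X × Y => pX a.1 * Wm a.1 a.2)}

section SystemPiTilde

variable {S1 S2 X Y1 Y2 US1 US2 : Type}
variable [Fintype S1] [Fintype S2] [Fintype X] [Fintype Y1] [Fintype Y2]
variable [Fintype US1] [Fintype US2]

/-- Probability of a pair of source blocks under the i.i.d. source `p_{S̃1,S̃2}`. -/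
def srcProd2 (ps : S1 × S2 → ℝ) (m : ℕ) (s1 : Fin m → S1) (s2 : Fin m → S2) : ℝ :=
  ∏ t, ps (s1 t, s2 t)

/-- Joint pmf of `(S̃1(t), S̃2(t), Ŝ1(t))` induced by a (possibly randomized) code
for System Π̃, in which receiver 1 also observes `S̃2^m`. -/
def jointPiT1 (ps : S1 × S2 → ℝ) (W : X → Y1 × Y2 → ℝ) (m n : ℕ)
    (F : (Fin m → S1) × (Fin m → S2) → (Fin n → X) → ℝ)
    (G1 : (Fin n → Y1) × (Fin m → S2) → (Fin m → US1) → ℝ) (t : Fin m) :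
    S1 × S2 × US1 → ℝ :=
  fun a => ∑ s1 : Fin m → S1, ∑ s2 : Fin m → S2, ∑ x : Fin n → X,
    ∑ y : (Fin n → Y1) × (Fin n → Y2), ∑ u : Fin m → US1,
      srcProd2 ps m s1 s2 * F (s1, s2) x * nFold W n x y * G1 (y.1, s2) u *
        (if s1 t = a.1 ∧ s2 t = a.2.1 ∧ u t = a.2.2 then 1 else 0)

/-- Joint pmf of `(S̃2(t), Ŝ2(t))` induced by a (possibly randomized) code for
System Π̃. -/
def jointPiT2 (ps : S1 × S2 → ℝ) (W : X → Y1 × Y2 → ℝ) (m n : ℕ)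
    (F : (Fin m → S1) × (Fin m → S2) → (Fin n → X) → ℝ)
    (G2 : (Fin n → Y2) → (Fin m → US2) → ℝ) (t : Fin m) :
    S2 × US2 → ℝ :=
  fun a => ∑ s1 : Fin m → S1, ∑ s2 : Fin m → S2, ∑ x : Fin n → X,
    ∑ y : (Fin n → Y1) × (Fin n → Y2), ∑ u : Fin m → US2,
      srcProd2 ps m s1 s2 * F (s1, s2) x * nFold W n x y * G2 y.2 u *
        (if s2 t = a.1 ∧ u t = a.2 then 1 else 0)

/-- `(κ̃, 𝒬̃₁, 𝒬̃₂)` is achievable for System Π̃ (Definition 3). -/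
def InGammaTilde (ps : S1 × S2 → ℝ) (W : X → Y1 × Y2 → ℝ)
    (Q1 : Set (S1 × S2 × US1 → ℝ)) (Q2 : Set (S2 × US2 → ℝ)) (κ : ℝ) : Prop :=
  ∀ ε : ℝ, 0 < ε → ∃ (m n : ℕ), 0 < m ∧
    ∃ (F : (Fin m → S1) × (Fin m → S2) → (Fin n → X) → ℝ)
      (G1 : (Fin n → Y1) × (Fin m → S2) → (Fin m → US1) → ℝ)
      (G2 : (Fin n → Y2) → (Fin m → US2) → ℝ),
      IsChannel F ∧ IsChannel G1 ∧ IsChannel G2 ∧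
      (n : ℝ) / (m : ℝ) ≤ κ + ε ∧
      (∃ q1 ∈ Q1,
        l1dist (fun a => (1 / (m : ℝ)) * ∑ t, jointPiT1 ps W m n F G1 t a) q1 ≤ ε) ∧
      (∃ q2 ∈ Q2,
        l1dist (fun a => (1 / (m : ℝ)) * ∑ t, jointPiT2 ps W m n F G2 t a) q2 ≤ ε)

end SystemPiTilde


/-! ### Basic facts on finite pmfs -/

lemma sum_pi_prod {ι Z : Type} [Fintype ι] [DecidableEq ι] [Fintype Z] (f : ι → Z → ℝ) :
    ∑ z : ι → Z, ∏ t, f t (z t) = ∏ t, ∑ a, f t a := by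
  rw [Finset.prod_univ_sum, Fintype.piFinset_univ]

lemma sum_pi_prod_pmf {ι Z : Type} [Fintype ι] [DecidableEq ι] [Fintype Z] (f : ι → Z → ℝ)
    (hf : ∀ t, IsPMF (f t)) : IsPMF (fun z : ι → Z => ∏ t, f t (z t)) := by
  refine ⟨fun z => Finset.prod_nonneg fun t _ => (hf t).1 _, ?_⟩
  rw [sum_pi_prod]
  exact Finset.prod_eq_one fun t _ => (hf t).2

lemma exists_le_avg {Z : Type} [Fintype Z] {p : Z → ℝ} (hp : IsPMF p) (f : Z → ℝ) (c : ℝ)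
    (h : ∑ z, p z * f z ≤ c) : ∃ z, f z ≤ c := by
  by_contra hcon
  push Not at hcon
  have h1 : ∃ z, 0 < p z := by
    by_contra h0
    push Not at h0
    have : ∑ z, p z ≤ 0 := Finset.sum_nonpos fun z _ => h0 z
    rw [hp.2] at this
    linarith
  obtain ⟨z0, hz0⟩ := h1
  have : ∑ z, p z * c < ∑ z, p z * f z := by
    apply Finset.sum_lt_sum
    · intro z _
      exact mul_le_mul_of_nonneg_left (hcon z).le (hp.1 z)
    · exact ⟨z0, Finset.mem_univ _, mul_lt_mul_of_pos_left (hcon z0) hz0⟩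
  rw [← Finset.sum_mul, hp.2] at this
  linarith

/-- Expectation of a product of functions of two distinct coordinates. -/
lemma pi_pair {ι Z : Type} [Fintype ι] [DecidableEq ι] [Fintype Z] {p : Z → ℝ} (hp : IsPMF p)
    {i j : ι} (hij : i ≠ j) (g h : Z → ℝ) :
    ∑ z : ι → Z, (∏ t, p (z t)) * (g (z i) * h (z j)) =
      (∑ a, p a * g a) * (∑ a, p a * h a) := by
  have h1 : ∀ z : ι → Z, (∏ t, p (z t)) * (g (z i) * h (z j)) =
      ∏ t, (p (z t) * ((if t = i then g (z t) else 1) * (if t = j then h (z t) else 1))) := by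
    intro z
    rw [Finset.prod_mul_distrib, Finset.prod_mul_distrib]
    simp
  simp_rw [h1]
  rw [sum_pi_prod (fun t a => p a * ((if t = i then g a else 1) * (if t = j then h a else 1)))]
  have h2 : ∀ t, ∑ a, p a * ((if t = i then g a else 1) * (if t = j then h a else 1)) =
      (if t = i then (∑ a, p a * g a) else 1) * (if t = j then (∑ a, p a * h a) else 1) := by
    intro t
    by_cases hi : t = i
    · subst hi
      simp [hij]
    · by_cases hj : t = j
      · simp [hj]
        subst hj
        simp [hi]
      · simp [hi, hj, hp.2]
  simp_rw [h2]
  rw [Finset.prod_mul_distrib]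
  simp

/-- Expectation of a function of one coordinate. -/
lemma pi_single {ι Z : Type} [Fintype ι] [DecidableEq ι] [Fintype Z] {p : Z → ℝ} (hp : IsPMF p)
    (i : ι) (g : Z → ℝ) :
    ∑ z : ι → Z, (∏ t, p (z t)) * g (z i) = ∑ a, p a * g a := by
  have h1 : ∀ z : ι → Z, (∏ t, p (z t)) * g (z i) =
      ∏ t, (p (z t) * (if t = i then g (z t) else 1)) := by
    intro z
    rw [Finset.prod_mul_distrib]
    simp
  simp_rw [h1]
  rw [sum_pi_prod (fun t a => p a * (if t = i then g a else 1))]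
  have h2 : ∀ t, ∑ a, p a * (if t = i then g a else 1) =
      (if t = i then (∑ a, p a * g a) else 1) := by
    intro t
    by_cases hi : t = i <;> simp [hi, hp.2]
  simp_rw [h2]
  simp

lemma pi_variance {Z : Type} [Fintype Z] {p : Z → ℝ} (hp : IsPMF p) (g : Z → ℝ)
    (hg : ∑ a, p a * g a = 0) (m : ℕ) :
    ∑ z : Fin m → Z, (∏ t, p (z t)) * (∑ t, g (z t)) ^ 2 = m * ∑ a, p a * g a ^ 2 := by
  have h1 : ∀ z : Fin m → Z, (∏ t, p (z t)) * (∑ t, g (z t)) ^ 2 =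
      ∑ i, ∑ j, (∏ t, p (z t)) * (g (z i) * g (z j)) := by
    intro z
    rw [sq, Finset.sum_mul_sum, Finset.mul_sum]
    simp_rw [Finset.mul_sum]
  simp_rw [h1]
  rw [Finset.sum_comm]
  have h2 : ∀ i : Fin m, ∑ z : Fin m → Z, ∑ j, (∏ t, p (z t)) * (g (z i) * g (z j)) =
      ∑ a, p a * g a ^ 2 := by
    intro i
    rw [Finset.sum_comm]
    rw [Finset.sum_eq_single i]
    · have := pi_single hp i (fun a => g a * g a)
      simp_rw [sq]
      exact this
    · intro j _ hj
      rw [pi_pair hp hj.symm g g, hg, zero_mul]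
    · simp
  rw [Finset.sum_congr rfl fun i _ => h2 i]
  simp

/-- Weak law of large numbers (Chebyshev) in finite-sum form. -/
lemma wlln {Z : Type} [Fintype Z] {p : Z → ℝ} (hp : IsPMF p) (f : Z → ℝ) {δ η : ℝ}
    (hδ : 0 < δ) (hη : 0 < η) :
    ∃ m0 : ℕ, ∀ m : ℕ, m0 ≤ m → ∑ z : Fin m → Z, (∏ t, p (z t)) *
      (if δ * m ≤ |∑ t, f (z t) - m * ∑ a, p a * f a| then 1 else 0) ≤ η := by
  set μ := ∑ a, p a * f a with hμ
  set V := ∑ a, p a * (f a - μ) ^ 2 with hV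
  have hV0 : 0 ≤ V := Finset.sum_nonneg fun a _ => mul_nonneg (hp.1 a) (sq_nonneg _)
  obtain ⟨m0, hm0⟩ := exists_nat_gt (V / (δ ^ 2 * η))
  refine ⟨m0 + 1, fun m hm => ?_⟩
  have hmpos : (0:ℝ) < m := by exact_mod_cast (by omega : 0 < m)
  have hg : ∑ a, p a * (f a - μ) = 0 := by
    simp_rw [mul_sub]
    rw [Finset.sum_sub_distrib, ← Finset.sum_mul, hp.2, ← hμ]
    ring
  have hvar := pi_variance hp (fun a => f a - μ) hg m
  have key : ∑ z : Fin m → Z, (∏ t, p (z t)) *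
      (if δ * m ≤ |∑ t, f (z t) - m * μ| then (1:ℝ) else 0) ≤
      ∑ z : Fin m → Z, (∏ t, p (z t)) * (∑ t, (f (z t) - μ)) ^ 2 / (δ * m) ^ 2 := by
    apply Finset.sum_le_sum
    intro z _
    have hP : 0 ≤ ∏ t, p (z t) := Finset.prod_nonneg fun t _ => hp.1 _
    rw [mul_div_assoc]
    apply mul_le_mul_of_nonneg_left _ hP
    have e : ∑ t, (f (z t) - μ) = ∑ t, f (z t) - m * μ := by
      rw [Finset.sum_sub_distrib]
      simp
    rw [e]
    split_ifs with h
    · rw [le_div_iff₀ (by positivity), one_mul, ← sq_abs (∑ t, f (z t) - m * μ)]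
      exact pow_le_pow_left₀ (by positivity) h 2
    · positivity
  refine key.trans ?_
  rw [← Finset.sum_div, hvar, ← hV, div_le_iff₀ (by positivity)]
  have : V / (δ ^ 2 * η) < m := hm0.trans (by exact_mod_cast (by omega : m0 < m))
  rw [div_lt_iff₀ (by positivity)] at this
  nlinarith

/-- Jensen / Gibbs inequality. -/
lemma gibbs {Z : Type} [Fintype Z] {p : Z → ℝ} (hp : IsPMF p) (r : Z → ℝ)
    (hr : ∀ z, 0 < p z → 0 < r z) (h : ∑ z, p z * r z ≤ 1) :
    ∑ z, p z * Real.logb 2 (r z) ≤ 0 := by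
  have hl : 0 < Real.log 2 := Real.log_pos (by norm_num)
  have h1 : ∑ z, p z * Real.logb 2 (r z) ≤ ∑ z, (p z * r z - p z) / Real.log 2 := by
    apply Finset.sum_le_sum
    intro z _
    rcases (hp.1 z).eq_or_lt with h0 | h0
    · simp [← h0]
    · rw [Real.logb, ← mul_div_assoc, div_le_div_iff_of_pos_right hl]
      have := Real.log_le_sub_one_of_pos (hr z h0)
      nlinarith
  refine h1.trans ?_
  rw [← Finset.sum_div, Finset.sum_sub_distrib, hp.2]
  exact div_nonpos_of_nonpos_of_nonneg (by linarith) hl.le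

/-- Equality case in the Gibbs inequality. -/
lemma gibbs_eq {Z : Type} [Fintype Z] {p : Z → ℝ} (hp : IsPMF p) (r : Z → ℝ)
    (hr : ∀ z, 0 < p z → 0 < r z) (h : ∑ z, p z * r z ≤ 1)
    (h0 : ∑ z, p z * Real.logb 2 (r z) = 0) : ∀ z, 0 < p z → r z = 1 := by
  have hl : 0 < Real.log 2 := Real.log_pos (by norm_num)
  have hlog : ∑ z, p z * Real.log (r z) = 0 := by
    have : ∀ z, p z * Real.logb 2 (r z) = p z * Real.log (r z) / Real.log 2 := by
      intro z; rw [Real.logb]; ring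
    simp_rw [this] at h0
    rw [← Finset.sum_div, div_eq_zero_iff] at h0
    exact h0.resolve_right hl.ne'
  have hnn : ∀ z ∈ (Finset.univ : Finset Z), 0 ≤ p z * (r z - 1 - Real.log (r z)) := by
    intro z _
    rcases (hp.1 z).eq_or_lt with h1 | h1
    · simp [← h1]
    · have := Real.log_le_sub_one_of_pos (hr z h1)
      exact mul_nonneg h1.le (by linarith)
  have hs : ∑ z, p z * (r z - 1 - Real.log (r z)) = 0 := by
    apply le_antisymm _ (Finset.sum_nonneg hnn)
    simp_rw [mul_sub, mul_one]
    rw [Finset.sum_sub_distrib, Finset.sum_sub_distrib, hlog, hp.2]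
    linarith
  rw [Finset.sum_eq_zero_iff_of_nonneg hnn] at hs
  intro z hz
  have h2 := hs z (Finset.mem_univ _)
  rcases mul_eq_zero.1 h2 with h3 | h3
  · exact absurd h3 hz.ne'
  · by_contra hne
    have := Real.log_lt_sub_one_of_pos (hr z hz) hne
    linarith

/-- Existence of conditional kernels. -/
lemma exists_kernel {C U : Type} [Fintype U] [Nonempty U] (r : C → U → ℝ)
    (hr : ∀ c u, 0 ≤ r c u) :
    ∃ k : C → U → ℝ, IsChannel k ∧ ∀ c u, r c u = (∑ v, r c v) * k c u := by
  refine ⟨fun c u => if (∑ v, r c v) = 0 then (if u = Classical.arbitrary U then 1 else 0)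
    else r c u / ∑ v, r c v, ?_, ?_⟩
  · intro c
    by_cases h : (∑ v, r c v) = 0
    · simp only [h, if_true]
      refine ⟨fun u => by dsimp only; split_ifs <;> norm_num, by simp⟩
    · simp only [h, if_false]
      refine ⟨fun u => div_nonneg (hr c u) (Finset.sum_nonneg fun v _ => hr c v), ?_⟩
      rw [← Finset.sum_div, div_self h]
  · intro c u
    by_cases h : (∑ v, r c v) = 0
    · simp only [h, zero_mul]
      exact (Finset.sum_eq_zero_iff_of_nonneg fun v _ => hr c v).1 h u (Finset.mem_univ _)
    · simp only [h, if_false]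
      field_simp

/-- Information-density form of the law of large numbers. -/
lemma aep {Z : Type} [Fintype Z] {p : Z → ℝ} (hp : IsPMF p) (num den : Z → ℝ)
    (hn : ∀ z, 0 < p z → 0 < num z) (hd : ∀ z, 0 < p z → 0 < den z) {ρ η : ℝ}
    (hρ : ρ < ∑ z, p z * Real.logb 2 (num z / den z)) (hη : 0 < η) :
    ∃ m0 : ℕ, ∀ m : ℕ, m0 ≤ m → ∑ z : Fin m → Z, (∏ t, p (z t)) *
      (if (2:ℝ) ^ (m * ρ) * ∏ t, den (z t) ≤ ∏ t, num (z t) then 0 else 1) ≤ η := by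
  set J := ∑ z, p z * Real.logb 2 (num z / den z) with hJ
  obtain ⟨m0, hm0⟩ := wlln hp (fun z => Real.logb 2 (num z / den z)) (sub_pos.2 hρ) hη
  refine ⟨m0, fun m hm => le_trans (Finset.sum_le_sum ?_) (hm0 m hm)⟩
  intro z _
  have hP : 0 ≤ ∏ t, p (z t) := Finset.prod_nonneg fun t _ => hp.1 _
  rcases hP.eq_or_lt with h0 | h0
  · simp [← h0]
  apply mul_le_mul_of_nonneg_left _ hP
  have hpt : ∀ t, 0 < p (z t) := by
    intro t
    rcases (hp.1 (z t)).eq_or_lt with h1 | h1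
    · exact absurd (Finset.prod_eq_zero (Finset.mem_univ t) h1.symm) h0.ne'
    · exact h1
  have hnum : 0 < ∏ t, num (z t) := Finset.prod_pos fun t _ => hn _ (hpt t)
  have hden : 0 < ∏ t, den (z t) := Finset.prod_pos fun t _ => hd _ (hpt t)
  split_ifs with h1 h2 h2
  · exact zero_le_one
  · exact le_rfl
  · exact le_rfl
  · exfalso
    push Not at h1 h2
    rw [← hJ] at h2
    have h3 := (abs_lt.1 h2).1
    have h4 : ∑ t, Real.logb 2 (num (z t) / den (z t)) =
        Real.logb 2 (∏ t, num (z t)) - Real.logb 2 (∏ t, den (z t)) := by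
      rw [Real.logb_prod _ _ fun t _ => (hn _ (hpt t)).ne',
        Real.logb_prod _ _ fun t _ => (hd _ (hpt t)).ne', ← Finset.sum_sub_distrib]
      exact Finset.sum_congr rfl fun t _ => Real.logb_div (hn _ (hpt t)).ne' (hd _ (hpt t)).ne'
    rw [h4] at h3
    have h5 := Real.logb_lt_logb (b := 2) (by norm_num) hnum h1
    rw [Real.logb_mul (by positivity) hden.ne', Real.logb_rpow (by norm_num) (by norm_num)] at h5
    nlinarith


/-! ### Conditional mutual information -/

/-- Conditional mutual information with the conditioning variable in the middle. -/
def cmiMid {A C U : Type} [Fintype A] [Fintype C] [Fintype U] (q : A × C × U → ℝ) : ℝ :=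
  CMI (fun a : A × U × C => q (a.1, a.2.2, a.2.1))

lemma cmi_expand {A C U : Type} [Fintype A] [Fintype C] [Fintype U] (q : A × C × U → ℝ) :
    cmiMid q = ∑ a, ∑ c, ∑ u, q (a, c, u) * (Real.logb 2 (q (a, c, u))
      + Real.logb 2 (∑ a', ∑ u', q (a', c, u')) - Real.logb 2 (∑ u', q (a, c, u'))
      - Real.logb 2 (∑ a', q (a', c, u))) := by
  have e1 : Hent (fun ac : A × C => ∑ b, q (ac.1, ac.2, b)) =
      -∑ a, ∑ c, ∑ u, q (a, c, u) * Real.logb 2 (∑ u', q (a, c, u')) := by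
    unfold Hent
    rw [Fintype.sum_prod_type]
    simp_rw [Finset.sum_mul]
  have e2 : Hent (fun bc : U × C => ∑ a, q (a, bc.2, bc.1)) =
      -∑ a, ∑ c, ∑ u, q (a, c, u) * Real.logb 2 (∑ a', q (a', c, u)) := by
    unfold Hent
    rw [Fintype.sum_prod_type_right]
    simp_rw [Finset.sum_mul]
    congr 1
    rw [Finset.sum_comm' (t' := Finset.univ) (s' := fun _ => Finset.univ) (by simp)]
    · symm
      rw [Finset.sum_congr rfl fun a _ => Finset.sum_comm]
      rw [Finset.sum_comm]
      refine Finset.sum_congr rfl fun u _ => ?_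
      rw [Finset.sum_comm]
  have e3 : Hent (fun a : A × U × C => q (a.1, a.2.2, a.2.1)) =
      -∑ a, ∑ c, ∑ u, q (a, c, u) * Real.logb 2 (q (a, c, u)) := by
    unfold Hent
    rw [Fintype.sum_prod_type]
    simp_rw [Fintype.sum_prod_type_right]
  have e4 : Hent (fun c : C => ∑ a, ∑ b, q (a, c, b)) =
      -∑ a, ∑ c, ∑ u, q (a, c, u) * Real.logb 2 (∑ a', ∑ u', q (a', c, u')) := by
    unfold Hent
    simp_rw [Finset.sum_mul]
    rw [Finset.sum_comm]
  unfold cmiMid CMI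
  simp only
  rw [e1, e2, e3, e4]
  simp_rw [mul_sub, mul_add, Finset.sum_sub_distrib, Finset.sum_add_distrib]
  ring

lemma cmi_form {A C U : Type} [Fintype A] [Fintype C] [Fintype U] (q : A × C × U → ℝ)
    (hq : ∀ z, 0 ≤ q z) (num den : A × C × U → ℝ)
    (hn : ∀ z, 0 < q z → 0 < num z) (hd : ∀ z, 0 < q z → 0 < den z)
    (h : ∀ a c u, 0 < q (a, c, u) → q (a, c, u) * (∑ a', ∑ u', q (a', c, u')) * den (a, c, u) =
      (∑ u', q (a, c, u')) * (∑ a', q (a', c, u)) * num (a, c, u)) :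
    cmiMid q = ∑ z, q z * Real.logb 2 (num z / den z) := by
  rw [cmi_expand, Fintype.sum_prod_type]
  simp_rw [Fintype.sum_prod_type]
  refine Finset.sum_congr rfl fun a _ => Finset.sum_congr rfl fun c _ =>
    Finset.sum_congr rfl fun u _ => ?_
  rcases (hq (a, c, u)).eq_or_lt with h0 | h0
  · rw [← h0]; simp
  congr 1
  have p1 : 0 < ∑ u', q (a, c, u') :=
    lt_of_lt_of_le h0 (Finset.single_le_sum (f := fun u' => q (a, c, u')) (fun i _ => hq _)
      (Finset.mem_univ u))
  have p2 : 0 < ∑ a', q (a', c, u) :=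
    lt_of_lt_of_le h0 (Finset.single_le_sum (f := fun a' => q (a', c, u)) (fun i _ => hq _)
      (Finset.mem_univ a))
  have p3 : 0 < ∑ a', ∑ u', q (a', c, u') :=
    lt_of_lt_of_le p1 (Finset.single_le_sum (f := fun a' => ∑ u', q (a', c, u'))
      (fun i _ => Finset.sum_nonneg fun j _ => hq _) (Finset.mem_univ a))
  have hn' := hn _ h0
  have hd' := hd _ h0
  have h' := congrArg (Real.logb 2) (h a c u h0)
  rw [Real.logb_mul (by positivity) hd'.ne', Real.logb_mul h0.ne' p3.ne',
    Real.logb_mul (by positivity) hn'.ne', Real.logb_mul p1.ne' p2.ne'] at h'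
  rw [Real.logb_div hn'.ne' hd'.ne']
  linarith

lemma Hent_continuous {Z α : Type} [Fintype Z] [TopologicalSpace α] (f : α → Z → ℝ)
    (hf : ∀ z, Continuous fun x => f x z) : Continuous fun x => Hent (f x) := by
  unfold Hent
  refine Continuous.neg (continuous_finsetSum _ fun z _ => ?_)
  have : (fun x => f x z * Real.logb 2 (f x z)) =
      fun x => (f x z * Real.log (f x z)) / Real.log 2 := by
    funext x; rw [Real.logb]; ring
  rw [this]
  exact (Real.continuous_mul_log.comp (hf z)).div_const _

lemma cmiMid_continuous {A C U : Type} [Fintype A] [Fintype C] [Fintype U] :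
    Continuous (cmiMid : (A × C × U → ℝ) → ℝ) := by
  unfold cmiMid CMI
  refine Continuous.sub (Continuous.sub (Continuous.add ?_ ?_) ?_) ?_
  all_goals
    apply Hent_continuous
    intro z
    fun_prop

lemma MI_continuous {A U : Type} [Fintype A] [Fintype U] :
    Continuous (MI : (A × U → ℝ) → ℝ) := by
  unfold MI
  refine Continuous.sub (Continuous.add ?_ ?_) ?_
  all_goals
    apply Hent_continuous
    intro z
    fun_prop

lemma MI_eq_cmiMid {A U : Type} [Fintype A] [Fintype U] (q : A × U → ℝ) (hq : ∑ z, q z = 1) :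
    MI q = cmiMid (fun z : A × Unit × U => q (z.1, z.2.2)) := by
  rw [Fintype.sum_prod_type] at hq
  unfold MI cmiMid CMI Hent
  simp [Fintype.sum_prod_type, hq]

/-- Forward kernels of a joint pmf, and the resulting formula for the information. -/
lemma src_kernels {A C U : Type} [Fintype A] [Fintype C] [Fintype U] [Nonempty U]
    (q : A × C × U → ℝ) (hq : IsPMF q) :
    ∃ (Ka : A × C → U → ℝ) (Kc : C → U → ℝ), IsChannel Ka ∧ IsChannel Kc ∧
      (∀ a c u, q (a, c, u) = (∑ u', q (a, c, u')) * Ka (a, c) u) ∧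
      (∀ z, 0 < q z → 0 < Ka (z.1, z.2.1) z.2.2) ∧ (∀ z, 0 < q z → 0 < Kc z.2.1 z.2.2) ∧
      cmiMid q = ∑ z, q z * Real.logb 2 (Ka (z.1, z.2.1) z.2.2 / Kc z.2.1 z.2.2) ∧
      0 ≤ cmiMid q ∧
      (cmiMid q = 0 → ∀ z, 0 < q z → Ka (z.1, z.2.1) z.2.2 = Kc z.2.1 z.2.2) := by
  obtain ⟨Ka, hKa, hKa'⟩ := exists_kernel (fun (ac : A × C) u => q (ac.1, ac.2, u))
    (fun _ _ => hq.1 _)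
  obtain ⟨Kc, hKc, hKc'⟩ := exists_kernel (fun (c : C) u => ∑ a, q (a, c, u))
    (fun _ _ => Finset.sum_nonneg fun _ _ => hq.1 _)
  have hfac : ∀ a c u, q (a, c, u) = (∑ u', q (a, c, u')) * Ka (a, c) u :=
    fun a c u => hKa' (a, c) u
  have hfacc : ∀ c u, ∑ a, q (a, c, u) = (∑ a, ∑ u', q (a, c, u')) * Kc c u := by
    intro c u
    have := hKc' c u
    rw [Finset.sum_comm] at this
    exact this
  have hn : ∀ z : A × C × U, 0 < q z → 0 < Ka (z.1, z.2.1) z.2.2 := by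
    rintro ⟨a, c, u⟩ h
    rcases ((hKa (a, c)).1 u).eq_or_lt with h0 | h0
    · rw [hfac, ← h0, mul_zero] at h
      exact absurd h (lt_irrefl _)
    · exact h0
  have hd : ∀ z : A × C × U, 0 < q z → 0 < Kc z.2.1 z.2.2 := by
    rintro ⟨a, c, u⟩ h
    rcases ((hKc c).1 u).eq_or_lt with h0 | h0
    · have h1 : 0 < ∑ a, q (a, c, u) := lt_of_lt_of_le h
        (Finset.single_le_sum (f := fun a' => q (a', c, u)) (fun i _ => hq.1 _)
          (Finset.mem_univ a))
      rw [hfacc, ← h0, mul_zero] at h1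
      exact absurd h1 (lt_irrefl _)
    · exact h0
  have hform : cmiMid q = ∑ z, q z * Real.logb 2 (Ka (z.1, z.2.1) z.2.2 / Kc z.2.1 z.2.2) := by
    apply cmi_form q hq.1 (fun z => Ka (z.1, z.2.1) z.2.2) (fun z => Kc z.2.1 z.2.2) hn hd
    intro a c u _
    rw [hfacc c u]
    conv_lhs => rw [hfac a c u]
    ring
  have hr : ∀ z : A × C × U, 0 < q z → 0 < Kc z.2.1 z.2.2 / Ka (z.1, z.2.1) z.2.2 :=
    fun z hz => div_pos (hd z hz) (hn z hz)
  have hsum : ∑ z : A × C × U, q z * (Kc z.2.1 z.2.2 / Ka (z.1, z.2.1) z.2.2) ≤ 1 := by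
    have h1 : ∑ z : A × C × U, q z * (Kc z.2.1 z.2.2 / Ka (z.1, z.2.1) z.2.2) ≤
        ∑ z : A × C × U, (∑ u', q (z.1, z.2.1, u')) * Kc z.2.1 z.2.2 := by
      apply Finset.sum_le_sum
      rintro ⟨a, c, u⟩ _
      have hnn : 0 ≤ (∑ u', q (a, c, u')) := Finset.sum_nonneg fun _ _ => hq.1 _
      rcases (hq.1 (a, c, u)).eq_or_lt with h0 | h0
      · simp only [← h0, zero_mul]
        exact mul_nonneg hnn ((hKc c).1 u)
      · have := hn _ h0
        simp only at this ⊢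
        rw [hfac a c u]
        apply le_of_eq
        field_simp
    refine h1.trans (le_of_eq ?_)
    have h2 := hq.2
    simp_rw [Fintype.sum_prod_type] at h2 ⊢
    simp_rw [← Finset.mul_sum, (hKc _).2, mul_one]
    exact h2
  have hneg : cmiMid q =
      -∑ z : A × C × U, q z * Real.logb 2 (Kc z.2.1 z.2.2 / Ka (z.1, z.2.1) z.2.2) := by
    rw [hform, ← Finset.sum_neg_distrib]
    refine Finset.sum_congr rfl fun z _ => ?_
    rw [← mul_neg, ← Real.logb_inv, inv_div]
  refine ⟨Ka, Kc, hKa, hKc, hfac, hn, hd, hform, ?_, ?_⟩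
  · rw [hneg]
    have := gibbs hq (fun z : A × C × U => Kc z.2.1 z.2.2 / Ka (z.1, z.2.1) z.2.2) hr hsum
    linarith
  · intro h0 z hz
    rw [hneg, neg_eq_zero] at h0
    have := gibbs_eq hq _ hr hsum h0 z hz
    rw [div_eq_one_iff_eq (hn z hz).ne'] at this
    exact this.symm

lemma compact_cont_lower {Z : Type} [Fintype Z] (Q : Set (Z → ℝ)) (hQ : IsCompact Q)
    (f : (Z → ℝ) → ℝ) (hf : Continuous f) (R ε : ℝ) (hR : ∀ q ∈ Q, R ≤ f q) (hε : 0 < ε) :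
    ∃ δ > 0, ∀ p, (∃ q ∈ Q, l1dist p q ≤ δ) → R - ε < f p := by
  have hopen : IsOpen {p | R - ε < f p} := isOpen_lt continuous_const hf
  obtain ⟨δ, hδ, hsub⟩ := hQ.exists_thickening_subset_open hopen
    (fun q hq => by have := hR q hq; simp only [Set.mem_ofPred_eq]; linarith)
  refine ⟨δ / 2, by linarith, fun p ⟨q, hq, hd⟩ => hsub ?_⟩
  rw [Metric.mem_thickening_iff]
  refine ⟨q, hq, lt_of_le_of_lt ?_ (by linarith : δ / 2 < δ)⟩
  rw [dist_pi_le_iff (by linarith)]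
  intro z
  rw [Real.dist_eq]
  exact le_trans (Finset.single_le_sum (f := fun a => |p a - q a|) (fun _ _ => abs_nonneg _)
    (Finset.mem_univ z)) hd


/-! ### Source coding -/

/-- Empirical distribution of a block. -/
def etyp {Z : Type} {m : ℕ} (h : Fin m → Z) : Z → ℝ :=
  fun z => (1 / (m : ℝ)) * ∑ t, (if h t = z then 1 else 0)

lemma wlln_type {Z : Type} [Fintype Z] {q : Z → ℝ} (hq : IsPMF q) {ε η : ℝ}
    (hε : 0 < ε) (hη : 0 < η) :
    ∃ m0 : ℕ, ∀ m : ℕ, m0 ≤ m → ∑ z : Fin m → Z, (∏ t, q (z t)) *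
      (if l1dist (etyp z) q ≤ ε then 0 else 1) ≤ η := by
  set k : ℝ := (Fintype.card Z : ℝ) + 1 with hk
  have hkpos : 0 < k := by positivity
  have h1 := fun z0 : Z => wlln hq (fun z => if z = z0 then 1 else 0) (div_pos hε hkpos)
    (div_pos hη hkpos)
  choose m0 hm0 using h1
  refine ⟨(Finset.univ.sup m0) + 1, fun m hm => ?_⟩
  have hm1 : ∀ z0, m0 z0 ≤ m := fun z0 =>
    le_trans (Finset.le_sup (f := m0) (Finset.mem_univ z0)) (by omega)
  have hmpos : (0:ℝ) < m := by exact_mod_cast (by omega : 0 < m)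
  have key : ∑ z : Fin m → Z, (∏ t, q (z t)) * (if l1dist (etyp z) q ≤ ε then (0:ℝ) else 1) ≤
      ∑ z0 : Z, ∑ z : Fin m → Z, (∏ t, q (z t)) *
      (if ε / k * m ≤ |∑ t, (if z t = z0 then (1:ℝ) else 0) -
        m * ∑ a, q a * (if a = z0 then 1 else 0)| then 1 else 0) := by
    rw [Finset.sum_comm]
    apply Finset.sum_le_sum
    intro z _
    rw [← Finset.mul_sum]
    apply mul_le_mul_of_nonneg_left _ (Finset.prod_nonneg fun t _ => hq.1 _)
    split_ifs with h
    · exact Finset.sum_nonneg fun _ _ => by split_ifs <;> norm_num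
    · have hex : ∃ z0, ε / k ≤ |etyp z z0 - q z0| := by
        by_contra hcon
        push Not at hcon
        apply h
        unfold l1dist
        calc ∑ a, |etyp z a - q a| ≤ ∑ a : Z, ε / k := Finset.sum_le_sum fun a _ => (hcon a).le
          _ = (Fintype.card Z) * (ε / k) := by simp
          _ ≤ k * (ε / k) := by
            apply mul_le_mul_of_nonneg_right _ (by positivity)
            linarith
          _ = ε := by field_simp
      obtain ⟨z0, hz0⟩ := hex
      refine le_trans ?_ (Finset.single_le_sum (fun _ _ => by split_ifs <;> norm_num)
        (Finset.mem_univ z0))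
      rw [if_pos]
      have : ∑ t, (if z t = z0 then (1:ℝ) else 0) - m * ∑ a, q a * (if a = z0 then 1 else 0) =
          m * (etyp z z0 - q z0) := by
        unfold etyp
        simp only [mul_ite, mul_one, mul_zero, Finset.sum_ite_eq', Finset.mem_univ, if_true]
        field_simp
      rw [this, abs_mul, abs_of_pos hmpos, mul_comm]
      exact mul_le_mul_of_nonneg_left hz0 hmpos.le
  refine key.trans ?_
  calc _ ≤ ∑ z0 : Z, η / k := Finset.sum_le_sum fun z0 _ => hm0 z0 m (hm1 z0)
    _ = (Fintype.card Z) * (η / k) := by simp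
    _ ≤ k * (η / k) := by
      apply mul_le_mul_of_nonneg_right _ (by positivity)
      linarith
    _ = η := by field_simp

lemma one_sub_ind {Z : Type} [Fintype Z] {p : Z → ℝ} (hp : IsPMF p) (S : Z → Prop) :
    1 - ∑ v, p v * (if S v then (1:ℝ) else 0) = ∑ v, p v * (if S v then (0:ℝ) else 1) := by
  have h : ∑ v, p v * (if S v then (1:ℝ) else 0) + ∑ v, p v * (if S v then (0:ℝ) else 1) = 1 := by
    rw [← Finset.sum_add_distrib]
    refine Eq.trans ?_ hp.2
    refine Finset.sum_congr rfl fun v _ => ?_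
    split_ifs <;> simp
  linarith

/-- Greedy derandomisation of a random codebook. -/
lemma greedy_fin {A U : Type} [Fintype A] [Fintype U] (Q : U → ℝ) (hQ : IsPMF Q)
    (T : A → U → Prop) (M : ℕ) : ∀ (w : A → ℝ), (∀ a, 0 ≤ w a) → ∃ u : Fin M → U,
      ∑ a, w a * (if ∃ j, T a (u j) then 0 else 1) ≤
        ∑ a, w a * (1 - ∑ v, Q v * (if T a v then 1 else 0)) ^ M := by
  induction M with
  | zero =>
    intro w _
    exact ⟨fun j => j.elim0, by simp⟩
  | succ M ih =>
    intro w hw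
    have havg : ∑ v, Q v * (∑ a, w a * (if T a v then 0 else 1) *
        (1 - ∑ v, Q v * (if T a v then 1 else 0)) ^ M) ≤
        ∑ a, w a * (1 - ∑ v, Q v * (if T a v then 1 else 0)) ^ (M + 1) := by
      apply le_of_eq
      simp_rw [Finset.mul_sum]
      rw [Finset.sum_comm]
      refine Finset.sum_congr rfl fun a _ => ?_
      have e : (1 - ∑ v, Q v * (if T a v then (1:ℝ) else 0)) =
          ∑ v, Q v * (if T a v then (0:ℝ) else 1) := by
        exact one_sub_ind hQ _
      rw [pow_succ]
      nth_rewrite 3 [e]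
      rw [Finset.mul_sum, Finset.mul_sum]
      refine Finset.sum_congr rfl fun v _ => ?_
      ring
    obtain ⟨v, hv⟩ := exists_le_avg hQ _ _ havg
    obtain ⟨u, hu⟩ := ih (fun a => w a * (if T a v then 0 else 1))
      (fun a => mul_nonneg (hw a) (by split_ifs <;> norm_num))
    refine ⟨Fin.cons v u, le_trans (le_of_eq ?_) (hu.trans hv)⟩
    refine Finset.sum_congr rfl fun a _ => ?_
    rw [mul_assoc]
    congr 1
    simp only [Fin.exists_fin_succ, Fin.cons_zero, Fin.cons_succ]
    by_cases h1 : T a v <;> simp [h1]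

lemma greedy {A U K : Type} [Fintype A] [Fintype U] [Fintype K] (Q : U → ℝ) (hQ : IsPMF Q)
    (T : A → U → Prop) (w : A → ℝ) (hw : ∀ a, 0 ≤ w a) : ∃ u : K → U,
      ∑ a, w a * (if ∃ j, T a (u j) then 0 else 1) ≤
        ∑ a, w a * (1 - ∑ v, Q v * (if T a v then 1 else 0)) ^ (Fintype.card K) := by
  obtain ⟨u, hu⟩ := greedy_fin Q hQ T (Fintype.card K) w hw
  refine ⟨fun k => u (Fintype.equivFin K k), le_trans (le_of_eq ?_) hu⟩
  refine Finset.sum_congr rfl fun a _ => ?_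
  congr 1
  have : (∃ j, T a (u (Fintype.equivFin K j))) ↔ ∃ j, T a (u j) :=
    (Fintype.equivFin K).exists_congr_left.trans (by simp)
  simp only [this]

lemma sum_triple {A C U : Type} [Fintype A] [Fintype C] [Fintype U] (m : ℕ)
    (g : (Fin m → A × C × U) → ℝ) :
    ∑ z, g z = ∑ a : Fin m → A, ∑ c : Fin m → C, ∑ u : Fin m → U,
      g (fun t => (a t, c t, u t)) := by
  rw [← (Equiv.arrowProdEquivProdArrow (Fin m) (fun _ => A) (fun _ => C × U)).symm.sum_comp]
  rw [Fintype.sum_prod_type]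
  refine Finset.sum_congr rfl fun a _ => ?_
  rw [← (Equiv.arrowProdEquivProdArrow (Fin m) (fun _ => C) (fun _ => U)).symm.sum_comp]
  rw [Fintype.sum_prod_type]
  rfl

lemma cover_ineq (M : ℕ) {θ x y : ℝ} (hθ : 0 < θ) (hx0 : 0 ≤ x) (hx1 : x ≤ 1)
    (hy1 : y ≤ 1) (hxy : x ≤ θ * y) : (1 - y) ^ M ≤ 1 - x + Real.exp (-(M / θ)) := by
  have h1 : (1 - y) ^ M ≤ (Real.exp (-(x / θ))) ^ M := by
    apply pow_le_pow_left₀ (by linarith)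
    have h2 := Real.add_one_le_exp (-(x / θ))
    have h3 : x / θ ≤ y := by rw [div_le_iff₀ hθ]; linarith
    linarith
  refine h1.trans ?_
  rw [← Real.exp_nat_mul]
  have hc := convexOn_exp.2 (Set.mem_univ (-(M / θ))) (Set.mem_univ 0) hx0 (sub_nonneg.2 hx1)
    (by ring)
  simp only [smul_eq_mul, mul_zero, add_zero, Real.exp_zero, mul_one] at hc
  have e : (M:ℝ) * -(x / θ) = x * -(M / θ) := by ring
  rw [e]
  refine hc.trans ?_
  have : x * Real.exp (-(M / θ)) ≤ 1 * Real.exp (-(M / θ)) :=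
    mul_le_mul_of_nonneg_right hx1 (Real.exp_pos _).le
  linarith

lemma src_core {A C U K : Type} [Fintype A] [Fintype C] [Fintype U] [Fintype K] [Nonempty K]
    (q : A × C × U → ℝ) (hq : IsPMF q)
    (Ka : A × C → U → ℝ) (Kc : C → U → ℝ) (hKa : IsChannel Ka) (hKc : IsChannel Kc)
    (hfac : ∀ a c u, q (a, c, u) = (∑ u', q (a, c, u')) * Ka (a, c) u)
    (m : ℕ) (θ e0 : ℝ) (hbd : ∀ x y : ℝ, 0 ≤ x → x ≤ 1 → 0 ≤ y → y ≤ 1 → x ≤ θ * y →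
      (1 - y) ^ (Fintype.card K) ≤ 1 - x + e0)
    (T : (Fin m → A × C × U) → Prop)
    (hT : ∀ z, T z → ∏ t, Ka ((z t).1, (z t).2.1) (z t).2.2 ≤
      θ * ∏ t, Kc (z t).2.1 (z t).2.2) :
    ∃ (enc : (Fin m → A) → (Fin m → C) → K) (dec : K → (Fin m → C) → Fin m → U),
      ∑ a : Fin m → A, ∑ c : Fin m → C, (∏ t, ∑ u, q (a t, c t, u)) *
        (if T (fun t => (a t, c t, dec (enc a c) c t)) then 0 else 1) ≤
      (∑ z : Fin m → A × C × U, (∏ t, q (z t)) * (if T z then 0 else 1)) + e0 := by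
  have hw : ∀ (a : Fin m → A) (c : Fin m → C), 0 ≤ ∏ t, ∑ u, q (a t, c t, u) :=
    fun a c => Finset.prod_nonneg fun t _ => Finset.sum_nonneg fun u _ => hq.1 _
  have hpQ : ∀ c : Fin m → C, IsPMF (fun u : Fin m → U => ∏ t, Kc (c t) (u t)) :=
    fun c => sum_pi_prod_pmf (fun t => Kc (c t)) (fun t => hKc _)
  have hpA : ∀ (a : Fin m → A) (c : Fin m → C),
      IsPMF (fun u : Fin m → U => ∏ t, Ka (a t, c t) (u t)) :=
    fun a c => sum_pi_prod_pmf (fun t => Ka (a t, c t)) (fun t => hKa _)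
  have h1 := fun c : Fin m → C => greedy (K := K) (fun u : Fin m → U => ∏ t, Kc (c t) (u t))
    (hpQ c) (fun a u => T (fun t => (a t, c t, u t))) (fun a => ∏ t, ∑ u, q (a t, c t, u))
    (fun a => hw a c)
  choose cb hcb using h1
  refine ⟨fun a c => if h : ∃ j, T (fun t => (a t, c t, cb c j t)) then h.choose
    else Classical.arbitrary K, fun k c => cb c k, ?_⟩
  have hind : ∀ (S : (Fin m → U) → Prop) (p : (Fin m → U) → ℝ), IsPMF p →
      0 ≤ ∑ v, p v * (if S v then (1:ℝ) else 0) ∧ ∑ v, p v * (if S v then (1:ℝ) else 0) ≤ 1 := by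
    intro S p hp
    refine ⟨Finset.sum_nonneg fun v _ => mul_nonneg (hp.1 v) (by split_ifs <;> norm_num), ?_⟩
    have h1 := one_sub_ind hp S
    have h2 : 0 ≤ ∑ v, p v * (if S v then (0:ℝ) else 1) :=
      Finset.sum_nonneg fun v _ => mul_nonneg (hp.1 v) (by split_ifs <;> norm_num)
    linarith
  calc _ ≤ ∑ a : Fin m → A, ∑ c : Fin m → C, (∏ t, ∑ u, q (a t, c t, u)) *
        (if ∃ j, T (fun t => (a t, c t, cb c j t)) then (0:ℝ) else 1) := by
        refine Finset.sum_le_sum fun a _ => Finset.sum_le_sum fun c _ => ?_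
        apply mul_le_mul_of_nonneg_left _ (hw a c)
        by_cases h : ∃ j, T (fun t => (a t, c t, cb c j t))
        · have := h.choose_spec
          simp only [h, dif_pos, if_true]
          rw [if_pos this]
        · simp only [h, if_false]
          split_ifs <;> norm_num
    _ = ∑ c : Fin m → C, ∑ a : Fin m → A, (∏ t, ∑ u, q (a t, c t, u)) *
        (if ∃ j, T (fun t => (a t, c t, cb c j t)) then (0:ℝ) else 1) := Finset.sum_comm
    _ ≤ ∑ c : Fin m → C, ∑ a : Fin m → A, (∏ t, ∑ u, q (a t, c t, u)) *
        (1 - ∑ v : Fin m → U, (∏ t, Kc (c t) (v t)) *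
          (if T (fun t => (a t, c t, v t)) then 1 else 0)) ^ (Fintype.card K) :=
        Finset.sum_le_sum fun c _ => hcb c
    _ ≤ ∑ c : Fin m → C, ∑ a : Fin m → A, (∏ t, ∑ u, q (a t, c t, u)) *
        (1 - (∑ v : Fin m → U, (∏ t, Ka (a t, c t) (v t)) *
          (if T (fun t => (a t, c t, v t)) then 1 else 0)) + e0) := by
        refine Finset.sum_le_sum fun c _ => Finset.sum_le_sum fun a _ => ?_
        apply mul_le_mul_of_nonneg_left _ (hw a c)
        have i1 := hind (fun v => T (fun t => (a t, c t, v t))) _ (hpA a c)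
        have i2 := hind (fun v => T (fun t => (a t, c t, v t))) _ (hpQ c)
        refine hbd _ _ i1.1 i1.2 i2.1 i2.2 ?_
        rw [Finset.mul_sum]
        apply Finset.sum_le_sum
        intro v _
        split_ifs with h
        · have := hT _ h
          simpa using this
        · simp
    _ = (∑ z : Fin m → A × C × U, (∏ t, q (z t)) * (if T z then 0 else 1)) + e0 := by
        rw [Finset.sum_comm, sum_triple]
        have hone : ∑ a : Fin m → A, ∑ c : Fin m → C, (∏ t, ∑ u, q (a t, c t, u)) = 1 := by
          have h2 := (sum_pi_prod_pmf (fun _ : Fin m => q) (fun _ => hq)).2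
          rw [sum_triple] at h2
          rw [← h2]
          refine Finset.sum_congr rfl fun a _ => Finset.sum_congr rfl fun c _ => ?_
          rw [← sum_pi_prod (fun t u => q (a t, c t, u))]
        have e2 : e0 = ∑ a : Fin m → A, ∑ c : Fin m → C,
            (∏ t, ∑ u, q (a t, c t, u)) * e0 := by
          simp_rw [← Finset.sum_mul]
          rw [hone, one_mul]
        conv_rhs => rw [e2]
        rw [← Finset.sum_add_distrib]
        refine Finset.sum_congr rfl fun a _ => ?_
        rw [← Finset.sum_add_distrib]
        refine Finset.sum_congr rfl fun c _ => ?_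
        rw [mul_add]
        congr 1
        have h3 : (1:ℝ) - (∑ v : Fin m → U, (∏ t, Ka (a t, c t) (v t)) *
          (if T (fun t => (a t, c t, v t)) then 1 else 0)) = ∑ v : Fin m → U,
            (∏ t, Ka (a t, c t) (v t)) * (if T (fun t => (a t, c t, v t)) then 0 else 1) := by
          exact one_sub_ind (hpA a c) _
        rw [h3, Finset.mul_sum]
        refine Finset.sum_congr rfl fun v _ => ?_
        rw [← mul_assoc, ← Finset.prod_mul_distrib]
        congr 1
        exact Finset.prod_congr rfl fun t _ => (hfac _ _ _).symm


lemma rpow_big {s : ℝ} (hs : 0 < s) (B : ℝ) :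
    ∃ m0 : ℕ, ∀ m : ℕ, m0 ≤ m → B ≤ (2:ℝ) ^ ((m:ℝ) * s) := by
  have hl : 0 < Real.log 2 := Real.log_pos (by norm_num)
  obtain ⟨m0, hm0⟩ := exists_nat_gt (B / (s * Real.log 2))
  refine ⟨m0, fun m hm => ?_⟩
  rw [Real.rpow_def_of_pos (by norm_num)]
  have h1 := Real.add_one_le_exp (Real.log 2 * (m * s))
  have h2 : B / (s * Real.log 2) < m := hm0.trans_le (by exact_mod_cast hm)
  rw [div_lt_iff₀ (by positivity)] at h2
  nlinarith

lemma source_coding {A C U : Type} [Fintype A] [Fintype C] [Fintype U] [Nonempty U]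
    (q : A × C × U → ℝ) (hq : IsPMF q) {ε δ : ℝ} (hε : 0 < ε) (hδ : 0 < δ) :
    ∃ m0 : ℕ, ∀ m : ℕ, m0 ≤ m → ∀ (K : Type) [Fintype K] [Nonempty K],
      (m:ℝ) * ((1 + δ) * cmiMid q) ≤ Real.logb 2 (Fintype.card K) →
      ∃ (enc : (Fin m → A) → (Fin m → C) → K) (dec : K → (Fin m → C) → Fin m → U),
        ∑ a : Fin m → A, ∑ c : Fin m → C, (∏ t, ∑ u, q (a t, c t, u)) *
          (if l1dist (etyp (fun t => (a t, c t, dec (enc a c) c t))) q ≤ ε then 0 else 1) ≤ ε := by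
  obtain ⟨Ka, Kc, hKa, hKc, hfac, hn, hd, hform, hI0, hIeq⟩ := src_kernels q hq
  set I := cmiMid q with hI
  obtain ⟨m1, hm1⟩ := wlln_type hq hε (half_pos (half_pos hε))
  suffices hS : ∃ m2 : ℕ, ∀ m : ℕ, m2 ≤ m → ∀ (K : Type) [Fintype K] [Nonempty K],
      (m:ℝ) * ((1 + δ) * I) ≤ Real.logb 2 (Fintype.card K) → ∃ θ e0 : ℝ, e0 ≤ ε / 2 ∧
      (∀ x y : ℝ, 0 ≤ x → x ≤ 1 → 0 ≤ y → y ≤ 1 → x ≤ θ * y →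
        (1 - y) ^ (Fintype.card K) ≤ 1 - x + e0) ∧
      ∑ z : Fin m → A × C × U, (∏ t, q (z t)) *
        (if ∏ t, Ka ((z t).1, (z t).2.1) (z t).2.2 ≤ θ * ∏ t, Kc (z t).2.1 (z t).2.2
          then 0 else 1) ≤ ε / 2 / 2 by
    obtain ⟨m2, hm2⟩ := hS
    refine ⟨max m1 m2, fun m hm K _ _ hK => ?_⟩
    obtain ⟨θ, e0, he0, hbd, hP⟩ := hm2 m (le_trans (le_max_right _ _) hm) K hK
    have hP1 := hm1 m (le_trans (le_max_left _ _) hm)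
    obtain ⟨T, hT⟩ : ∃ T : (Fin m → A × C × U) → Prop, ∀ z, T z ↔
      (∏ t, Ka ((z t).1, (z t).2.1) (z t).2.2 ≤ θ * ∏ t, Kc (z t).2.1 (z t).2.2 ∧
        l1dist (etyp z) q ≤ ε) := ⟨_, fun _ => Iff.rfl⟩
    obtain ⟨enc, dec, hcode⟩ := src_core (K := K) q hq Ka Kc hKa hKc hfac m θ e0 hbd
      T (fun z hz => ((hT z).1 hz).1)
    refine ⟨enc, dec, le_trans (Finset.sum_le_sum fun a _ => Finset.sum_le_sum fun c _ => ?_)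
      (hcode.trans ?_)⟩
    · apply mul_le_mul_of_nonneg_left _
        (Finset.prod_nonneg fun t _ => Finset.sum_nonneg fun u _ => hq.1 _)
      split_ifs with h1 h2 h2
      · norm_num
      · norm_num
      · exact absurd ((hT _).1 h2).2 h1
      · norm_num
    · have : ∑ z : Fin m → A × C × U, (∏ t, q (z t)) *
          (if T z then (0:ℝ) else 1) ≤
          ∑ z : Fin m → A × C × U, (∏ t, q (z t)) *
          (if ∏ t, Ka ((z t).1, (z t).2.1) (z t).2.2 ≤ θ * ∏ t, Kc (z t).2.1 (z t).2.2
            then (0:ℝ) else 1) +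
          ∑ z : Fin m → A × C × U, (∏ t, q (z t)) *
            (if l1dist (etyp z) q ≤ ε then (0:ℝ) else 1) := by
        rw [← Finset.sum_add_distrib]
        apply Finset.sum_le_sum
        intro z _
        rw [← mul_add]
        apply mul_le_mul_of_nonneg_left _ (Finset.prod_nonneg fun t _ => hq.1 _)
        by_cases h1 : ∏ t, Ka ((z t).1, (z t).2.1) (z t).2.2 ≤ θ * ∏ t, Kc (z t).2.1 (z t).2.2 <;>
        by_cases h2 : l1dist (etyp z) q ≤ ε <;> simp [hT, h1, h2]
      linarith
  rcases hI0.eq_or_lt with h0 | hpos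
  · refine ⟨0, fun m _ K _ _ _ => ⟨1, 0, by linarith, ?_, ?_⟩⟩
    · intro x y _ _ hy0 hy1 hxy
      have hc : Fintype.card K ≠ 0 := Fintype.card_ne_zero
      have := pow_le_of_le_one (by linarith : 0 ≤ 1 - y) (by linarith) hc
      linarith
    · refine le_trans (le_of_eq (Finset.sum_eq_zero fun z _ => ?_)) (by linarith)
      by_cases hz : ∀ t, 0 < q (z t)
      · rw [if_pos, mul_zero]
        rw [one_mul]
        exact le_of_eq (Finset.prod_congr rfl fun t _ => hIeq h0.symm _ (hz t))
      · push Not at hz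
        obtain ⟨t, ht⟩ := hz
        rw [Finset.prod_eq_zero (Finset.mem_univ t) (le_antisymm ht (hq.1 _)), zero_mul]
  · set s := δ * I / 2 with hs
    have hspos : 0 < s := by positivity
    obtain ⟨m2, hm2⟩ := rpow_big hspos (2 / ε)
    have hneg : -(I + s) < ∑ z, q z * Real.logb 2 (Kc z.2.1 z.2.2 / Ka (z.1, z.2.1) z.2.2) := by
      have : ∑ z, q z * Real.logb 2 (Kc z.2.1 z.2.2 / Ka (z.1, z.2.1) z.2.2) = -I := by
        rw [hform, ← Finset.sum_neg_distrib]
        refine Finset.sum_congr rfl fun z _ => ?_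
        rw [← mul_neg, ← Real.logb_inv, inv_div]
      rw [this]
      linarith
    obtain ⟨m3, hm3⟩ := aep hq (fun z => Kc z.2.1 z.2.2) (fun z => Ka (z.1, z.2.1) z.2.2) hd hn
      hneg (half_pos (half_pos hε))
    refine ⟨max m2 m3, fun m hm K _ _ hK => ⟨(2:ℝ) ^ ((m:ℝ) * (I + s)),
      Real.exp (-(Fintype.card K / (2:ℝ) ^ ((m:ℝ) * (I + s)))), ?_, ?_, ?_⟩⟩
    · have hcard : (0:ℝ) < Fintype.card K := by exact_mod_cast Fintype.card_pos
      have h1 : (2:ℝ) ^ ((m:ℝ) * ((1 + δ) * I)) ≤ Fintype.card K := by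
        rw [Real.le_logb_iff_rpow_le (by norm_num) hcard] at hK
        exact hK
      have h2 : (2:ℝ) ^ ((m:ℝ) * s) ≤ Fintype.card K / (2:ℝ) ^ ((m:ℝ) * (I + s)) := by
        rw [le_div_iff₀ (by positivity), ← Real.rpow_add (by norm_num)]
        refine le_trans (le_of_eq ?_) h1
        congr 1
        rw [hs]; ring
      have h3 := (hm2 m (le_trans (le_max_left _ _) hm)).trans h2
      set x := (Fintype.card K : ℝ) / (2:ℝ) ^ ((m:ℝ) * (I + s))
      have hx : 0 < x := lt_of_lt_of_le (by positivity) h3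
      have h4 := Real.add_one_le_exp x
      rw [Real.exp_neg]
      rw [div_le_iff₀ hε] at h3
      rw [inv_le_comm₀ (Real.exp_pos _) (by positivity)]
      have : (ε / 2)⁻¹ ≤ x := by
        rw [inv_le_iff_one_le_mul₀ (by positivity)]
        linarith
      linarith
    · intro x y hx0 hx1 _ hy1 hxy
      exact cover_ineq _ (by positivity) hx0 hx1 hy1 hxy
    · refine le_trans (le_of_eq (Finset.sum_congr rfl fun z _ => ?_))
        (hm3 m (le_trans (le_max_right _ _) hm))
      congr 1
      have : (2:ℝ) ^ ((m:ℝ) * -(I + s)) = ((2:ℝ) ^ ((m:ℝ) * (I + s)))⁻¹ := by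
        rw [← Real.rpow_neg (by norm_num)]; congr 1; ring
      simp only [this]
      have hiff : (∏ t, Ka ((z t).1, (z t).2.1) (z t).2.2 ≤
          (2:ℝ) ^ ((m:ℝ) * (I + s)) * ∏ t, Kc (z t).2.1 (z t).2.2) ↔
          (((2:ℝ) ^ ((m:ℝ) * (I + s)))⁻¹ * ∏ t, Ka ((z t).1, (z t).2.1) (z t).2.2 ≤
            ∏ t, Kc (z t).2.1 (z t).2.2) := by
        rw [inv_mul_le_iff₀ (by positivity)]
      simp only [hiff]

/-- Averaged joint law of a block of random letters. -/
lemma avg_dist {Ω Z : Type} [Fintype Ω] [Fintype Z] {P : Ω → ℝ} (hP : IsPMF P) {m : ℕ}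
    (hm : 0 < m) (h : Ω → Fin m → Z) (q : Z → ℝ) (hq : IsPMF q) (ε : ℝ) (hε : 0 ≤ ε) :
    l1dist (fun z => (1 / (m:ℝ)) * ∑ t, ∑ ω, P ω * (if h ω t = z then 1 else 0)) q ≤
      ε + 2 * ∑ ω, P ω * (if l1dist (etyp (h ω)) q ≤ ε then 0 else 1) := by
  have hmR : (0:ℝ) < m := by exact_mod_cast hm
  have e : ∀ z, (1 / (m:ℝ)) * ∑ t, ∑ ω, P ω * (if h ω t = z then (1:ℝ) else 0) - q z =
      ∑ ω, P ω * (etyp (h ω) z - q z) := by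
    intro z
    simp_rw [mul_sub]
    rw [Finset.sum_sub_distrib, ← Finset.sum_mul, hP.2, one_mul, Finset.sum_comm, Finset.mul_sum]
    congr 1
    refine Finset.sum_congr rfl fun ω _ => ?_
    unfold etyp
    rw [← Finset.mul_sum]
    ring
  have h2 : ∀ ω, l1dist (etyp (h ω)) q ≤ 2 := by
    intro ω
    unfold l1dist
    calc ∑ a, |etyp (h ω) a - q a| ≤ ∑ a, (etyp (h ω) a + q a) := by
          apply Finset.sum_le_sum
          intro a _
          have h1 : 0 ≤ etyp (h ω) a := by
            unfold etyp
            exact mul_nonneg (by positivity)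
              (Finset.sum_nonneg fun _ _ => by split_ifs <;> norm_num)
          have h3 := hq.1 a
          rw [abs_le]
          constructor <;> linarith
      _ = 2 := by
          rw [Finset.sum_add_distrib, hq.2]
          unfold etyp
          rw [← Finset.mul_sum, Finset.sum_comm]
          simp
          field_simp
          norm_num
  unfold l1dist
  simp_rw [e]
  calc ∑ a, |∑ ω, P ω * (etyp (h ω) a - q a)| ≤ ∑ a, ∑ ω, P ω * |etyp (h ω) a - q a| := by
        apply Finset.sum_le_sum
        intro a _
        refine (Finset.abs_sum_le_sum_abs _ _).trans (le_of_eq ?_)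
        refine Finset.sum_congr rfl fun ω _ => ?_
        rw [abs_mul, abs_of_nonneg (hP.1 ω)]
    _ = ∑ ω, P ω * l1dist (etyp (h ω)) q := by
        rw [Finset.sum_comm]
        refine Finset.sum_congr rfl fun ω _ => ?_
        unfold l1dist
        rw [Finset.mul_sum]
    _ ≤ ∑ ω, P ω * (ε + 2 * (if l1dist (etyp (h ω)) q ≤ ε then 0 else 1)) := by
        apply Finset.sum_le_sum
        intro ω _
        apply mul_le_mul_of_nonneg_left _ (hP.1 ω)
        have := h2 ω
        split_ifs <;> linarith
    _ = _ := by
        simp_rw [mul_add]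
        rw [Finset.sum_add_distrib, ← Finset.sum_mul, hP.2, one_mul, Finset.mul_sum]
        congr 1
        refine Finset.sum_congr rfl fun ω _ => ?_
        have e2 : l1dist (etyp (h ω)) q = ∑ x, |etyp (h ω) x - q x| := rfl
        simp only [e2]
        ring


/-- Average error probability for a general (one-shot) broadcast code, `M2` known at receiver 1. -/
def gerr {A B1 B2 K1 K2 : Type} [Fintype B1] [Fintype B2] [Fintype K1] [Fintype K2]
    (V : A → B1 × B2 → ℝ) (f : K1 × K2 → A) (g1 : B1 × K2 → K1) (g2 : B2 → K2) : ℝ :=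
  (1 : ℝ) / ((Fintype.card K1 : ℝ) * (Fintype.card K2 : ℝ)) *
    ∑ m : K1 × K2, ∑ b : B1 × B2,
      V (f m) b * (if g1 (b.1, m.2) = m.1 ∧ g2 b.2 = m.2 then 0 else 1)

/-- Superposition codebook law (one satellite cluster). -/
def cbLaw {C A K1 : Type} [Fintype K1] (pc : C → ℝ) (px : C → A → ℝ) (w : C × (K1 → A)) : ℝ :=
  pc w.1 * ∏ k, px w.1 (w.2 k)

section cb
variable {C A K1 : Type} [Fintype C] [Fintype A] [Fintype K1] [DecidableEq K1]
  {pc : C → ℝ} {px : C → A → ℝ}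

lemma cbLaw_pmf (hpc : IsPMF pc) (hpx : IsChannel px) :
    IsPMF (cbLaw pc px : C × (K1 → A) → ℝ) := by
  refine ⟨fun w => mul_nonneg (hpc.1 _) (Finset.prod_nonneg fun k _ => (hpx _).1 _), ?_⟩
  unfold cbLaw
  rw [Fintype.sum_prod_type]
  dsimp only
  simp_rw [← Finset.mul_sum]
  refine Eq.trans (Finset.sum_congr rfl fun c _ => ?_) hpc.2
  rw [(sum_pi_prod_pmf (fun _ : K1 => px c) (fun _ => hpx c)).2, mul_one]

lemma cbLaw_single (hpx : IsChannel px) (i : K1) (h : C → A → ℝ) :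
    ∑ w : C × (K1 → A), cbLaw pc px w * h w.1 (w.2 i) = ∑ c, pc c * ∑ a, px c a * h c a := by
  unfold cbLaw
  rw [Fintype.sum_prod_type]
  refine Finset.sum_congr rfl fun c _ => ?_
  dsimp only
  simp_rw [mul_assoc]
  rw [← Finset.mul_sum, pi_single (hpx c) i (h c)]

lemma cbLaw_pair (hpx : IsChannel px) {i j : K1} (hij : i ≠ j) (g h : C → A → ℝ) :
    ∑ w : C × (K1 → A), cbLaw pc px w * (g w.1 (w.2 i) * h w.1 (w.2 j)) =
      ∑ c, pc c * ((∑ a, px c a * g c a) * ∑ a, px c a * h c a) := by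
  unfold cbLaw
  rw [Fintype.sum_prod_type]
  refine Finset.sum_congr rfl fun c _ => ?_
  dsimp only
  simp_rw [mul_assoc]
  rw [← Finset.mul_sum, pi_pair (hpx c) hij (g c) (h c)]

lemma cbLaw_fst [Nonempty K1] (hpx : IsChannel px) (h : C → ℝ) :
    ∑ w : C × (K1 → A), cbLaw pc px w * h w.1 = ∑ c, pc c * h c := by
  have := cbLaw_single (pc := pc) hpx (Classical.arbitrary K1) (fun c _ => h c)
  rw [this]
  refine Finset.sum_congr rfl fun c _ => ?_
  rw [← Finset.sum_mul, (hpx c).2, one_mul]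
end cb

section oneshot
variable {C A B1 B2 K1 K2 : Type} [Fintype C] [Fintype A] [Fintype B1] [Fintype B2]
    [Fintype K1] [Fintype K2] [Nonempty K1] [Nonempty K2] [DecidableEq K1] [DecidableEq K2]

lemma oneshot_err (V : A → B1 × B2 → ℝ) (hV : IsChannel V)
    (T1 : A → C → B1 → Prop) (T2 : C → B2 → Prop) (w : K2 → C × (K1 → A)) :
    ∃ (f : K1 × K2 → A) (g1 : B1 × K2 → K1) (g2 : B2 → K2),
      gerr V f g1 g2 ≤ (1 : ℝ) / ((Fintype.card K1 : ℝ) * (Fintype.card K2 : ℝ)) *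
        ∑ m : K1 × K2,
          (∑ b, margW1 V ((w m.2).2 m.1) b * (if T1 ((w m.2).2 m.1) (w m.2).1 b then 0 else 1)
          + ∑ k ∈ univ.erase m.1, ∑ b, margW1 V ((w m.2).2 m.1) b *
              (if T1 ((w m.2).2 k) (w m.2).1 b then 1 else 0)
          + ∑ b, margW2 V ((w m.2).2 m.1) b * (if T2 (w m.2).1 b then 0 else 1)
          + ∑ l ∈ univ.erase m.2, ∑ b, margW2 V ((w m.2).2 m.1) b *
              (if T2 (w l).1 b then 1 else 0)) := by
  refine ⟨fun m => (w m.2).2 m.1,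
    fun b => if h : ∃ k, T1 ((w b.2).2 k) (w b.2).1 b.1 then h.choose else Classical.arbitrary K1,
    fun b => if h : ∃ l, T2 (w l).1 b then h.choose else Classical.arbitrary K2, ?_⟩
  unfold gerr
  apply mul_le_mul_of_nonneg_left _ (by positivity)
  apply Finset.sum_le_sum
  intro m _
  have e1 : ∀ g : B1 → ℝ, ∑ b, margW1 V ((w m.2).2 m.1) b * g b =
      ∑ b : B1 × B2, V ((w m.2).2 m.1) b * g b.1 := by
    intro g
    rw [Fintype.sum_prod_type]
    unfold margW1
    simp_rw [Finset.sum_mul]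
  have e2 : ∀ g : B2 → ℝ, ∑ b, margW2 V ((w m.2).2 m.1) b * g b =
      ∑ b : B1 × B2, V ((w m.2).2 m.1) b * g b.2 := by
    intro g
    rw [Fintype.sum_prod_type, Finset.sum_comm]
    unfold margW2
    simp_rw [Finset.sum_mul]
  simp_rw [e1, e2]
  rw [Finset.sum_comm (s := univ.erase m.1), Finset.sum_comm (s := univ.erase m.2)]
  rw [← Finset.sum_add_distrib, ← Finset.sum_add_distrib, ← Finset.sum_add_distrib]
  apply Finset.sum_le_sum
  intro b _
  rw [← Finset.mul_sum, ← Finset.mul_sum, ← mul_add, ← mul_add, ← mul_add]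
  apply mul_le_mul_of_nonneg_left _ ((hV _).1 _)
  have n1 : 0 ≤ ∑ i ∈ univ.erase m.1, (if T1 ((w m.2).2 i) (w m.2).1 b.1 then (1:ℝ) else 0) :=
    Finset.sum_nonneg fun _ _ => by split_ifs <;> norm_num
  have n2 : 0 ≤ ∑ i ∈ univ.erase m.2, (if T2 (w i).1 b.2 then (1:ℝ) else 0) :=
    Finset.sum_nonneg fun _ _ => by split_ifs <;> norm_num
  by_cases h1 : T1 ((w m.2).2 m.1) (w m.2).1 b.1
  swap
  · rw [if_neg h1]
    have : (0:ℝ) ≤ if T2 (w m.2).1 b.2 then 0 else 1 := by split_ifs <;> norm_num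
    split_ifs at this ⊢ <;> linarith
  by_cases h2 : T2 (w m.2).1 b.2
  swap
  · rw [if_neg h2, if_pos h1]
    split_ifs <;> linarith
  rw [if_pos h1, if_pos h2]
  by_cases h3 : ∃ k, k ≠ m.1 ∧ T1 ((w m.2).2 k) (w m.2).1 b.1
  · obtain ⟨k, hk, hT⟩ := h3
    have : (1:ℝ) ≤ ∑ i ∈ univ.erase m.1, (if T1 ((w m.2).2 i) (w m.2).1 b.1 then (1:ℝ) else 0) := by
      refine le_trans (le_of_eq ?_) (Finset.single_le_sum
        (f := fun i => if T1 ((w m.2).2 i) (w m.2).1 b.1 then (1:ℝ) else 0)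
        (fun i _ => by split_ifs <;> norm_num) (Finset.mem_erase.2 ⟨hk, Finset.mem_univ k⟩))
      simp [hT]
    split_ifs <;> linarith
  by_cases h4 : ∃ k, k ≠ m.2 ∧ T2 (w k).1 b.2
  · obtain ⟨k, hk, hT⟩ := h4
    have : (1:ℝ) ≤ ∑ i ∈ univ.erase m.2, (if T2 (w i).1 b.2 then (1:ℝ) else 0) := by
      refine le_trans (le_of_eq ?_) (Finset.single_le_sum
        (f := fun i => if T2 (w i).1 b.2 then (1:ℝ) else 0)
        (fun i _ => by split_ifs <;> norm_num) (Finset.mem_erase.2 ⟨hk, Finset.mem_univ k⟩))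
      simp [hT]
    split_ifs <;> linarith
  push Not at h3 h4
  rw [if_pos]
  · linarith
  · have x1 : ∃ k, T1 ((w m.2).2 k) (w m.2).1 b.1 := ⟨_, h1⟩
    have x2 : ∃ l, T2 (w l).1 b.2 := ⟨_, h2⟩
    constructor
    · rw [dif_pos x1]
      by_contra hne
      exact h3 _ hne x1.choose_spec
    · rw [dif_pos x2]
      by_contra hne
      exact h4 _ hne x2.choose_spec

lemma oneshot (pc : C → ℝ) (hpc : IsPMF pc) (px : C → A → ℝ) (hpx : IsChannel px)
    (V : A → B1 × B2 → ℝ) (hV : IsChannel V)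
    (T1 : A → C → B1 → Prop) (T2 : C → B2 → Prop) :
    ∃ (f : K1 × K2 → A) (g1 : B1 × K2 → K1) (g2 : B2 → K2),
      gerr V f g1 g2 ≤
        ∑ c, pc c * ∑ a, px c a * ∑ b, margW1 V a b * (if T1 a c b then 0 else 1)
        + ((Fintype.card K1 : ℝ) - 1) * ∑ c, pc c * ∑ b, (∑ a, px c a * margW1 V a b) *
            ∑ a, px c a * (if T1 a c b then 1 else 0)
        + ∑ c, pc c * ∑ a, px c a * ∑ b, margW2 V a b * (if T2 c b then 0 else 1)
        + ((Fintype.card K2 : ℝ) - 1) * ∑ b, (∑ c, pc c * ∑ a, px c a * margW2 V a b) *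
            ∑ c, pc c * (if T2 c b then 1 else 0) := by
  have hμ := cbLaw_pmf (K1 := K1) hpc hpx
  have hPi := sum_pi_prod_pmf (fun _ : K2 => (cbLaw pc px : C × (K1 → A) → ℝ)) (fun _ => hμ)
  have hc1 : (0:ℝ) < Fintype.card K1 := by exact_mod_cast Fintype.card_pos
  have hc2 : (0:ℝ) < Fintype.card K2 := by exact_mod_cast Fintype.card_pos
  obtain ⟨w, hw⟩ := exists_le_avg hPi (fun w => (1 : ℝ) / ((Fintype.card K1 : ℝ) * (Fintype.card K2 : ℝ)) *
        ∑ m : K1 × K2,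
          (∑ b, margW1 V ((w m.2).2 m.1) b * (if T1 ((w m.2).2 m.1) (w m.2).1 b then 0 else 1)
          + ∑ k ∈ univ.erase m.1, ∑ b, margW1 V ((w m.2).2 m.1) b *
              (if T1 ((w m.2).2 k) (w m.2).1 b then 1 else 0)
          + ∑ b, margW2 V ((w m.2).2 m.1) b * (if T2 (w m.2).1 b then 0 else 1)
          + ∑ l ∈ univ.erase m.2, ∑ b, margW2 V ((w m.2).2 m.1) b *
              (if T2 (w l).1 b then 1 else 0)))
        (∑ c, pc c * ∑ a, px c a * ∑ b, margW1 V a b * (if T1 a c b then 0 else 1)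
        + ((Fintype.card K1 : ℝ) - 1) * ∑ c, pc c * ∑ b, (∑ a, px c a * margW1 V a b) *
            ∑ a, px c a * (if T1 a c b then 1 else 0)
        + ∑ c, pc c * ∑ a, px c a * ∑ b, margW2 V a b * (if T2 c b then 0 else 1)
        + ((Fintype.card K2 : ℝ) - 1) * ∑ b, (∑ c, pc c * ∑ a, px c a * margW2 V a b) *
            ∑ c, pc c * (if T2 c b then 1 else 0)) (by
    simp_rw [mul_left_comm _ ((1:ℝ) / _) _]
    rw [← Finset.mul_sum]
    simp_rw [Finset.mul_sum (s := (univ : Finset (K1 × K2)))]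
    rw [Finset.sum_comm]
    rw [one_div_mul_eq_div, div_le_iff₀ (by positivity)]
    rw [show ∀ x : ℝ, x * ((Fintype.card K1 : ℝ) * (Fintype.card K2 : ℝ)) =
      ∑ m : K1 × K2, x by intro x; simp; ring]
    apply Finset.sum_le_sum
    intro m _
    simp_rw [mul_add]
    rw [Finset.sum_add_distrib, Finset.sum_add_distrib, Finset.sum_add_distrib]
    refine le_of_eq (congrArg₂ _ (congrArg₂ _ (congrArg₂ _ ?_ ?_) ?_) ?_)
    · have := pi_single hμ m.2 (fun z => ∑ b, margW1 V (z.2 m.1) b * (if T1 (z.2 m.1) z.1 b then 0 else 1))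
      refine this.trans ?_
      exact cbLaw_single hpx m.1 (fun c a => ∑ b, margW1 V a b * (if T1 a c b then 0 else 1))
    · simp_rw [Finset.mul_sum (s := univ.erase m.1)]
      rw [Finset.sum_comm]
      have key : ∀ k ∈ univ.erase m.1, ∑ w : K2 → C × (K1 → A), (∏ t, cbLaw pc px (w t)) *
          ∑ b, margW1 V ((w m.2).2 m.1) b * (if T1 ((w m.2).2 k) (w m.2).1 b then (1:ℝ) else 0) =
          ∑ c, pc c * ∑ b, (∑ a, px c a * margW1 V a b) *
            ∑ a, px c a * (if T1 a c b then 1 else 0) := by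
        intro k hk
        have hne : m.1 ≠ k := fun h => (Finset.mem_erase.1 hk).1 h.symm
        have := pi_single hμ m.2 (fun z => ∑ b, margW1 V (z.2 m.1) b *
          (if T1 (z.2 k) z.1 b then (1:ℝ) else 0))
        refine this.trans ?_
        simp_rw [Finset.mul_sum (s := (univ : Finset B1))]
        rw [Finset.sum_comm, Finset.sum_comm (t := (univ : Finset B1))]
        refine Finset.sum_congr rfl fun b _ => ?_
        exact cbLaw_pair hpx hne (fun c a => margW1 V a b) (fun c a => if T1 a c b then (1:ℝ) else 0)
      rw [Finset.sum_congr rfl key, Finset.sum_const, Finset.card_erase_of_mem (Finset.mem_univ _),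
        Finset.card_univ, nsmul_eq_mul, Nat.cast_sub Fintype.card_pos, Nat.cast_one]
    · have := pi_single hμ m.2 (fun z => ∑ b, margW2 V (z.2 m.1) b * (if T2 z.1 b then 0 else 1))
      refine this.trans ?_
      exact cbLaw_single hpx m.1 (fun c a => ∑ b, margW2 V a b * (if T2 c b then 0 else 1))
    · simp_rw [Finset.mul_sum (s := univ.erase m.2)]
      rw [Finset.sum_comm]
      have key : ∀ l ∈ univ.erase m.2, ∑ w : K2 → C × (K1 → A), (∏ t, cbLaw pc px (w t)) *
          ∑ b, margW2 V ((w m.2).2 m.1) b * (if T2 (w l).1 b then (1:ℝ) else 0) =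
          ∑ b, (∑ c, pc c * ∑ a, px c a * margW2 V a b) *
            ∑ c, pc c * (if T2 c b then 1 else 0) := by
        intro l hl
        have hne : m.2 ≠ l := fun h => (Finset.mem_erase.1 hl).1 h.symm
        simp_rw [Finset.mul_sum (s := (univ : Finset B2))]
        rw [Finset.sum_comm]
        refine Finset.sum_congr rfl fun b _ => ?_
        refine (pi_pair hμ hne (fun z => margW2 V (z.2 m.1) b)
          (fun z => if T2 z.1 b then (1:ℝ) else 0)).trans ?_
        congr 1
        · exact cbLaw_single hpx m.1 (fun c a => margW2 V a b)
        · exact cbLaw_fst hpx (fun c => if T2 c b then (1:ℝ) else 0)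
      rw [Finset.sum_congr rfl key, Finset.sum_const, Finset.card_erase_of_mem (Finset.mem_univ _),
        Finset.card_univ, nsmul_eq_mul, Nat.cast_sub Fintype.card_pos, Nat.cast_one])
  obtain ⟨f, g1, g2, hfg⟩ := oneshot_err V hV T1 T2 w
  exact ⟨f, g1, g2, hfg.trans hw⟩
end oneshot


lemma sum_pairFn {A C : Type} [Fintype A] [Fintype C] (m : ℕ) (g : (Fin m → A × C) → ℝ) :
    ∑ z : Fin m → A × C, g z = ∑ a : Fin m → A, ∑ c : Fin m → C, g (fun t => (a t, c t)) := by
  rw [← Fintype.sum_prod_type' (f := fun (a : Fin m → A) (c : Fin m → C) => g (fun t => (a t, c t)))]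
  refine Fintype.sum_equiv (Equiv.arrowProdEquivProdArrow (Fin m) (fun _ => A) (fun _ => C)) _ _ fun z => ?_
  rfl

lemma ch_sel {Z : Type} [Fintype Z] (R num den : Z → ℝ) (hR : ∀ z, 0 ≤ R z)
    (hn : ∀ z, 0 ≤ num z) (hd : ∀ z, 0 ≤ den z)
    (hP : IsPMF (fun z => R z * num z)) (hpos : ∀ z, 0 < R z * num z → 0 < den z)
    {r ε : ℝ} (hr0 : 0 ≤ r) (hε : 0 < ε)
    (hr : r < ∑ z, R z * num z * Real.logb 2 (num z / den z) ∨ r = 0) :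
    ∃ N0 : ℕ, ∀ N : ℕ, N0 ≤ N → ∃ k : ℕ, 0 < k ∧ (N:ℝ) * r ≤ Real.logb 2 k ∧
      ∃ T : (Fin N → Z) → Prop,
        ∑ z, (∏ t, R (z t) * num (z t)) * (if T z then 0 else 1)
          + ((k:ℝ) - 1) * ∑ z, (∏ t, R (z t) * den (z t)) * (if T z then 1 else 0) ≤ ε := by
  rcases hr with hr | hr
  · set J := ∑ z, R z * num z * Real.logb 2 (num z / den z) with hJ
    have hn' : ∀ z, 0 < R z * num z → 0 < num z := fun z h => by
      rcases (hn z).eq_or_lt with h0 | h0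
      · rw [← h0, mul_zero] at h; exact absurd h (lt_irrefl _)
      · exact h0
    obtain ⟨N1, h1⟩ := aep hP num den hn' hpos (ρ := (r + J) / 2) (η := ε / 2) (by linarith)
      (by linarith)
    obtain ⟨N2, h2⟩ := rpow_big (s := (J - r) / 2) (by linarith) (2 / ε)
    refine ⟨max N1 N2, fun N hN => ⟨⌈(2:ℝ) ^ ((N:ℝ) * r)⌉₊, ?_, ?_, fun z =>
      (2:ℝ) ^ (N * ((r + J) / 2)) * ∏ t, den (z t) ≤ ∏ t, num (z t), ?_⟩⟩
    · exact Nat.ceil_pos.2 (by positivity)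
    · rw [Real.le_logb_iff_rpow_le (by norm_num)]
      · exact Nat.le_ceil _
      · exact_mod_cast Nat.ceil_pos.2 (by positivity)
    · have a1 := h1 N (le_trans (le_max_left _ _) hN)
      have a2 := h2 N (le_trans (le_max_right _ _) hN)
      have a3 : ∑ z : Fin N → Z, (∏ t, R (z t) * den (z t)) *
          (if (2:ℝ) ^ (N * ((r + J) / 2)) * ∏ t, den (z t) ≤ ∏ t, num (z t) then (1:ℝ) else 0) ≤
          ((2:ℝ) ^ (N * ((r + J) / 2)))⁻¹ := by
        have hpm := sum_pi_prod_pmf (fun _ : Fin N => fun z => R z * num z) (fun _ => hP)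
        calc _ ≤ ∑ z : Fin N → Z, ((2:ℝ) ^ (N * ((r + J) / 2)))⁻¹ * ∏ t, R (z t) * num (z t) := by
              apply Finset.sum_le_sum
              intro z _
              split_ifs with h
              · rw [mul_one, Finset.prod_mul_distrib, Finset.prod_mul_distrib, mul_left_comm]
                apply mul_le_mul_of_nonneg_left _ (Finset.prod_nonneg fun t _ => hR _)
                rw [← div_eq_inv_mul, le_div_iff₀' (by positivity)]
                exact h
              · rw [mul_zero]
                exact mul_nonneg (by positivity) (hpm.1 z)
          _ = _ := by rw [← Finset.mul_sum, hpm.2, mul_one]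
      have hk : ((⌈(2:ℝ) ^ ((N:ℝ) * r)⌉₊ : ℕ) : ℝ) - 1 ≤ (2:ℝ) ^ ((N:ℝ) * r) := by
        have := Nat.ceil_lt_add_one (show (0:ℝ) ≤ (2:ℝ) ^ ((N:ℝ) * r) by positivity)
        linarith
      have a4 : (2:ℝ) ^ ((N:ℝ) * r) * ((2:ℝ) ^ (N * ((r + J) / 2)))⁻¹ ≤ ε / 2 := by
        have : (2:ℝ) ^ ((N:ℝ) * r) * ((2:ℝ) ^ (N * ((r + J) / 2)))⁻¹ =
            ((2:ℝ) ^ ((N:ℝ) * ((J - r) / 2)))⁻¹ := by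
          rw [← Real.rpow_neg (by norm_num), ← Real.rpow_neg (by norm_num),
            ← Real.rpow_add (by norm_num)]
          congr 1; ring
        rw [this, inv_le_comm₀ (by positivity) (by positivity)]
        rw [inv_div]; exact a2
      have a5 : (0:ℝ) ≤ ∑ z : Fin N → Z, (∏ t, R (z t) * den (z t)) *
          (if (2:ℝ) ^ (N * ((r + J) / 2)) * ∏ t, den (z t) ≤ ∏ t, num (z t) then (1:ℝ) else 0) :=
        Finset.sum_nonneg fun z _ => mul_nonneg (Finset.prod_nonneg fun t _ =>
          mul_nonneg (hR _) (hd _)) (by split_ifs <;> norm_num)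
      have a6 := mul_le_mul hk a3 a5 (by positivity)
      linarith
  · refine ⟨0, fun N _ => ⟨1, one_pos, by simp [hr], fun _ => True, ?_⟩⟩
    simp [hε.le]

lemma nFold_channel {A B1 B2 : Type} [Fintype B1] [Fintype B2] {V : A → B1 × B2 → ℝ}
    (hV : IsChannel V) (N : ℕ) : IsChannel (nFold V N) := by
  intro x
  refine ⟨fun y => Finset.prod_nonneg fun t _ => (hV _).1 _, ?_⟩
  rw [Fintype.sum_prod_type]
  unfold nFold
  dsimp only
  have := sum_pairFn N (fun y : Fin N → B1 × B2 => ∏ t, V (x t) (y t))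
  rw [← this, sum_pi_prod]
  exact Finset.prod_eq_one fun t _ => (hV _).2

lemma margW1_nFold {A B1 B2 : Type} [Fintype B1] [Fintype B2] (V : A → B1 × B2 → ℝ)
    (N : ℕ) (x : Fin N → A) (y : Fin N → B1) :
    margW1 (nFold V N) x y = ∏ t, margW1 V (x t) (y t) := by
  unfold margW1 nFold
  exact sum_pi_prod (fun t b => V (x t) (y t, b))

lemma margW2_nFold {A B1 B2 : Type} [Fintype B1] [Fintype B2] (V : A → B1 × B2 → ℝ)
    (N : ℕ) (x : Fin N → A) (y : Fin N → B2) :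
    margW2 (nFold V N) x y = ∏ t, margW2 V (x t) (y t) := by
  unfold margW2 nFold
  exact sum_pi_prod (fun t b => V (x t) (b, y t))

lemma margW1_channel {A B1 B2 : Type} [Fintype B1] [Fintype B2] {V : A → B1 × B2 → ℝ}
    (hV : IsChannel V) : IsChannel (margW1 V) := by
  intro x
  refine ⟨fun y => Finset.sum_nonneg fun t _ => (hV _).1 _, ?_⟩
  have := (hV x).2
  rwa [Fintype.sum_prod_type] at this

lemma margW2_channel {A B1 B2 : Type} [Fintype B1] [Fintype B2] {V : A → B1 × B2 → ℝ}
    (hV : IsChannel V) : IsChannel (margW2 V) := by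
  intro x
  refine ⟨fun y => Finset.sum_nonneg fun t _ => (hV _).1 _, ?_⟩
  have := (hV x).2
  rwa [Fintype.sum_prod_type, Finset.sum_comm] at this

/-- Composition of kernels. -/
def kcomp {C A B : Type} [Fintype A] (px : C → A → ℝ) (V : A → B → ℝ) (c : C) (b : B) : ℝ :=
  ∑ a, px c a * V a b

lemma kcomp_channel {C A B : Type} [Fintype A] [Fintype B] {px : C → A → ℝ} {V : A → B → ℝ}
    (hpx : IsChannel px) (hV : IsChannel V) : IsChannel (kcomp px V) := by
  intro c
  refine ⟨fun b => Finset.sum_nonneg fun a _ => mul_nonneg ((hpx c).1 a) ((hV a).1 b), ?_⟩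
  unfold kcomp
  rw [Finset.sum_comm]
  refine Eq.trans (Finset.sum_congr rfl fun a _ => ?_) (hpx c).2
  rw [← Finset.mul_sum, (hV a).2, mul_one]

lemma kcomp_prod {C A B : Type} [Fintype A] (px : C → A → ℝ) (V : A → B → ℝ) (N : ℕ)
    (c : Fin N → C) (b : Fin N → B) :
    ∑ a : Fin N → A, (∏ t, px (c t) (a t)) * ∏ t, V (a t) (b t) = ∏ t, kcomp px V (c t) (b t) := by
  simp_rw [← Finset.prod_mul_distrib]
  exact sum_pi_prod (fun t a => px (c t) a * V a (b t))

/-- Output pmf. -/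
def outp {C B : Type} [Fintype C] (pc : C → ℝ) (k : C → B → ℝ) (b : B) : ℝ := ∑ c, pc c * k c b

lemma outp_prod {C B : Type} [Fintype C] (pc : C → ℝ) (k : C → B → ℝ) (N : ℕ) (b : Fin N → B) :
    ∑ c : Fin N → C, (∏ t, pc (c t)) * ∏ t, k (c t) (b t) = ∏ t, outp pc k (b t) := by
  simp_rw [← Finset.prod_mul_distrib]
  exact sum_pi_prod (fun t c => pc c * k c (b t))

/-- `I(A;B1|C)`. -/
def J1 {C A B1 B2 : Type} [Fintype C] [Fintype A] [Fintype B1] [Fintype B2]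
    (pc : C → ℝ) (px : C → A → ℝ) (V : A → B1 × B2 → ℝ) : ℝ :=
  ∑ z : A × C × B1, pc z.2.1 * px z.2.1 z.1 * margW1 V z.1 z.2.2 *
    Real.logb 2 (margW1 V z.1 z.2.2 / kcomp px (margW1 V) z.2.1 z.2.2)

/-- `I(C;B2)`. -/
def J2 {C A B1 B2 : Type} [Fintype C] [Fintype A] [Fintype B1] [Fintype B2]
    (pc : C → ℝ) (px : C → A → ℝ) (V : A → B1 × B2 → ℝ) : ℝ :=
  ∑ z : C × B2, pc z.1 * kcomp px (margW2 V) z.1 z.2 *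
    Real.logb 2 (kcomp px (margW2 V) z.1 z.2 / outp pc (kcomp px (margW2 V)) z.2)

section
variable {C A B1 B2 : Type} [Fintype C] [Fintype A] [Fintype B1] [Fintype B2]

lemma channel_coding (pc : C → ℝ) (hpc : IsPMF pc) (px : C → A → ℝ) (hpx : IsChannel px)
    (V : A → B1 × B2 → ℝ) (hV : IsChannel V) {r1 r2 ε : ℝ} (hr1 : 0 ≤ r1) (hr2 : 0 ≤ r2)
    (h1 : r1 < J1 pc px V ∨ r1 = 0) (h2 : r2 < J2 pc px V ∨ r2 = 0) (hε : 0 < ε) :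
    ∃ (N k1 k2 : ℕ), 0 < N ∧ 0 < k1 ∧ 0 < k2 ∧ (N:ℝ) * r1 ≤ Real.logb 2 k1 ∧
      (N:ℝ) * r2 ≤ Real.logb 2 k2 ∧
      ∃ (f : Fin k1 × Fin k2 → Fin N → A) (g1 : (Fin N → B1) × Fin k2 → Fin k1)
        (g2 : (Fin N → B2) → Fin k2), gerr (nFold V N) f g1 g2 ≤ ε := by
  have hV1 := margW1_channel hV
  have hV2 := margW2_channel hV
  have hk1 := kcomp_channel hpx hV1
  have hk2 := kcomp_channel hpx hV2
  have hP1 : IsPMF (fun z : A × C × B1 => pc z.2.1 * px z.2.1 z.1 * margW1 V z.1 z.2.2) := by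
    refine ⟨fun z => mul_nonneg (mul_nonneg (hpc.1 _) ((hpx _).1 _)) ((hV1 _).1 _), ?_⟩
    simp_rw [Fintype.sum_prod_type]
    rw [Finset.sum_comm]
    refine Eq.trans (Finset.sum_congr rfl fun c _ => ?_) hpc.2
    simp_rw [← Finset.mul_sum, (hV1 _).2, mul_one, ← Finset.mul_sum, (hpx c).2, mul_one]
  have hP2 : IsPMF (fun z : C × B2 => pc z.1 * kcomp px (margW2 V) z.1 z.2) := by
    refine ⟨fun z => mul_nonneg (hpc.1 _) ((hk2 _).1 _), ?_⟩
    simp_rw [Fintype.sum_prod_type]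
    refine Eq.trans (Finset.sum_congr rfl fun c _ => ?_) hpc.2
    simp_rw [← Finset.mul_sum, (hk2 _).2, mul_one]
  have ho : ∀ b, 0 ≤ outp pc (kcomp px (margW2 V)) b := fun b =>
    Finset.sum_nonneg fun c _ => mul_nonneg (hpc.1 c) ((hk2 c).1 b)
  obtain ⟨N1, hN1⟩ := ch_sel (Z := A × C × B1) (fun z => pc z.2.1 * px z.2.1 z.1)
    (fun z => margW1 V z.1 z.2.2) (fun z => kcomp px (margW1 V) z.2.1 z.2.2)
    (fun z => mul_nonneg (hpc.1 _) ((hpx _).1 _)) (fun z => (hV1 _).1 _) (fun z => (hk1 _).1 _)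
    hP1 (fun z hz => by
      unfold kcomp
      have : 0 < px z.2.1 z.1 * margW1 V z.1 z.2.2 := by
        refine lt_of_le_of_ne (mul_nonneg ((hpx _).1 _) ((hV1 _).1 _)) fun h => ?_
        rw [mul_assoc, ← h, mul_zero] at hz
        exact lt_irrefl _ hz
      exact lt_of_lt_of_le this (Finset.single_le_sum
        (f := fun a => px z.2.1 a * margW1 V a z.2.2)
        (fun a _ => mul_nonneg ((hpx _).1 _) ((hV1 _).1 _)) (Finset.mem_univ z.1)))
    hr1 (half_pos hε) h1
  obtain ⟨N2, hN2⟩ := ch_sel (Z := C × B2) (fun z => pc z.1)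
    (fun z => kcomp px (margW2 V) z.1 z.2) (fun z => outp pc (kcomp px (margW2 V)) z.2)
    (fun z => hpc.1 _) (fun z => (hk2 _).1 _) (fun z => ho _)
    hP2 (fun z hz => by
      unfold outp
      exact lt_of_lt_of_le hz (Finset.single_le_sum
        (f := fun c => pc c * kcomp px (margW2 V) c z.2)
        (fun a _ => mul_nonneg (hpc.1 _) ((hk2 _).1 _)) (Finset.mem_univ z.1)))
    hr2 (half_pos hε) h2
  set N := max (max N1 N2) 1 with hN
  obtain ⟨k1, hk1p, hk1l, T1, hT1⟩ := hN1 N ((le_max_left _ _).trans (le_max_left _ _))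
  obtain ⟨k2, hk2p, hk2l, T2, hT2⟩ := hN2 N ((le_max_right _ _).trans (le_max_left _ _))
  have : Nonempty (Fin k1) := ⟨⟨0, hk1p⟩⟩
  have : Nonempty (Fin k2) := ⟨⟨0, hk2p⟩⟩
  obtain ⟨f, g1, g2, hfg⟩ := oneshot (K1 := Fin k1) (K2 := Fin k2)
    (fun c : Fin N → C => ∏ t, pc (c t)) (sum_pi_prod_pmf (fun _ => pc) fun _ => hpc)
    (fun c (a : Fin N → A) => ∏ t, px (c t) (a t))
    (fun c => sum_pi_prod_pmf (fun t => px (c t)) fun t => hpx (c t)) (nFold V N)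
    (nFold_channel hV N) (fun a c b => T1 (fun t => (a t, c t, b t)))
    (fun c b => T2 (fun t => (c t, b t)))
  refine ⟨N, k1, k2, by omega, hk1p, hk2p, hk1l, hk2l, f, g1, g2, hfg.trans ?_⟩
  rw [sum_triple, sum_triple] at hT1
  rw [sum_pairFn, sum_pairFn] at hT2
  simp only [Fintype.card_fin, margW1_nFold, margW2_nFold, kcomp_prod, outp_prod]
  have x1 : ∑ c : Fin N → C, (∏ t, pc (c t)) * ∑ a : Fin N → A, (∏ t, px (c t) (a t)) *
      ∑ b : Fin N → B1, (∏ t, margW1 V (a t) (b t)) *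
        (if T1 (fun t => (a t, c t, b t)) then (0:ℝ) else 1) =
      ∑ a : Fin N → A, ∑ c : Fin N → C, ∑ b : Fin N → B1,
        (∏ t, pc (c t) * px (c t) (a t) * margW1 V (a t) (b t)) *
        (if T1 (fun t => (a t, c t, b t)) then (0:ℝ) else 1) := by
    rw [Finset.sum_comm (t := (univ : Finset (Fin N → C)))]
    refine Finset.sum_congr rfl fun c _ => ?_
    rw [Finset.mul_sum]
    refine Finset.sum_congr rfl fun a _ => ?_
    rw [Finset.mul_sum, Finset.mul_sum]
    refine Finset.sum_congr rfl fun b _ => ?_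
    simp only [Finset.prod_mul_distrib]
    ring
  have x2 : ∑ c : Fin N → C, (∏ t, pc (c t)) * ∑ b : Fin N → B1,
      (∏ t, kcomp px (margW1 V) (c t) (b t)) * ∑ a : Fin N → A, (∏ t, px (c t) (a t)) *
        (if T1 (fun t => (a t, c t, b t)) then (1:ℝ) else 0) =
      ∑ a : Fin N → A, ∑ c : Fin N → C, ∑ b : Fin N → B1,
        (∏ t, pc (c t) * px (c t) (a t) * kcomp px (margW1 V) (c t) (b t)) *
        (if T1 (fun t => (a t, c t, b t)) then (1:ℝ) else 0) := by
    rw [Finset.sum_comm (t := (univ : Finset (Fin N → C)))]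
    refine Finset.sum_congr rfl fun c _ => ?_
    rw [Finset.mul_sum, Finset.sum_comm]
    refine Finset.sum_congr rfl fun b _ => ?_
    rw [Finset.mul_sum, Finset.mul_sum]
    refine Finset.sum_congr rfl fun a _ => ?_
    simp only [Finset.prod_mul_distrib]
    ring
  have x3 : ∑ c : Fin N → C, (∏ t, pc (c t)) * ∑ a : Fin N → A, (∏ t, px (c t) (a t)) *
      ∑ b : Fin N → B2, (∏ t, margW2 V (a t) (b t)) *
        (if T2 (fun t => (c t, b t)) then (0:ℝ) else 1) =
      ∑ c : Fin N → C, ∑ b : Fin N → B2, (∏ t, pc (c t) * kcomp px (margW2 V) (c t) (b t)) *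
        (if T2 (fun t => (c t, b t)) then (0:ℝ) else 1) := by
    refine Finset.sum_congr rfl fun c _ => ?_
    simp_rw [Finset.mul_sum]
    rw [Finset.sum_comm]
    refine Finset.sum_congr rfl fun b _ => ?_
    simp only [Finset.prod_mul_distrib, ← kcomp_prod, Finset.mul_sum, Finset.sum_mul]
    refine Finset.sum_congr rfl fun a _ => ?_
    ring
  have x4 : ∑ b : Fin N → B2, (∏ t, outp pc (kcomp px (margW2 V)) (b t)) *
      ∑ c : Fin N → C, (∏ t, pc (c t)) * (if T2 (fun t => (c t, b t)) then (1:ℝ) else 0) =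
      ∑ c : Fin N → C, ∑ b : Fin N → B2, (∏ t, pc (c t) * outp pc (kcomp px (margW2 V)) (b t)) *
        (if T2 (fun t => (c t, b t)) then (1:ℝ) else 0) := by
    rw [Finset.sum_comm]
    refine Finset.sum_congr rfl fun b _ => ?_
    rw [Finset.mul_sum]
    refine Finset.sum_congr rfl fun c _ => ?_
    simp only [Finset.prod_mul_distrib]
    ring
  rw [x1, x2, x3, x4]
  linarith
end


/-- Flatten a block of blocks. -/
def blkE (L n : ℕ) (X : Type) : (Fin L → Fin n → X) ≃ (Fin (L * n) → X) :=
  (Equiv.curry (Fin L) (Fin n) X).symm.trans (Equiv.arrowCongr finProdFinEquiv (Equiv.refl X))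

lemma nFold_blk {X Y1 Y2 : Type} (W : X → Y1 × Y2 → ℝ) (L n : ℕ) (x : Fin L → Fin n → X)
    (y : (Fin L → Fin n → Y1) × (Fin L → Fin n → Y2)) :
    nFold W (L * n) (blkE L n X x) (blkE L n Y1 y.1, blkE L n Y2 y.2) =
      nFold (nFold W n) L x y := by
  unfold nFold
  dsimp only
  rw [← Fintype.prod_prod_type' (f := fun (l : Fin L) (t : Fin n) => W (x l t) (y.1 l t, y.2 l t))]
  symm
  refine Fintype.prod_equiv finProdFinEquiv _ _ fun p => ?_
  simp [blkE, Function.uncurry]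

lemma gerr_transport {X Y1 Y2 K1 K2 : Type} [Fintype Y1] [Fintype Y2] [Fintype K1] [Fintype K2]
    (W : X → Y1 × Y2 → ℝ) (L n : ℕ) (f : K1 × K2 → Fin L → Fin n → X)
    (g1 : (Fin L → Fin n → Y1) × K2 → K1) (g2 : (Fin L → Fin n → Y2) → K2) :
    gerr (nFold W (L * n)) (fun m => blkE L n X (f m))
      (fun b => g1 ((blkE L n Y1).symm b.1, b.2)) (fun b => g2 ((blkE L n Y2).symm b)) =
    gerr (nFold (nFold W n) L) f g1 g2 := by
  unfold gerr
  congr 1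
  refine Finset.sum_congr rfl fun m _ => ?_
  symm
  refine Fintype.sum_equiv ((blkE L n Y1).prodCongr (blkE L n Y2)) _ _ fun b => ?_
  have h := nFold_blk W L n (f m) b
  rw [← h]
  simp
  rfl

lemma errP1_eq_gerr {X Y1 Y2 : Type} [Fintype Y1] [Fintype Y2] (W : X → Y1 × Y2 → ℝ)
    (n k1 k2 : ℕ) (f : Fin k1 × Fin k2 → Fin n → X)
    (g1 : (Fin n → Y1) × Fin k2 → Fin k1) (g2 : (Fin n → Y2) → Fin k2) :
    errP1 W n k1 k2 f g1 g2 = gerr (nFold W n) f g1 g2 := by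
  unfold errP1 gerr
  simp only [Fintype.card_fin]
  congr 1
  refine Finset.sum_congr rfl fun m _ => Finset.sum_congr rfl fun y _ => ?_
  congr

section rep
variable {A B1 B2 K1 K2 : Type} [Fintype B1] [Fintype B2]
    [Fintype K1] [Fintype K2] [Nonempty K1] [Nonempty K2]

lemma gerr_repeat (V : A → B1 × B2 → ℝ) (hV : IsChannel V) (f : K1 × K2 → A)
    (g1 : B1 × K2 → K1) (g2 : B2 → K2) (L : ℕ) :
    gerr (K1 := Fin L → K1) (K2 := Fin L → K2) (nFold V L) (fun m l => f (m.1 l, m.2 l))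
      (fun b l => g1 (b.1 l, b.2 l)) (fun b l => g2 (b l)) ≤ L * gerr V f g1 g2 := by
  have hc1 : (0:ℝ) < Fintype.card K1 := by exact_mod_cast Fintype.card_pos
  have hc2 : (0:ℝ) < Fintype.card K2 := by exact_mod_cast Fintype.card_pos
  set w : ℝ := 1 / ((Fintype.card K1 : ℝ) * (Fintype.card K2 : ℝ)) with hw
  have hwpos : 0 < w := by positivity
  set p : (K1 × K2) × (B1 × B2) → ℝ := fun z => w * V (f z.1) z.2 with hpdef
  have hp : IsPMF p := by
    refine ⟨fun z => mul_nonneg hwpos.le ((hV _).1 _), ?_⟩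
    rw [Fintype.sum_prod_type]
    simp only [hpdef, ← Finset.mul_sum, (hV _).2]
    simp [hw]
    field_simp
  set e : (K1 × K2) × (B1 × B2) → ℝ := fun z =>
    if g1 (z.2.1, z.1.2) = z.1.1 ∧ g2 z.2.2 = z.1.2 then 0 else 1 with he
  have e1 : gerr V f g1 g2 = ∑ z, p z * e z := by
    rw [Fintype.sum_prod_type]
    unfold gerr
    rw [Finset.mul_sum]
    refine Finset.sum_congr rfl fun m _ => ?_
    rw [Finset.mul_sum]
    refine Finset.sum_congr rfl fun b _ => ?_
    simp only [hpdef, he, mul_assoc, hw]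
  have e2 : gerr (K1 := Fin L → K1) (K2 := Fin L → K2) (nFold V L) (fun m l => f (m.1 l, m.2 l))
      (fun b l => g1 (b.1 l, b.2 l)) (fun b l => g2 (b l)) ≤
      ∑ z : Fin L → (K1 × K2) × (B1 × B2), (∏ t, p (z t)) * ∑ l, e (z l) := by
    rw [sum_pairFn, sum_pairFn]
    simp_rw [sum_pairFn L (A := B1) (C := B2)]
    unfold gerr
    rw [Fintype.sum_prod_type, Finset.mul_sum]
    apply Finset.sum_le_sum; intro m1 _
    rw [Finset.mul_sum]
    apply Finset.sum_le_sum; intro m2 _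
    rw [Finset.mul_sum, Fintype.sum_prod_type]
    apply Finset.sum_le_sum; intro b1 _
    apply Finset.sum_le_sum; intro b2 _
    have hw' : (1:ℝ) / ((Fintype.card (Fin L → K1) : ℝ) * (Fintype.card (Fin L → K2) : ℝ)) = w ^ L := by
      simp [hw, mul_pow]
    rw [hw', ← mul_assoc]
    have hprod : w ^ L * nFold V L (fun l => f (m1 l, m2 l)) (b1, b2) =
        ∏ t, p ((m1 t, m2 t), (b1 t, b2 t)) := by
      simp only [hpdef, nFold, Finset.prod_mul_distrib, Finset.prod_const, Finset.card_univ,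
        Fintype.card_fin]
    rw [hprod]
    apply mul_le_mul_of_nonneg_left _ (Finset.prod_nonneg fun t _ => hp.1 _)
    have en : ∀ z, 0 ≤ e z := fun z => by simp only [he]; split_ifs <;> norm_num
    split_ifs with h
    · exact Finset.sum_nonneg fun _ _ => en _
    · have : ∃ l, ¬ (g1 (b1 l, m2 l) = m1 l ∧ g2 (b2 l) = m2 l) := by
        by_contra hcon
        push Not at hcon
        exact h ⟨funext fun l => (hcon l).1, funext fun l => (hcon l).2⟩
      obtain ⟨l, hl⟩ := this
      refine le_trans (le_of_eq ?_) (Finset.single_le_sum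
        (f := fun l => e ((m1 l, m2 l), (b1 l, b2 l))) (fun _ _ => en _) (Finset.mem_univ l))
      simp only [he, if_neg hl]
  refine e2.trans (le_of_eq ?_)
  simp_rw [Finset.mul_sum]
  rw [Finset.sum_comm]
  simp_rw [pi_single hp _ e, ← e1]
  simp

lemma gerr_shift [AddCommGroup K1] [AddCommGroup K2] (V : A → B1 × B2 → ℝ) (f : K1 × K2 → A)
    (g1 : B1 × K2 → K1) (g2 : B2 → K2) (π : K1 × K2 → ℝ) (hπ : IsPMF π) :
    ∃ (f' : K1 × K2 → A) (g1' : B1 × K2 → K1) (g2' : B2 → K2),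
      ∑ m, π m * ∑ b : B1 × B2, V (f' m) b *
        (if g1' (b.1, m.2) = m.1 ∧ g2' b.2 = m.2 then 0 else 1) ≤ gerr V f g1 g2 := by
  have hc1 : (0:ℝ) < Fintype.card K1 := by exact_mod_cast Fintype.card_pos
  have hc2 : (0:ℝ) < Fintype.card K2 := by exact_mod_cast Fintype.card_pos
  set e : K1 × K2 → ℝ := fun m => ∑ b : B1 × B2, V (f m) b *
        (if g1 (b.1, m.2) = m.1 ∧ g2 b.2 = m.2 then 0 else 1) with he
  have hunif : IsPMF (fun _ : K1 × K2 => (1:ℝ) / ((Fintype.card K1 : ℝ) * (Fintype.card K2 : ℝ))) := by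
    refine ⟨fun _ => by positivity, ?_⟩
    simp
    field_simp
  obtain ⟨θ, hθ⟩ := exists_le_avg hunif (fun θ => ∑ m, π m * e (m + θ)) (gerr V f g1 g2) (by
    have hg : gerr V f g1 g2 = (1:ℝ) / ((Fintype.card K1 : ℝ) * (Fintype.card K2 : ℝ)) * ∑ m, e m := rfl
    rw [← Finset.mul_sum, Finset.sum_comm, hg]
    refine le_of_eq ?_
    congr 1
    have : ∀ m : K1 × K2, ∑ θ, π m * e (m + θ) = π m * ∑ m, e m := by
      intro m
      rw [← Finset.mul_sum]
      congr 1
      exact Fintype.sum_equiv (Equiv.addLeft m) _ _ fun _ => rfl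
    simp_rw [this]
    rw [← Finset.sum_mul, hπ.2, one_mul])
  refine ⟨fun m => f (m + θ), fun b => g1 (b.1, b.2 + θ.2) - θ.1, fun b => g2 b - θ.2,
    le_trans (le_of_eq ?_) hθ⟩
  refine Finset.sum_congr rfl fun m _ => ?_
  congr 1
  simp only [he, sub_eq_iff_eq_add, Prod.fst_add, Prod.snd_add]
end rep

lemma good_code {X Y1 Y2 : Type} [Fintype Y1] [Fintype Y2]
    {W : X → Y1 × Y2 → ℝ} (hW : IsChannel W) {r : ℝ × ℝ} (hr : Ach1 W r) {L : ℕ} (hL : 0 < L)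
    {ε : ℝ} (hε : 0 < ε) :
    ∃ (n0 : ℕ) (K1 K2 : Type) (_ : Fintype K1) (_ : Fintype K2) (_ : Nonempty K1) (_ : Nonempty K2),
      0 < n0 ∧ ((L * n0 : ℕ) : ℝ) * r.1 ≤ Real.logb 2 (Fintype.card K1) ∧
      ((L * n0 : ℕ) : ℝ) * r.2 ≤ Real.logb 2 (Fintype.card K2) ∧
      ∀ π : K1 × K2 → ℝ, IsPMF π → ∃ (f : K1 × K2 → Fin (L * n0) → X)
        (g1 : (Fin (L * n0) → Y1) × K2 → K1) (g2 : (Fin (L * n0) → Y2) → K2),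
        ∑ m, π m * ∑ b : (Fin (L * n0) → Y1) × (Fin (L * n0) → Y2), nFold W (L * n0) (f m) b *
          (if g1 (b.1, m.2) = m.1 ∧ g2 b.2 = m.2 then 0 else 1) ≤ ε := by
  have hLR : (0:ℝ) < L := by exact_mod_cast hL
  obtain ⟨n0, k1, k2, hn0, hk1, hk2, f, g1, g2, h1, h2, herr⟩ := hr.2.2 (ε / L) (by positivity)
  have : NeZero k1 := ⟨hk1.ne'⟩
  have : NeZero k2 := ⟨hk2.ne'⟩
  have hn0R : (0:ℝ) < n0 := by exact_mod_cast hn0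
  refine ⟨n0, Fin L → Fin k1, Fin L → Fin k2, inferInstance, inferInstance, inferInstance,
    inferInstance, hn0, ?_, ?_, ?_⟩
  · rw [le_div_iff₀ hn0R] at h1
    simp only [Fintype.card_fun, Fintype.card_fin]
    push_cast
    rw [Real.logb_pow]
    nlinarith
  · rw [le_div_iff₀ hn0R] at h2
    simp only [Fintype.card_fun, Fintype.card_fin]
    push_cast
    rw [Real.logb_pow]
    nlinarith
  · intro π hπ
    rw [errP1_eq_gerr] at herr
    have hrep := gerr_repeat (nFold W n0) (nFold_channel hW n0) f g1 g2 L
    rw [← gerr_transport] at hrep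
    obtain ⟨f', g1', g2', hs⟩ := gerr_shift (nFold W (L * n0)) _ _ _ π hπ
    refine ⟨f', g1', g2', hs.trans (hrep.trans ?_)⟩
    rw [le_div_iff₀ hLR] at herr
    linarith


lemma source_coding2 {A U : Type} [Fintype A] [Fintype U] [Nonempty U]
    (q : A × U → ℝ) (hq : IsPMF q) {ε δ : ℝ} (hε : 0 < ε) (hδ : 0 < δ) :
    ∃ m0 : ℕ, ∀ m : ℕ, m0 ≤ m → ∀ (K : Type) [Fintype K] [Nonempty K],
      (m:ℝ) * ((1 + δ) * MI q) ≤ Real.logb 2 (Fintype.card K) →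
      ∃ (enc : (Fin m → A) → K) (dec : K → Fin m → U),
        ∑ a : Fin m → A, (∏ t, ∑ u, q (a t, u)) *
          (if l1dist (etyp (fun t => (a t, dec (enc a) t))) q ≤ ε then 0 else 1) ≤ ε := by
  have hq' : IsPMF (fun z : A × Unit × U => q (z.1, z.2.2)) := by
    refine ⟨fun z => hq.1 _, ?_⟩
    refine Eq.trans ?_ hq.2
    simp [Fintype.sum_prod_type]
  obtain ⟨m0, h⟩ := source_coding _ hq' hε hδ
  refine ⟨m0, fun m hm K _ _ hK => ?_⟩
  rw [MI_eq_cmiMid q hq.2] at hK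
  obtain ⟨enc, dec, hc⟩ := h m hm K hK
  refine ⟨fun a => enc a (fun _ => ()), fun k => dec k (fun _ => ()), le_trans (le_of_eq ?_) hc⟩
  refine Finset.sum_congr rfl fun a _ => ?_
  rw [Fintype.sum_unique]
  have e : ∀ u : Fin m → U, l1dist (etyp (fun t => (a t, u t))) q =
      l1dist (etyp (fun t => (a t, (), u t))) (fun z : A × Unit × U => q (z.1, z.2.2)) := by
    intro u
    unfold l1dist etyp
    simp [Fintype.sum_prod_type]
  rw [e]

/-- Point mass. -/
def delta {Z : Type} (z0 z : Z) : ℝ := if z = z0 then 1 else 0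

lemma delta_sum {Z : Type} [Fintype Z] (z0 : Z) (g : Z → ℝ) : ∑ z, delta z0 z * g z = g z0 := by
  unfold delta
  simp

lemma delta_pmf {Z : Type} [Fintype Z] (z0 : Z) : IsPMF (delta z0) := by
  refine ⟨fun z => by unfold delta; split_ifs <;> norm_num, ?_⟩
  have := delta_sum z0 (fun _ => (1:ℝ))
  simpa using this

section asm
variable {S1 S2 X Y1 Y2 US1 US2 K1 K2 : Type}
variable [Fintype S1] [Fintype S2] [Fintype X] [Fintype Y1] [Fintype Y2]
variable [Fintype US1] [Fintype US2]

lemma assemble {ps : S1 × S2 → ℝ} (hps : IsPMF ps) {W : X → Y1 × Y2 → ℝ} (hW : IsChannel W)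
    {q1 : S1 × S2 × US1 → ℝ} (hq1 : IsPMF q1) {q2 : S2 × US2 → ℝ} (hq2 : IsPMF q2)
    {m n : ℕ} (hm : 0 < m) {ε : ℝ} (hε : 0 ≤ ε)
    (enc1 : (Fin m → S1) → (Fin m → S2) → K1) (dec1 : K1 → (Fin m → S2) → Fin m → US1)
    (enc2 : (Fin m → S2) → K2) (dec2 : K2 → Fin m → US2)
    (f : K1 × K2 → Fin n → X) (g1 : (Fin n → Y1) × K2 → K1) (g2 : (Fin n → Y2) → K2)
    (h1 : ∑ s1 : Fin m → S1, ∑ s2 : Fin m → S2, srcProd2 ps m s1 s2 *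
      (if l1dist (etyp (fun t => (s1 t, s2 t, dec1 (enc1 s1 s2) s2 t))) q1 ≤ ε then 0 else 1) ≤ ε)
    (h2 : ∑ s2 : Fin m → S2, (∏ t, ∑ a, ps (a, s2 t)) *
      (if l1dist (etyp (fun t => (s2 t, dec2 (enc2 s2) t))) q2 ≤ ε then 0 else 1) ≤ ε)
    (h3 : ∑ s1 : Fin m → S1, ∑ s2 : Fin m → S2, srcProd2 ps m s1 s2 *
      ∑ y : (Fin n → Y1) × (Fin n → Y2), nFold W n (f (enc1 s1 s2, enc2 s2)) y *
        (if g1 (y.1, enc2 s2) = enc1 s1 s2 ∧ g2 y.2 = enc2 s2 then 0 else 1) ≤ ε) :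
    ∃ (F : (Fin m → S1) × (Fin m → S2) → (Fin n → X) → ℝ)
      (G1 : (Fin n → Y1) × (Fin m → S2) → (Fin m → US1) → ℝ)
      (G2 : (Fin n → Y2) → (Fin m → US2) → ℝ),
      IsChannel F ∧ IsChannel G1 ∧ IsChannel G2 ∧
      l1dist (fun a => (1 / (m : ℝ)) * ∑ t, jointPiT1 ps W m n F G1 t a) q1 ≤ 5 * ε ∧
      l1dist (fun a => (1 / (m : ℝ)) * ∑ t, jointPiT2 ps W m n F G2 t a) q2 ≤ 5 * ε := by
  have hV := nFold_channel hW n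
  set P : ((Fin m → S1) × (Fin m → S2)) × ((Fin n → Y1) × (Fin n → Y2)) → ℝ := fun ω =>
    srcProd2 ps m ω.1.1 ω.1.2 * nFold W n (f (enc1 ω.1.1 ω.1.2, enc2 ω.1.2)) ω.2 with hPdef
  have hsum : ∀ g : _ → ℝ, ∑ ω, P ω * g ω = ∑ s1 : Fin m → S1, ∑ s2 : Fin m → S2,
      srcProd2 ps m s1 s2 * ∑ y : (Fin n → Y1) × (Fin n → Y2),
        nFold W n (f (enc1 s1 s2, enc2 s2)) y * g ((s1, s2), y) := by
    intro g
    rw [Fintype.sum_prod_type, Fintype.sum_prod_type]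
    refine Finset.sum_congr rfl fun s1 _ => Finset.sum_congr rfl fun s2 _ => ?_
    rw [Finset.mul_sum]
    refine Finset.sum_congr rfl fun y _ => ?_
    simp only [hPdef, mul_assoc]
  have hS0 : ∀ s1 s2, 0 ≤ srcProd2 ps m s1 s2 := fun s1 s2 =>
    Finset.prod_nonneg fun t _ => hps.1 _
  have hS : ∑ s1 : Fin m → S1, ∑ s2 : Fin m → S2, srcProd2 ps m s1 s2 = 1 := by
    have := (sum_pi_prod_pmf (fun _ : Fin m => ps) fun _ => hps).2
    rw [sum_pairFn] at this
    exact this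
  have hP : IsPMF P := by
    refine ⟨fun ω => mul_nonneg (hS0 _ _) ((hV _).1 _), ?_⟩
    have := hsum (fun _ => 1)
    simp only [mul_one, (hV _).2] at this
    rw [this, hS]
  have hbad : ∀ T : ((Fin m → S1) × (Fin m → S2)) × ((Fin n → Y1) × (Fin n → Y2)) → Prop,
      ∀ T' : (Fin m → S1) → (Fin m → S2) → Prop,
      (∀ s1 s2 y, T' s1 s2 → (g1 (y.1, enc2 s2) = enc1 s1 s2 ∧ g2 y.2 = enc2 s2) →
        T ((s1, s2), y)) →
      (∑ s1 : Fin m → S1, ∑ s2 : Fin m → S2, srcProd2 ps m s1 s2 *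
        (if T' s1 s2 then (0:ℝ) else 1) ≤ ε) →
      ∑ ω, P ω * (if T ω then (0:ℝ) else 1) ≤ 2 * ε := by
    intro T T' hT hT'
    have : ∑ ω, P ω * (if T ω then (0:ℝ) else 1) ≤
        ∑ ω, P ω * ((if T' ω.1.1 ω.1.2 then (0:ℝ) else 1) +
          (if g1 (ω.2.1, enc2 ω.1.2) = enc1 ω.1.1 ω.1.2 ∧ g2 ω.2.2 = enc2 ω.1.2 then (0:ℝ) else 1)) := by
      apply Finset.sum_le_sum
      intro ω _
      apply mul_le_mul_of_nonneg_left _ (hP.1 ω)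
      have := hT ω.1.1 ω.1.2 ω.2
      by_cases a1 : T' ω.1.1 ω.1.2
      · by_cases a2 : g1 (ω.2.1, enc2 ω.1.2) = enc1 ω.1.1 ω.1.2 ∧ g2 ω.2.2 = enc2 ω.1.2
        · rw [if_pos a1, if_pos a2, if_pos (this a1 a2)]; norm_num
        · rw [if_pos a1, if_neg a2]; split_ifs <;> norm_num
      · rw [if_neg a1]; split_ifs <;> norm_num
    refine this.trans ?_
    simp_rw [mul_add]
    rw [Finset.sum_add_distrib, hsum (fun ω => if T' ω.1.1 ω.1.2 then (0:ℝ) else 1), hsum]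
    have e1 : ∑ s1 : Fin m → S1, ∑ s2 : Fin m → S2,
      srcProd2 ps m s1 s2 * ∑ y : (Fin n → Y1) × (Fin n → Y2),
        nFold W n (f (enc1 s1 s2, enc2 s2)) y * (if T' s1 s2 then (0:ℝ) else 1) =
        ∑ s1 : Fin m → S1, ∑ s2 : Fin m → S2, srcProd2 ps m s1 s2 *
        (if T' s1 s2 then (0:ℝ) else 1) := by
      refine Finset.sum_congr rfl fun s1 _ => Finset.sum_congr rfl fun s2 _ => ?_
      rw [← Finset.sum_mul, (hV _).2, one_mul]
    dsimp only at e1 ⊢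
    rw [e1]
    linarith
  refine ⟨fun s => delta (f (enc1 s.1 s.2, enc2 s.2)), fun y => delta (dec1 (g1 (y.1, enc2 y.2)) y.2),
    fun y => delta (dec2 (g2 y)), fun _ => delta_pmf _, fun _ => delta_pmf _, fun _ => delta_pmf _,
    ?_, ?_⟩
  · have hj : ∀ t a, jointPiT1 ps W m n (fun s => delta (f (enc1 s.1 s.2, enc2 s.2)))
        (fun y => delta (dec1 (g1 (y.1, enc2 y.2)) y.2)) t a =
        ∑ ω, P ω * (if (ω.1.1 t, ω.1.2 t, dec1 (g1 (ω.2.1, enc2 ω.1.2)) ω.1.2 t) = a then 1 else 0) := by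
      intro t a
      rw [hsum]
      unfold jointPiT1
      refine Finset.sum_congr rfl fun s1 _ => Finset.sum_congr rfl fun s2 _ => ?_
      rw [← delta_sum (f (enc1 s1 s2, enc2 s2)) (fun x => ∑ y : (Fin n → Y1) × (Fin n → Y2),
        nFold W n x y * (if (s1 t, s2 t, dec1 (g1 (y.1, enc2 s2)) s2 t) = a then (1:ℝ) else 0)),
        Finset.mul_sum]
      refine Finset.sum_congr rfl fun x _ => ?_
      rw [Finset.mul_sum, Finset.mul_sum]
      refine Finset.sum_congr rfl fun y _ => ?_
      have := delta_sum (dec1 (g1 (y.1, enc2 s2)) s2) (fun u => if (s1 t, s2 t, u t) = a then (1:ℝ) else 0)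
      rw [← this, Finset.mul_sum, Finset.mul_sum, Finset.mul_sum]
      refine Finset.sum_congr rfl fun u _ => ?_
      simp only [Prod.ext_iff]
      ring
    simp_rw [hj]
    refine le_trans (le_of_eq ?_) ((avg_dist hP hm
      (fun ω t => (ω.1.1 t, ω.1.2 t, dec1 (g1 (ω.2.1, enc2 ω.1.2)) ω.1.2 t)) q1 hq1 ε hε).trans ?_)
    · congr!
    have := hbad (fun ω => l1dist (etyp (fun t =>
      (ω.1.1 t, ω.1.2 t, dec1 (g1 (ω.2.1, enc2 ω.1.2)) ω.1.2 t))) q1 ≤ ε)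
      (fun s1 s2 => l1dist (etyp (fun t => (s1 t, s2 t, dec1 (enc1 s1 s2) s2 t))) q1 ≤ ε)
      (fun s1 s2 y a b => by dsimp only; rw [b.1]; exact a) h1
    linarith
  · have hj : ∀ t a, jointPiT2 ps W m n (fun s => delta (f (enc1 s.1 s.2, enc2 s.2)))
        (fun y => delta (dec2 (g2 y))) t a =
        ∑ ω, P ω * (if (ω.1.2 t, dec2 (g2 ω.2.2) t) = a then 1 else 0) := by
      intro t a
      rw [hsum]
      unfold jointPiT2
      refine Finset.sum_congr rfl fun s1 _ => Finset.sum_congr rfl fun s2 _ => ?_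
      rw [← delta_sum (f (enc1 s1 s2, enc2 s2)) (fun x => ∑ y : (Fin n → Y1) × (Fin n → Y2),
        nFold W n x y * (if (s2 t, dec2 (g2 y.2) t) = a then (1:ℝ) else 0)),
        Finset.mul_sum]
      refine Finset.sum_congr rfl fun x _ => ?_
      rw [Finset.mul_sum, Finset.mul_sum]
      refine Finset.sum_congr rfl fun y _ => ?_
      have := delta_sum (dec2 (g2 y.2)) (fun u => if (s2 t, u t) = a then (1:ℝ) else 0)
      rw [← this, Finset.mul_sum, Finset.mul_sum, Finset.mul_sum]
      refine Finset.sum_congr rfl fun u _ => ?_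
      simp only [Prod.ext_iff]
      ring
    simp_rw [hj]
    refine le_trans (le_of_eq ?_)
      ((avg_dist hP hm (fun ω t => (ω.1.2 t, dec2 (g2 ω.2.2) t)) q2 hq2 ε hε).trans ?_)
    · congr!
    have := hbad (fun ω => l1dist (etyp (fun t => (ω.1.2 t, dec2 (g2 ω.2.2) t))) q2 ≤ ε)
      (fun s1 s2 => l1dist (etyp (fun t => (s2 t, dec2 (enc2 s2) t))) q2 ≤ ε)
      (fun s1 s2 y a b => by dsimp only; rw [b.2]; exact a) (by
        refine le_trans (le_of_eq ?_) h2
        rw [Finset.sum_comm]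
        refine Finset.sum_congr rfl fun s2 _ => ?_
        rw [← Finset.sum_mul]
        congr 1
        exact sum_pi_prod (fun t a => ps (a, s2 t)))
    linarith
end asm


lemma cmiMid_nonneg {A C U : Type} [Fintype A] [Fintype C] [Fintype U] [Nonempty U]
    (q : A × C × U → ℝ) (hq : IsPMF q) : 0 ≤ cmiMid q := by
  obtain ⟨Ka, Kc, hKa, hKc, hfac, hn, hd, hform, hI0, hIeq⟩ := src_kernels q hq
  exact hI0

lemma MI_nonneg {A U : Type} [Fintype A] [Fintype U] [Nonempty U]
    (q : A × U → ℝ) (hq : IsPMF q) : 0 ≤ MI q := by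
  rw [MI_eq_cmiMid q hq.2]
  apply cmiMid_nonneg
  refine ⟨fun z => hq.1 _, ?_⟩
  refine Eq.trans ?_ hq.2
  simp [Fintype.sum_prod_type]

section bw
variable {S1 S2 X Y1 Y2 US1 US2 : Type}
variable [Fintype S1] [Fintype S2] [Fintype X] [Fintype Y1] [Fintype Y2]
variable [Fintype US1] [Fintype US2] [Nonempty US1] [Nonempty US2] [Nonempty X]

lemma backward {ps : S1 × S2 → ℝ} (hps : IsPMF ps) {W : X → Y1 × Y2 → ℝ} (hW : IsChannel W)
    {κ : ℝ} (hκ : 0 ≤ κ)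
    {Q1 : Set (S1 × S2 × US1 → ℝ)} {Q2 : Set (S2 × US2 → ℝ)}
    {q1 : S1 × S2 × US1 → ℝ} (hq1Q : q1 ∈ Q1) (hq1 : IsPMF q1)
    (hm1 : ∀ s12 : S1 × S2, ∑ u, q1 (s12.1, s12.2, u) = ps s12)
    {q2 : S2 × US2 → ℝ} (hq2Q : q2 ∈ Q2) (hq2 : IsPMF q2)
    (hm2 : ∀ s2, ∑ u, q2 (s2, u) = ∑ s1, ps (s1, s2))
    {r : ℝ × ℝ} (hr : r ∈ Cap1 W) (hr1 : cmiMid q1 = κ * r.1) (hr2 : MI q2 = κ * r.2) :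
    InGammaTilde ps W Q1 Q2 κ := by
  intro ε hε
  set ε1 := ε / 5 with hε1
  have hε1p : 0 < ε1 := by positivity
  suffices H : True by
    clear H
    have red : ∀ (m n : ℕ) (K1 K2 : Type) (_ : Fintype K1) (_ : Fintype K2), 0 < m →
        (n:ℝ) / m ≤ κ + ε →
        (∃ (enc : (Fin m → S1) → (Fin m → S2) → K1) (dec : K1 → (Fin m → S2) → Fin m → US1),
          ∑ a : Fin m → S1, ∑ c : Fin m → S2, (∏ t, ∑ u, q1 (a t, c t, u)) *
          (if l1dist (etyp (fun t => (a t, c t, dec (enc a c) c t))) q1 ≤ ε1 then 0 else 1) ≤ ε1) →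
        (∃ (enc : (Fin m → S2) → K2) (dec : K2 → Fin m → US2),
          ∑ a : Fin m → S2, (∏ t, ∑ u, q2 (a t, u)) *
          (if l1dist (etyp (fun t => (a t, dec (enc a) t))) q2 ≤ ε1 then 0 else 1) ≤ ε1) →
        (∀ π : K1 × K2 → ℝ, IsPMF π → ∃ (f : K1 × K2 → Fin n → X)
          (g1 : (Fin n → Y1) × K2 → K1) (g2 : (Fin n → Y2) → K2),
          ∑ m, π m * ∑ b : (Fin n → Y1) × (Fin n → Y2), nFold W n (f m) b *
          (if g1 (b.1, m.2) = m.1 ∧ g2 b.2 = m.2 then 0 else 1) ≤ ε1) →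
        ∃ (m n : ℕ), 0 < m ∧
          ∃ (F : (Fin m → S1) × (Fin m → S2) → (Fin n → X) → ℝ)
          (G1 : (Fin n → Y1) × (Fin m → S2) → (Fin m → US1) → ℝ)
          (G2 : (Fin n → Y2) → (Fin m → US2) → ℝ),
          IsChannel F ∧ IsChannel G1 ∧ IsChannel G2 ∧
          (n : ℝ) / (m : ℝ) ≤ κ + ε ∧
          (∃ q1 ∈ Q1,
            l1dist (fun a => (1 / (m : ℝ)) * ∑ t, jointPiT1 ps W m n F G1 t a) q1 ≤ ε) ∧
          (∃ q2 ∈ Q2,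
            l1dist (fun a => (1 / (m : ℝ)) * ∑ t, jointPiT2 ps W m n F G2 t a) q2 ≤ ε) := by
      rintro m n K1 K2 _ _ hm hn ⟨enc1, dec1, hs1⟩ ⟨enc2, dec2, hs2⟩ hch
      have hsrc := sum_pi_prod_pmf (fun _ : Fin m => ps) fun _ => hps
      have hS : ∑ s1 : Fin m → S1, ∑ s2 : Fin m → S2, srcProd2 ps m s1 s2 = 1 := by
        have := hsrc.2
        rw [sum_pairFn] at this
        exact this
      have hS0 : ∀ s1 s2, 0 ≤ srcProd2 ps m s1 s2 := fun s1 s2 =>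
        Finset.prod_nonneg fun t _ => hps.1 _
      set π : K1 × K2 → ℝ := fun k => ∑ s1 : Fin m → S1, ∑ s2 : Fin m → S2,
        srcProd2 ps m s1 s2 * delta (enc1 s1 s2, enc2 s2) k with hπd
      have hπs : ∀ g : K1 × K2 → ℝ, ∑ k, π k * g k = ∑ s1 : Fin m → S1, ∑ s2 : Fin m → S2,
          srcProd2 ps m s1 s2 * g (enc1 s1 s2, enc2 s2) := by
        intro g
        simp only [hπd, Finset.sum_mul]
        rw [Finset.sum_comm]
        refine Finset.sum_congr rfl fun s1 _ => ?_
        rw [Finset.sum_comm]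
        refine Finset.sum_congr rfl fun s2 _ => ?_
        rw [← delta_sum (enc1 s1 s2, enc2 s2) g, Finset.mul_sum]
        refine Finset.sum_congr rfl fun k _ => ?_
        ring
      have hπ : IsPMF π := by
        refine ⟨fun k => Finset.sum_nonneg fun s1 _ => Finset.sum_nonneg fun s2 _ =>
          mul_nonneg (hS0 _ _) ((delta_pmf _).1 k), ?_⟩
        have := hπs (fun _ => 1)
        simp only [mul_one] at this
        rw [this, hS]
      obtain ⟨f, g1, g2, hc⟩ := hch π hπ
      rw [hπs] at hc
      have hs1' : ∑ s1 : Fin m → S1, ∑ s2 : Fin m → S2, srcProd2 ps m s1 s2 *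
          (if l1dist (etyp (fun t => (s1 t, s2 t, dec1 (enc1 s1 s2) s2 t))) q1 ≤ ε1 then 0 else 1) ≤ ε1 := by
        refine le_trans (le_of_eq ?_) hs1
        refine Finset.sum_congr rfl fun s1 _ => Finset.sum_congr rfl fun s2 _ => ?_
        congr 1
        exact Finset.prod_congr rfl fun t _ => (hm1 (s1 t, s2 t)).symm
      have hs2' : ∑ s2 : Fin m → S2, (∏ t, ∑ a, ps (a, s2 t)) *
          (if l1dist (etyp (fun t => (s2 t, dec2 (enc2 s2) t))) q2 ≤ ε1 then 0 else 1) ≤ ε1 := by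
        refine le_trans (le_of_eq ?_) hs2
        refine Finset.sum_congr rfl fun s2 _ => ?_
        congr 1
        exact Finset.prod_congr rfl fun t _ => (hm2 (s2 t)).symm
      obtain ⟨F, G1, G2, hF, hG1, hG2, d1, d2⟩ := assemble hps hW hq1 hq2 hm hε1p.le
        enc1 dec1 enc2 dec2 f g1 g2 hs1' hs2' hc
      have h5 : 5 * ε1 = ε := by rw [hε1]; ring
      rw [h5] at d1 d2
      exact ⟨m, n, hm, F, G1, G2, hF, hG1, hG2, hn, ⟨q1, hq1Q, d1⟩, ⟨q2, hq2Q, d2⟩⟩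
    rcases hκ.eq_or_lt with h0 | hpos
    · obtain ⟨m1, hm1c⟩ := source_coding q1 hq1 hε1p one_pos
      obtain ⟨m2, hm2c⟩ := source_coding2 q2 hq2 hε1p one_pos
      refine red (max (max m1 m2) 1) 0 Unit Unit inferInstance inferInstance (by omega) ?_ ?_ ?_ ?_
      · simp [← h0, hε.le]
      · refine hm1c _ ((le_max_left _ _).trans (le_max_left _ _)) Unit ?_
        simp [hr1, ← h0]
      · refine hm2c _ ((le_max_right _ _).trans (le_max_left _ _)) Unit ?_
        simp [hr2, ← h0]
      · intro π hπ
        refine ⟨fun _ t => t.elim0, fun _ => (), fun _ => (), ?_⟩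
        simp [hε1p.le]
    · have hI1 := cmiMid_nonneg q1 hq1
      have hI2 := MI_nonneg q2 hq2
      have hr1n : 0 ≤ r.1 := by
        rw [hr1] at hI1; exact nonneg_of_mul_nonneg_right hI1 hpos
      have hr2n : 0 ≤ r.2 := by
        rw [hr2] at hI2; exact nonneg_of_mul_nonneg_right hI2 hpos
      set c := κ + ε / 2 with hc
      have hcp : 0 < c := by positivity
      set s := κ / c with hs
      have hs0 : 0 < s := by positivity
      have hs1 : s < 1 := by rw [hs, div_lt_one hcp]; linarith
      have hκs : κ = s * c := by rw [hs]; field_simp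
      set δ := (1 - s) / (2 * s) with hδ
      have hδp : 0 < δ := div_pos (by linarith) (by positivity)
      have hδs : (1 + δ) * s = (1 + s) / 2 := by rw [hδ]; field_simp; ring
      set η := (1 - s) / 2 with hη
      have hηp : 0 < η := by rw [hη]; linarith
      obtain ⟨m1, hm1c⟩ := source_coding q1 hq1 hε1p hδp
      obtain ⟨m2, hm2c⟩ := source_coding2 q2 hq2 hε1p hδp
      obtain ⟨r', hr', hd1, hd2⟩ : ∃ r', Ach1 W r' ∧ (1 - η) * r.1 ≤ r'.1 ∧ (1 - η) * r.2 ≤ r'.2 := by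
        have hg : ∀ x : ℝ, 0 ≤ x → ∃ ρ : ℝ, 0 < ρ ∧ ∀ y, 0 ≤ y → |x - y| < ρ → (1 - η) * x ≤ y := by
          intro x hx
          rcases hx.eq_or_lt with h | h
          · exact ⟨1, one_pos, fun y hy _ => by rw [← h]; simpa using hy⟩
          · refine ⟨η * x, by positivity, fun y _ hy => ?_⟩
            have := (abs_lt.1 hy).2
            linarith
        obtain ⟨ρ1, hρ1, ha⟩ := hg r.1 hr1n
        obtain ⟨ρ2, hρ2, hb⟩ := hg r.2 hr2n
        obtain ⟨r', hr', hd⟩ := Metric.mem_closure_iff.1 hr (min ρ1 ρ2) (lt_min hρ1 hρ2)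
        have hr'' : Ach1 W r' := hr'
        rw [Prod.dist_eq, max_lt_iff, Real.dist_eq, Real.dist_eq] at hd
        exact ⟨r', hr'', ha _ hr''.1 (hd.1.trans_le (min_le_left _ _)),
          hb _ hr''.2.1 (hd.2.trans_le (min_le_right _ _))⟩
      set M : ℕ := max (max m1 m2) (max 1 ⌈2 * c / ε⌉₊) with hM
      set L : ℕ := max 1 ⌈c * M⌉₊ with hL
      obtain ⟨n0, K1, K2, i1, i2, i3, i4, hn0, hl1, hl2, hcode⟩ :=
        good_code hW hr' (L := L) (by omega) hε1p
      set n := L * n0 with hn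
      have hnL : (L:ℝ) ≤ n := by
        rw [hn]; exact_mod_cast Nat.le_mul_of_pos_right L hn0
      have hcM : c * M ≤ n := by
        have h1 : c * M ≤ ⌈c * M⌉₊ := Nat.le_ceil _
        have h2 : ((⌈c * M⌉₊ : ℕ) : ℝ) ≤ L := by exact_mod_cast le_max_right _ _
        linarith
      set m : ℕ := ⌊(n:ℝ) / c⌋₊ with hm
      have hMm : M ≤ m := by
        rw [hm]; apply Nat.le_floor; rw [le_div_iff₀ hcp]; linarith
      have hmn : (m:ℝ) * c ≤ n := by
        rw [← le_div_iff₀ hcp]; exact Nat.floor_le (by positivity)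
      have hnm : (n:ℝ) < c * (m + 1) := by
        have := Nat.lt_floor_add_one ((n:ℝ) / c)
        rw [div_lt_iff₀ hcp] at this
        linarith
      have hm1 : 1 ≤ m := le_trans ((le_max_left _ _).trans (le_max_right _ _)) hMm
      have hmp : (0:ℝ) < m := by exact_mod_cast hm1
      have hmc : 2 * c / ε ≤ m := by
        have h1 : 2 * c / ε ≤ ⌈2 * c / ε⌉₊ := Nat.le_ceil _
        have h2 : ((⌈2 * c / ε⌉₊ : ℕ) : ℝ) ≤ m := by
          exact_mod_cast le_trans ((le_max_right _ _).trans (le_max_right _ _)) hMm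
        linarith
      rw [div_le_iff₀ hε] at hmc
      have hrate : ∀ x y : ℝ, 0 ≤ x → (1 - η) * x ≤ y → (m:ℝ) * ((1 + δ) * (κ * x)) ≤ n * y := by
        intro x y hx hxy
        have e1 : (m:ℝ) * ((1 + δ) * (κ * x)) = (m * c) * ((1 - η) * x) := by
          have : (1 + δ) * κ = (1 - η) * c := by
            rw [hκs, ← mul_assoc, hδs, hη]; ring
          calc (m:ℝ) * ((1 + δ) * (κ * x)) = m * ((1 + δ) * κ) * x := by ring
            _ = _ := by rw [this]; ring
        rw [e1]
        have h1η : 0 ≤ 1 - η := by rw [hη]; linarith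
        have := mul_nonneg h1η hx
        exact mul_le_mul hmn hxy this (by positivity)
      refine red m n K1 K2 i1 i2 hm1 ?_ ?_ ?_ hcode
      · rw [div_le_iff₀ hmp]
        nlinarith
      · refine hm1c m (le_trans ((le_max_left _ _).trans (le_max_left _ _)) hMm) K1 ?_
        rw [hr1]
        exact (hrate _ _ hr1n hd1).trans hl1
      · refine hm2c m (le_trans ((le_max_right _ _).trans (le_max_left _ _)) hMm) K2 ?_
        rw [hr2]
        exact (hrate _ _ hr2n hd2).trans hl2
  trivial
end bw


/-! ### Converse: single-letterisation -/

/-- Conditional information `I(D;B|C)` in kernel form. -/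
def Jab {C D B : Type} [Fintype C] [Fintype D] [Fintype B]
    (pc : C → ℝ) (px : C → D → ℝ) (V : D → B → ℝ) : ℝ :=
  ∑ z : D × C × B, pc z.2.1 * px z.2.1 z.1 * V z.1 z.2.2 *
    Real.logb 2 (V z.1 z.2.2 / kcomp px V z.2.1 z.2.2)

lemma sum_rot {X Y Z : Type} [Fintype X] [Fintype Y] [Fintype Z] (g : X → Y → Z → ℝ) :
    ∑ x, ∑ y, ∑ z, g x y z = ∑ y, ∑ z, ∑ x, g x y z := by
  rw [Finset.sum_comm]
  exact Finset.sum_congr rfl fun y _ => Finset.sum_comm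

lemma sum_mul_pmf {Z : Type} [Fintype Z] {p : Z → ℝ} (hp : IsPMF p) (k : ℝ) :
    ∑ z, k * p z = k := by
  rw [← Finset.mul_sum, hp.2, mul_one]

section core
variable {A C U D B : Type} [Fintype A] [Fintype C] [Fintype U] [Fintype D] [Fintype B]

lemma Jab_le {pc : C → ℝ} (hpc : IsPMF pc) {px : C → D → ℝ} (hpx : IsChannel px)
    {V : D → B → ℝ} (hV : IsChannel V) :
    Jab pc px V ≤ Real.logb 2 (Fintype.card B) := by
  have hk := kcomp_channel hpx hV
  have hP : IsPMF (fun z : D × C × B => pc z.2.1 * px z.2.1 z.1 * V z.1 z.2.2) := by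
    refine ⟨fun z => mul_nonneg (mul_nonneg (hpc.1 _) ((hpx _).1 _)) ((hV _).1 _), ?_⟩
    simp_rw [Fintype.sum_prod_type]
    rw [Finset.sum_comm]
    refine Eq.trans (Finset.sum_congr rfl fun c _ => ?_) hpc.2
    refine Eq.trans (Finset.sum_congr rfl fun x _ => sum_mul_pmf (hV x) _) ?_
    exact sum_mul_pmf (hpx c) _
  have hBne : Nonempty B := by
    by_contra hB
    rw [not_nonempty_iff] at hB
    have := hP.2
    simp at this
  have hB : (0:ℝ) < Fintype.card B := by exact_mod_cast Fintype.card_pos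
  have hpos : ∀ z : D × C × B, 0 < pc z.2.1 * px z.2.1 z.1 * V z.1 z.2.2 →
      0 < V z.1 z.2.2 ∧ 0 < kcomp px V z.2.1 z.2.2 := by
    intro z hz
    have hv : 0 < V z.1 z.2.2 := by
      rcases ((hV z.1).1 z.2.2).eq_or_lt with h | h
      · rw [← h] at hz; simp at hz
      · exact h
    have hx : 0 < px z.2.1 z.1 := by
      rcases ((hpx z.2.1).1 z.1).eq_or_lt with h | h
      · rw [← h] at hz; simp at hz
      · exact h
    refine ⟨hv, lt_of_lt_of_le (mul_pos hx hv) ?_⟩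
    exact Finset.single_le_sum (f := fun a => px z.2.1 a * V a z.2.2)
      (fun a _ => mul_nonneg ((hpx _).1 a) ((hV a).1 _)) (Finset.mem_univ z.1)
  have hg := gibbs hP (fun z => kcomp px V z.2.1 z.2.2 * 0 + V z.1 z.2.2 /
      (kcomp px V z.2.1 z.2.2 * Fintype.card B)) (fun z hz => by
        obtain ⟨h1, h2⟩ := hpos z hz
        positivity) ?_
  · have e : ∀ z : D × C × B, (pc z.2.1 * px z.2.1 z.1 * V z.1 z.2.2) * Real.logb 2
        (kcomp px V z.2.1 z.2.2 * 0 + V z.1 z.2.2 / (kcomp px V z.2.1 z.2.2 * Fintype.card B)) =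
        pc z.2.1 * px z.2.1 z.1 * V z.1 z.2.2 *
          Real.logb 2 (V z.1 z.2.2 / kcomp px V z.2.1 z.2.2) -
        (pc z.2.1 * px z.2.1 z.1 * V z.1 z.2.2) * Real.logb 2 (Fintype.card B) := by
      intro z
      rcases (hP.1 z).eq_or_lt with h | h
      · dsimp only at h
        rw [← h]; ring
      · obtain ⟨h1, h2⟩ := hpos z h
        rw [mul_zero, zero_add, ← div_div, Real.logb_div (div_pos h1 h2).ne' hB.ne']
        ring
    rw [Finset.sum_congr rfl fun z _ => e z, Finset.sum_sub_distrib, ← Finset.sum_mul, hP.2] at hg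
    unfold Jab
    linarith
  · have e : ∀ z : D × C × B, (pc z.2.1 * px z.2.1 z.1 * V z.1 z.2.2) *
        (kcomp px V z.2.1 z.2.2 * 0 + V z.1 z.2.2 / (kcomp px V z.2.1 z.2.2 * Fintype.card B)) ≤
        pc z.2.1 * (px z.2.1 z.1 * V z.1 z.2.2) / (kcomp px V z.2.1 z.2.2 * Fintype.card B) := by
      intro z
      rw [mul_zero, zero_add]
      have hv1 : V z.1 z.2.2 ≤ 1 := by
        rw [← (hV z.1).2]
        exact Finset.single_le_sum (fun b _ => (hV z.1).1 b) (Finset.mem_univ z.2.2)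
      have hv0 := (hV z.1).1 z.2.2
      have h3 := (hk z.2.1).1 z.2.2
      rw [← mul_div_assoc]
      apply div_le_div_of_nonneg_right _ (by positivity)
      have h4 := hP.1 z
      dsimp only at h4
      nlinarith
    refine le_trans (Finset.sum_le_sum fun z _ => e z) ?_
    simp_rw [Fintype.sum_prod_type]
    rw [sum_rot]
    refine le_trans (b := ∑ c : C, ∑ b : B, pc c * (1 / (Fintype.card B : ℝ))) ?_ ?_
    · refine Finset.sum_le_sum fun c _ => Finset.sum_le_sum fun b _ => ?_
      rw [← Finset.sum_div, ← Finset.mul_sum]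
      change pc c * kcomp px V c b / _ ≤ _
      rcases ((hk c).1 b).eq_or_lt with h | h
      · rw [← h]
        have := hpc.1 c
        simp
        positivity
      · apply le_of_eq
        field_simp
    · rw [Finset.sum_comm]
      simp_rw [← Finset.sum_mul, hpc.2]
      simp

lemma conv_core [Nonempty A] {ps : A × C → ℝ} (hps : IsPMF ps) {m : ℕ} (hm : 0 < m)
    {F : (Fin m → A) → (Fin m → C) → D → ℝ} (hF : ∀ a c, IsPMF (F a c))
    {V : D → B → ℝ} (hV : IsChannel V)
    {G : B → (Fin m → C) → (Fin m → U) → ℝ} (hG : ∀ y c, IsPMF (G y c))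
    {px : (Fin m → C) → D → ℝ} (hpx : IsChannel px)
    (hpxF : ∀ c x, ∑ a : Fin m → A, (∏ t, ps (a t, c t)) * F a c x =
      (∏ t, ∑ a, ps (a, c t)) * px c x)
    {q : A × C × U → ℝ}
    (hq : ∀ g : A × C × U → ℝ, (m:ℝ) * ∑ z, q z * g z =
      ∑ a : Fin m → A, ∑ c : Fin m → C, ∑ x, ∑ y, ∑ u : Fin m → U,
        ((∏ t, ps (a t, c t)) * F a c x * V x y * G y c u) * ∑ t, g (a t, c t, u t)) :
    (m:ℝ) * cmiMid q ≤ Jab (fun c : Fin m → C => ∏ t, ∑ a, ps (a, c t)) px V := by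
  have hm' : (0:ℝ) < m := by exact_mod_cast hm
  set P : (Fin m → A) × (Fin m → C) × D × B × (Fin m → U) → ℝ := fun w =>
    (∏ t, ps (w.1 t, w.2.1 t)) * F w.1 w.2.1 w.2.2.1 * V w.2.2.1 w.2.2.2.1 *
      G w.2.2.2.1 w.2.1 w.2.2.2.2 with hPdef
  have hps0 : ∀ (a : Fin m → A) (c : Fin m → C), 0 ≤ ∏ t : Fin m, ps (a t, c t) := fun a c =>
    Finset.prod_nonneg fun t _ => hps.1 _
  have hP0 : ∀ w, 0 ≤ P w := fun w => mul_nonneg (mul_nonneg (mul_nonneg (hps0 _ _)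
    ((hF _ _).1 _)) ((hV _).1 _)) ((hG _ _).1 _)
  have hE2 : ∀ h : (Fin m → C) → D → B → ℝ, ∑ w, P w * h w.2.1 w.2.2.1 w.2.2.2.1 =
      ∑ z : D × (Fin m → C) × B, (∏ t, ∑ a, ps (a, z.2.1 t)) * px z.2.1 z.1 * V z.1 z.2.2 *
        h z.2.1 z.1 z.2.2 := by
    intro h
    simp_rw [Fintype.sum_prod_type, hPdef]
    have e : ∀ (a : Fin m → A) (c : Fin m → C) (x : D) (y : B), ∑ u : Fin m → U,
        (∏ t, ps (a t, c t)) * F a c x * V x y * G y c u * h c x y =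
        ((∏ t, ps (a t, c t)) * F a c x) * (V x y * h c x y) := by
      intro a c x y
      rw [← Finset.sum_mul, sum_mul_pmf (hG y c)]
      ring
    simp_rw [e, ← Finset.mul_sum]
    rw [sum_rot]
    simp_rw [← Finset.sum_mul, hpxF]
    rw [Finset.sum_comm]
    refine Finset.sum_congr rfl fun x _ => Finset.sum_congr rfl fun c _ => ?_
    rw [Finset.mul_sum]
    exact Finset.sum_congr rfl fun y _ => by ring
  have hpcN : IsPMF (fun c : Fin m → C => ∏ t, ∑ a, ps (a, c t)) := by
    refine sum_pi_prod_pmf (fun _ c => ∑ a, ps (a, c)) fun _ => ?_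
    refine ⟨fun c => Finset.sum_nonneg fun a _ => hps.1 _, ?_⟩
    rw [Finset.sum_comm]
    refine Eq.trans ?_ hps.2
    rw [Fintype.sum_prod_type]
  have hPs : IsPMF P := by
    refine ⟨hP0, ?_⟩
    have := hE2 (fun _ _ _ => 1)
    simp only [mul_one] at this
    rw [this]
    simp_rw [Fintype.sum_prod_type]
    rw [Finset.sum_comm]
    refine Eq.trans (Finset.sum_congr rfl fun c _ => ?_) hpcN.2
    refine Eq.trans (Finset.sum_congr rfl fun x _ => sum_mul_pmf (hV x) _) ?_
    exact sum_mul_pmf (hpx c) _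
  have hE1 : ∀ g : A × C × U → ℝ, (m:ℝ) * ∑ z, q z * g z =
      ∑ w, P w * ∑ t, g (w.1 t, w.2.1 t, w.2.2.2.2 t) := by
    intro g
    rw [hq g]
    simp_rw [Fintype.sum_prod_type, hPdef]
  have hqz : ∀ z, (m:ℝ) * q z = ∑ w, P w * ∑ t, delta z (w.1 t, w.2.1 t, w.2.2.2.2 t) := by
    intro z
    rw [← hE1 (delta z)]
    congr 1
    rw [← delta_sum z q]
    exact Finset.sum_congr rfl fun _ _ => mul_comm _ _
  have hd0 : ∀ {Z : Type} (z z' : Z), 0 ≤ delta z z' := by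
    intro Z z z'
    unfold delta
    split_ifs <;> norm_num
  have hq0 : ∀ z, 0 ≤ q z := by
    intro z
    have : 0 ≤ (m:ℝ) * q z := by
      rw [hqz]
      exact Finset.sum_nonneg fun w _ => mul_nonneg (hP0 w) (Finset.sum_nonneg fun t _ => hd0 _ _)
    exact nonneg_of_mul_nonneg_right this hm'
  have hqpos : ∀ w, 0 < P w → ∀ t, 0 < q (w.1 t, w.2.1 t, w.2.2.2.2 t) := by
    intro w hw t
    have : 0 < (m:ℝ) * q (w.1 t, w.2.1 t, w.2.2.2.2 t) := by
      rw [hqz]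
      refine lt_of_lt_of_le (mul_pos hw (zero_lt_one)) ?_
      refine le_trans ?_ (Finset.single_le_sum (f := fun w' => P w' * ∑ t', delta
        (w.1 t, w.2.1 t, w.2.2.2.2 t) (w'.1 t', w'.2.1 t', w'.2.2.2.2 t'))
        (fun w' _ => mul_nonneg (hP0 w') (Finset.sum_nonneg fun t _ => hd0 _ _))
        (Finset.mem_univ w))
      refine mul_le_mul_of_nonneg_left ?_ hw.le
      refine le_trans ?_ (Finset.single_le_sum (f := fun t' => delta
        (w.1 t, w.2.1 t, w.2.2.2.2 t) (w.1 t', w.2.1 t', w.2.2.2.2 t'))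
        (fun t' _ => hd0 _ _) (Finset.mem_univ t))
      simp [delta]
    exact (mul_pos_iff_of_pos_left hm').1 this
  have hmarg : ∀ a c, ∑ u, q (a, c, u) = ps (a, c) := by
    intro a c
    have h1 := hE1 (fun z => delta (a, c) (z.1, z.2.1))
    have h2 : ∑ z : A × C × U, q z * delta (a, c) (z.1, z.2.1) = ∑ u, q (a, c, u) := by
      simp_rw [Fintype.sum_prod_type, ← Finset.sum_mul]
      have := delta_sum (a, c) (fun z : A × C => ∑ u, q (z.1, z.2, u))
      rw [Fintype.sum_prod_type] at this
      rw [← this]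
      exact Finset.sum_congr rfl fun _ _ => Finset.sum_congr rfl fun _ _ => mul_comm _ _
    have h3 : ∑ w, P w * ∑ t, delta (a, c) (w.1 t, w.2.1 t) = m * ps (a, c) := by
      simp_rw [Finset.mul_sum]
      rw [Finset.sum_comm]
      have : ∀ t : Fin m, ∑ w, P w * delta (a, c) (w.1 t, w.2.1 t) = ps (a, c) := by
        intro t
        simp_rw [Fintype.sum_prod_type, hPdef]
        have e : ∀ (a' : Fin m → A) (c' : Fin m → C), ∑ x, ∑ y, ∑ u,
            (∏ t, ps (a' t, c' t)) * F a' c' x * V x y * G y c' u * delta (a, c) (a' t, c' t) =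
            (∏ t, ps (a' t, c' t)) * delta (a, c) (a' t, c' t) := by
          intro a' c'
          simp_rw [← Finset.sum_mul]
          congr 1
          refine Eq.trans (Finset.sum_congr rfl fun x _ => Eq.trans
            (Finset.sum_congr rfl fun y _ => sum_mul_pmf (hG y c') _)
              (sum_mul_pmf (hV x) _)) (sum_mul_pmf (hF a' c') _)
        simp_rw [e]
        rw [← sum_pairFn m (fun z : Fin m → A × C => (∏ t, ps (z t)) * delta (a, c) (z t)),
          pi_single hps t (delta (a, c))]
        rw [← delta_sum (a, c) ps]
        exact Finset.sum_congr rfl fun _ _ => mul_comm _ _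
      rw [Finset.sum_congr rfl fun t _ => this t]
      simp
    rw [h2] at h1
    dsimp only at h1
    rw [h3] at h1
    exact mul_left_cancel₀ hm'.ne' h1
  obtain ⟨κ, hκ, hκe⟩ := exists_kernel (fun (c : C) (a : A) => ps (a, c)) fun c a => hps.1 _
  obtain ⟨φ, hφ, hφe⟩ := exists_kernel (fun (cu : C × U) (a : A) => q (a, cu.1, cu.2))
    fun c a => hq0 _
  have hφpos : ∀ z : A × C × U, 0 < q z → 0 < φ z.2 z.1 := by
    intro z hz
    rcases ((hφ z.2).1 z.1).eq_or_lt with h | h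
    · have := hφe z.2 z.1
      rw [← h, mul_zero] at this
      exact absurd this hz.ne'
    · exact h
  have hκpos : ∀ z : A × C × U, 0 < q z → 0 < κ z.2.1 z.1 := by
    intro z hz
    have h1 : 0 < ps (z.1, z.2.1) := by
      rw [← hmarg]
      exact lt_of_lt_of_le hz (Finset.single_le_sum (f := fun u => q (z.1, z.2.1, u))
        (fun u _ => hq0 _) (Finset.mem_univ z.2.2))
    rcases ((hκ z.2.1).1 z.1).eq_or_lt with h | h
    · have := hκe z.2.1 z.1
      rw [← h, mul_zero] at this
      exact absurd this h1.ne'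
    · exact h
  have hcmi := cmi_form q hq0 (fun z => φ z.2 z.1) (fun z => κ z.2.1 z.1) hφpos hκpos (by
    intro a c u _
    have h1 := hφe (c, u) a
    have h2 := hκe c a
    dsimp only at h1 h2 ⊢
    simp_rw [hmarg]
    calc q (a, c, u) * (∑ a', ps (a', c)) * κ c a = q (a, c, u) * ((∑ a', ps (a', c)) * κ c a) := by
          ring
      _ = ps (a, c) * q (a, c, u) := by rw [← h2]; ring
      _ = ps (a, c) * (∑ a', q (a', c, u)) * φ (c, u) a := by rw [mul_assoc, ← h1])
  set K := kcomp px V with hK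
  have hk : IsChannel K := kcomp_channel hpx hV
  have hVpos : ∀ w, 0 < P w → 0 < V w.2.2.1 w.2.2.2.1 := by
    intro w hw
    rcases ((hV w.2.2.1).1 w.2.2.2.1).eq_or_lt with h | h
    · simp only [hPdef] at hw
      rw [← h] at hw; simp at hw
    · exact h
  have hKpos : ∀ w, 0 < P w → 0 < K w.2.1 w.2.2.2.1 := by
    intro w hw
    have h1 : 0 < (∏ t, ps (w.1 t, w.2.1 t)) * F w.1 w.2.1 w.2.2.1 := by
      rcases (mul_nonneg (hps0 w.1 w.2.1) ((hF w.1 w.2.1).1 w.2.2.1)).eq_or_lt with h | h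
      · simp only [hPdef] at hw
        rw [← h] at hw; simp at hw
      · exact h
    have h2 : 0 < (∏ t, ∑ a, ps (a, w.2.1 t)) * px w.2.1 w.2.2.1 := by
      rw [← hpxF]
      exact lt_of_lt_of_le h1 (Finset.single_le_sum
        (f := fun a : Fin m → A => (∏ t, ps (a t, w.2.1 t)) * F a w.2.1 w.2.2.1)
        (fun a _ => mul_nonneg (hps0 _ _) ((hF _ _).1 _)) (Finset.mem_univ w.1))
    have h3 : 0 < px w.2.1 w.2.2.1 := by
      rcases ((hpx w.2.1).1 w.2.2.1).eq_or_lt with h | h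
      · rw [← h] at h2; simp at h2
      · exact h
    refine lt_of_lt_of_le (mul_pos h3 (hVpos w hw)) ?_
    exact Finset.single_le_sum (f := fun a => px w.2.1 a * V a w.2.2.2.1)
      (fun a _ => mul_nonneg ((hpx _).1 a) ((hV a).1 _)) (Finset.mem_univ w.2.2.1)
  have hg := gibbs hPs (fun w => (∏ t, φ (w.2.1 t, w.2.2.2.2 t) (w.1 t) / κ (w.2.1 t) (w.1 t)) *
      (K w.2.1 w.2.2.2.1 / V w.2.2.1 w.2.2.2.1)) (fun w hw => mul_pos
        (Finset.prod_pos fun t _ => div_pos (hφpos _ (hqpos w hw t)) (hκpos _ (hqpos w hw t)))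
        (div_pos (hKpos w hw) (hVpos w hw))) ?_
  · have e : ∀ w, P w * Real.logb 2 ((∏ t, φ (w.2.1 t, w.2.2.2.2 t) (w.1 t) / κ (w.2.1 t) (w.1 t)) *
        (K w.2.1 w.2.2.2.1 / V w.2.2.1 w.2.2.2.1)) =
        P w * (∑ t, Real.logb 2 (φ (w.2.1 t, w.2.2.2.2 t) (w.1 t) / κ (w.2.1 t) (w.1 t))) -
        P w * Real.logb 2 (V w.2.2.1 w.2.2.2.1 / K w.2.1 w.2.2.2.1) := by
      intro w
      rcases (hP0 w).eq_or_lt with h | h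
      · rw [← h]; ring
      · have p1 : ∀ t : Fin m, φ (w.2.1 t, w.2.2.2.2 t) (w.1 t) / κ (w.2.1 t) (w.1 t) ≠ 0 :=
          fun t => (div_pos (hφpos _ (hqpos w h t)) (hκpos _ (hqpos w h t))).ne'
        rw [Real.logb_mul (Finset.prod_ne_zero_iff.2 fun t _ => p1 t)
          (div_pos (hKpos w h) (hVpos w h)).ne', Real.logb_prod _ _ (fun t _ => p1 t),
          ← inv_div (V _ _) (K _ _), Real.logb_inv]
        ring
    rw [Finset.sum_congr rfl fun w _ => e w, Finset.sum_sub_distrib,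
      hE2 (fun c x y => Real.logb 2 (V x y / K c y)),
      ← hE1 (fun z => Real.logb 2 (φ z.2 z.1 / κ z.2.1 z.1)), ← hcmi] at hg
    unfold Jab
    linarith
  · have hφ0 : ∀ w : (Fin m → A) × (Fin m → C) × D × B × (Fin m → U),
        0 ≤ ∏ t, φ (w.2.1 t, w.2.2.2.2 t) (w.1 t) := fun w =>
      Finset.prod_nonneg fun t _ => (hφ _).1 _
    have e : ∀ w, P w * ((∏ t, φ (w.2.1 t, w.2.2.2.2 t) (w.1 t) / κ (w.2.1 t) (w.1 t)) *
        (K w.2.1 w.2.2.2.1 / V w.2.2.1 w.2.2.2.1)) ≤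
        ((∏ t, ∑ a, ps (a, w.2.1 t)) * K w.2.1 w.2.2.2.1 * G w.2.2.2.1 w.2.1 w.2.2.2.2 *
          ∏ t, φ (w.2.1 t, w.2.2.2.2 t) (w.1 t)) * F w.1 w.2.1 w.2.2.1 := by
      intro w
      rcases (hP0 w).eq_or_lt with h | h
      · rw [← h, zero_mul]
        exact mul_nonneg (mul_nonneg (mul_nonneg (mul_nonneg (hpcN.1 _) ((hk _).1 _))
          ((hG _ _).1 _)) (hφ0 w)) ((hF _ _).1 _)
      · apply le_of_eq
        have hv := (hVpos w h).ne'
        have hkp : (∏ t, κ (w.2.1 t) (w.1 t)) ≠ 0 :=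
          Finset.prod_ne_zero_iff.2 fun t _ => (hκpos _ (hqpos w h t)).ne'
        have hpk : ∏ t, ps (w.1 t, w.2.1 t) =
            (∏ t, ∑ a, ps (a, w.2.1 t)) * ∏ t, κ (w.2.1 t) (w.1 t) := by
          rw [← Finset.prod_mul_distrib]
          exact Finset.prod_congr rfl fun t _ => hκe (w.2.1 t) (w.1 t)
        simp only [hPdef]
        rw [hpk, Finset.prod_div_distrib]
        field_simp
    refine le_trans (Finset.sum_le_sum fun w _ => e w) (le_of_eq ?_)
    simp_rw [Fintype.sum_prod_type]
    have e2 : ∀ (a : Fin m → A) (c : Fin m → C), ∑ x, ∑ y, ∑ u : Fin m → U,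
        ((∏ t, ∑ a, ps (a, c t)) * K c y * G y c u * ∏ t, φ (c t, u t) (a t)) * F a c x =
        ∑ y, ∑ u : Fin m → U,
        ((∏ t, ∑ a, ps (a, c t)) * K c y * G y c u * ∏ t, φ (c t, u t) (a t)) := by
      intro a c
      rw [sum_rot]
      exact Finset.sum_congr rfl fun y _ => Finset.sum_congr rfl fun u _ =>
        sum_mul_pmf (hF a c) _
    simp_rw [e2]
    rw [Finset.sum_comm]
    refine Eq.trans (Finset.sum_congr rfl fun c _ => ?_) hpcN.2
    rw [sum_rot]
    refine Eq.trans (Finset.sum_congr rfl fun y _ => Eq.trans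
      (Finset.sum_congr rfl fun u _ => ?_) (sum_mul_pmf (hG y c) _)) (sum_mul_pmf (hk c) _)
    exact sum_mul_pmf (sum_pi_prod_pmf (fun t => φ (c t, u t)) fun t => hφ _) _

end core


lemma avg_type {Ω Z : Type} [Fintype Ω] [Fintype Z] {m : ℕ} (hm : 0 < m) (P : Ω → ℝ)
    (ζ : Ω → Fin m → Z) (g : Z → ℝ) :
    (m:ℝ) * ∑ z, (1 / (m:ℝ) * ∑ t, ∑ w, P w * delta (ζ w t) z) * g z =
      ∑ w, P w * ∑ t, g (ζ w t) := by
  have hm' : (m:ℝ) ≠ 0 := by exact_mod_cast hm.ne'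
  have e : ∀ z, (1 / (m:ℝ) * ∑ t, ∑ w, P w * delta (ζ w t) z) * g z =
      1 / (m:ℝ) * ∑ w, ∑ t, P w * (delta (ζ w t) z * g z) := by
    intro z
    rw [mul_assoc, Finset.sum_comm, Finset.sum_mul]
    simp_rw [Finset.sum_mul, mul_assoc]
  simp_rw [e]
  rw [← Finset.mul_sum, ← mul_assoc, mul_one_div_cancel hm', one_mul, Finset.sum_comm]
  refine Finset.sum_congr rfl fun w _ => ?_
  rw [Finset.sum_comm, Finset.mul_sum]
  refine Finset.sum_congr rfl fun t _ => ?_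
  rw [← Finset.mul_sum, delta_sum]

section fwd
variable {S1 S2 X Y1 Y2 US1 US2 : Type}
variable [Fintype S1] [Fintype S2] [Fintype X] [Fintype Y1] [Fintype Y2]
variable [Fintype US1] [Fintype US2]

lemma joint1_avg {ps : S1 × S2 → ℝ} {W : X → Y1 × Y2 → ℝ} {m n : ℕ} (hm : 0 < m)
    (F : (Fin m → S1) × (Fin m → S2) → (Fin n → X) → ℝ)
    (G1 : (Fin n → Y1) × (Fin m → S2) → (Fin m → US1) → ℝ) (g : S1 × S2 × US1 → ℝ) :
    (m:ℝ) * ∑ z, (1 / (m:ℝ) * ∑ t, jointPiT1 ps W m n F G1 t z) * g z =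
      ∑ a : Fin m → S1, ∑ c : Fin m → S2, ∑ x, ∑ y, ∑ u : Fin m → US1,
        ((∏ t, ps (a t, c t)) * F (a, c) x * margW1 (nFold W n) x y * G1 (y, c) u) *
          ∑ t, g (a t, c t, u t) := by
  have h := avg_type hm (fun w : (Fin m → S1) × (Fin m → S2) × (Fin n → X) ×
      ((Fin n → Y1) × (Fin n → Y2)) × (Fin m → US1) =>
      srcProd2 ps m w.1 w.2.1 * F (w.1, w.2.1) w.2.2.1 * nFold W n w.2.2.1 w.2.2.2.1 *
        G1 (w.2.2.2.1.1, w.2.1) w.2.2.2.2)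
      (fun w t => (w.1 t, w.2.1 t, w.2.2.2.2 t)) g
  refine Eq.trans ?_ (h.trans ?_)
  · congr 1
    refine Finset.sum_congr rfl fun z _ => ?_
    congr 2
    refine Finset.sum_congr rfl fun t _ => ?_
    unfold jointPiT1
    rw [Fintype.sum_prod_type]
    refine Finset.sum_congr rfl fun a _ => ?_
    rw [Fintype.sum_prod_type]
    refine Finset.sum_congr rfl fun c _ => ?_
    rw [Fintype.sum_prod_type]
    refine Finset.sum_congr rfl fun x _ => ?_
    refine Eq.symm (Eq.trans (Fintype.sum_prod_type _) ?_)
    refine Finset.sum_congr rfl fun y _ => Finset.sum_congr rfl fun u _ => ?_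
    symm
    congr 1
    unfold delta
    have : (a t = z.1 ∧ c t = z.2.1 ∧ u t = z.2.2) ↔ z = (a t, c t, u t) := by
      obtain ⟨z1, z2, z3⟩ := z
      simp only [Prod.mk.injEq]
      constructor
      · rintro ⟨h1, h2, h3⟩; exact ⟨h1.symm, h2.symm, h3.symm⟩
      · rintro ⟨h1, h2, h3⟩; exact ⟨h1.symm, h2.symm, h3.symm⟩
    by_cases hc : z = (a t, c t, u t)
    · rw [if_pos (this.2 hc), if_pos hc]
    · rw [if_neg (fun h => hc (this.1 h)), if_neg hc]
  · rw [Fintype.sum_prod_type]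
    refine Finset.sum_congr rfl fun a _ => ?_
    rw [Fintype.sum_prod_type]
    refine Finset.sum_congr rfl fun c _ => ?_
    rw [Fintype.sum_prod_type]
    refine Finset.sum_congr rfl fun x _ => ?_
    rw [Fintype.sum_prod_type, Fintype.sum_prod_type]
    refine Finset.sum_congr rfl fun y1 _ => ?_
    rw [Finset.sum_comm]
    refine Finset.sum_congr rfl fun u _ => ?_
    unfold margW1 srcProd2
    dsimp only
    generalize ∑ t, g (a t, c t, u t) = T
    simp_rw [Finset.mul_sum, Finset.sum_mul]

lemma joint2_avg {ps : S1 × S2 → ℝ} {W : X → Y1 × Y2 → ℝ} {m n : ℕ} (hm : 0 < m)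
    (F : (Fin m → S1) × (Fin m → S2) → (Fin n → X) → ℝ)
    (G2 : (Fin n → Y2) → (Fin m → US2) → ℝ)
    (px : (Fin m → S2) → (Fin n → X) → ℝ)
    (hpx : ∀ c x, ∑ a : Fin m → S1, (∏ t, ps (a t, c t)) * F (a, c) x =
      (∏ t, ∑ a, ps (a, c t)) * px c x) (g : S2 × US2 → ℝ) :
    (m:ℝ) * ∑ z, (1 / (m:ℝ) * ∑ t, jointPiT2 ps W m n F G2 t z) * g z =
      ∑ c : Fin m → S2, ∑ y, ∑ u : Fin m → US2,
        ((∏ t, ∑ a, ps (a, c t)) * kcomp px (margW2 (nFold W n)) c y * G2 y u) *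
          ∑ t, g (c t, u t) := by
  have h := avg_type hm (fun w : (Fin m → S1) × (Fin m → S2) × (Fin n → X) ×
      ((Fin n → Y1) × (Fin n → Y2)) × (Fin m → US2) =>
      srcProd2 ps m w.1 w.2.1 * F (w.1, w.2.1) w.2.2.1 * nFold W n w.2.2.1 w.2.2.2.1 *
        G2 w.2.2.2.1.2 w.2.2.2.2)
      (fun w t => (w.2.1 t, w.2.2.2.2 t)) g
  refine Eq.trans ?_ (h.trans ?_)
  · congr 1
    refine Finset.sum_congr rfl fun z _ => ?_
    congr 2
    refine Finset.sum_congr rfl fun t _ => ?_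
    unfold jointPiT2
    rw [Fintype.sum_prod_type]
    refine Finset.sum_congr rfl fun a _ => ?_
    rw [Fintype.sum_prod_type]
    refine Finset.sum_congr rfl fun c _ => ?_
    rw [Fintype.sum_prod_type]
    refine Finset.sum_congr rfl fun x _ => ?_
    refine Eq.symm (Eq.trans (Fintype.sum_prod_type _) ?_)
    refine Finset.sum_congr rfl fun y _ => Finset.sum_congr rfl fun u _ => ?_
    symm
    congr 1
    unfold delta
    have : (c t = z.1 ∧ u t = z.2) ↔ z = (c t, u t) := by
      obtain ⟨z1, z2⟩ := z
      simp only [Prod.mk.injEq]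
      constructor
      · rintro ⟨h1, h2⟩; exact ⟨h1.symm, h2.symm⟩
      · rintro ⟨h1, h2⟩; exact ⟨h1.symm, h2.symm⟩
    by_cases hc : z = (c t, u t)
    · rw [if_pos (this.2 hc), if_pos hc]
    · rw [if_neg (fun h => hc (this.1 h)), if_neg hc]
  · simp_rw [Fintype.sum_prod_type]
    rw [Finset.sum_comm]
    refine Finset.sum_congr rfl fun c _ => ?_
    have e : ∀ (a : Fin m → S1) (x : Fin n → X), ∑ y1 : Fin n → Y1, ∑ y2 : Fin n → Y2,
        ∑ u : Fin m → US2, srcProd2 ps m a c * F (a, c) x * nFold W n x (y1, y2) * G2 y2 u *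
          ∑ t, g (c t, u t) = ∑ y2, ∑ u : Fin m → US2, ((∏ t, ps (a t, c t)) * F (a, c) x) *
            (margW2 (nFold W n) x y2 * (G2 y2 u * ∑ t, g (c t, u t))) := by
      intro a x
      rw [sum_rot]
      refine Finset.sum_congr rfl fun y _ => Finset.sum_congr rfl fun u _ => ?_
      unfold margW2 srcProd2
      rw [Finset.sum_mul, Finset.mul_sum]
      exact Finset.sum_congr rfl fun _ _ => by ring
    simp_rw [e]
    rw [Finset.sum_comm]
    simp_rw [sum_rot (X := Fin m → S1)]
    rw [sum_rot]
    refine Finset.sum_congr rfl fun y _ => Finset.sum_congr rfl fun u _ => ?_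
    generalize ∑ t, g (c t, u t) = T
    simp_rw [← Finset.sum_mul, hpx]
    unfold kcomp
    rw [Finset.mul_sum, Finset.sum_mul, Finset.sum_mul]
    exact Finset.sum_congr rfl fun _ _ => by ring

lemma Jab_unit {C B : Type} [Fintype C] [Fintype B] {Ut : Type} [Fintype Ut] [Unique Ut]
    (o : Ut → ℝ) (ho : ∀ w, o w = 1) (pc : C → ℝ) (k : C → B → ℝ) :
    Jab o (fun _ => pc) k =
      ∑ z : C × B, pc z.1 * k z.1 z.2 * Real.logb 2 (k z.1 z.2 / outp pc k z.2) := by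
  unfold Jab
  simp_rw [Fintype.sum_prod_type, ho]
  refine Finset.sum_congr rfl fun c _ => ?_
  rw [Fintype.sum_unique]
  refine Finset.sum_congr rfl fun b _ => ?_
  rw [one_mul]
  rfl

lemma conv_code [Nonempty S1] [Nonempty S2] [Nonempty X] {ps : S1 × S2 → ℝ} (hps : IsPMF ps)
    {W : X → Y1 × Y2 → ℝ} (hW : IsChannel W) {m n : ℕ} (hm : 0 < m)
    {F : (Fin m → S1) × (Fin m → S2) → (Fin n → X) → ℝ}
    {G1 : (Fin n → Y1) × (Fin m → S2) → (Fin m → US1) → ℝ}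
    {G2 : (Fin n → Y2) → (Fin m → US2) → ℝ}
    (hF : IsChannel F) (hG1 : IsChannel G1) (hG2 : IsChannel G2) :
    ∃ (pc : (Fin m → S2) → ℝ) (px : (Fin m → S2) → (Fin n → X) → ℝ), IsPMF pc ∧ IsChannel px ∧
      (m:ℝ) * cmiMid (fun a => (1 / (m : ℝ)) * ∑ t, jointPiT1 ps W m n F G1 t a) ≤
        J1 pc px (nFold W n) ∧
      (m:ℝ) * MI (fun a => (1 / (m : ℝ)) * ∑ t, jointPiT2 ps W m n F G2 t a) ≤
        J2 pc px (nFold W n) ∧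
      J1 pc px (nFold W n) ≤ n * Real.logb 2 (Fintype.card Y1) ∧
      J2 pc px (nFold W n) ≤ n * Real.logb 2 (Fintype.card Y2) := by
  have hm' : (m:ℝ) ≠ 0 := by exact_mod_cast hm.ne'
  have hN := nFold_channel hW n
  have hps2 : IsPMF (fun c : S2 => ∑ a, ps (a, c)) := by
    refine ⟨fun c => Finset.sum_nonneg fun a _ => hps.1 _, ?_⟩
    rw [Finset.sum_comm]
    refine Eq.trans ?_ hps.2
    rw [Fintype.sum_prod_type]
  have hpc : IsPMF (fun c : Fin m → S2 => ∏ t, ∑ a, ps (a, c t)) :=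
    sum_pi_prod_pmf (fun _ c => ∑ a, ps (a, c)) fun _ => hps2
  obtain ⟨px, hpx, hpxe⟩ := exists_kernel (fun (c : Fin m → S2) (x : Fin n → X) =>
    ∑ a : Fin m → S1, (∏ t, ps (a t, c t)) * F (a, c) x) (fun c x => Finset.sum_nonneg fun a _ =>
      mul_nonneg (Finset.prod_nonneg fun t _ => hps.1 _) ((hF _).1 _))
  have hpxF : ∀ c x, ∑ a : Fin m → S1, (∏ t, ps (a t, c t)) * F (a, c) x =
      (∏ t, ∑ a, ps (a, c t)) * px c x := by
    intro c x
    rw [hpxe c x]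
    congr 1
    rw [Finset.sum_comm]
    refine Eq.trans (Finset.sum_congr rfl fun a _ => sum_mul_pmf (hF (a, c)) _) ?_
    exact sum_pi_prod (fun t a => ps (a, c t))
  have hV1 := margW1_channel hN
  have hk2 := kcomp_channel hpx (margW2_channel hN)
  set pc : (Fin m → S2) → ℝ := fun c => ∏ t, ∑ a, ps (a, c t) with hpcdef
  have hJ2 : J2 pc px (nFold W n) = Jab (fun c : Fin m → Unit => ∏ t, ∑ a : S2,
      (fun z : S2 × Unit => ∑ s, ps (s, z.1)) (a, c t)) (fun _ => pc)
        (kcomp px (margW2 (nFold W n))) := by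
    rw [Jab_unit]
    · rfl
    · intro w
      exact Finset.prod_eq_one fun t _ => hps2.2
  refine ⟨pc, px, hpc, hpx, ?_, ?_, ?_, ?_⟩
  · exact conv_core hps hm (F := fun a c => F (a, c)) (fun a c => hF _) hV1
      (G := fun y c => G1 (y, c)) (fun y c => hG1 _) hpx hpxF (joint1_avg hm F G1)
  · have hj := joint2_avg (W := W) hm F G2 px hpxF
    rw [MI_eq_cmiMid, hJ2]
    · refine conv_core (ps := fun z : S2 × Unit => ∑ s, ps (s, z.1)) (F := fun a _ => delta a)
        (G := fun y _ => G2 y) ?_ hm (fun a _ => delta_pmf a) hk2 (fun y _ => hG2 y)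
        (fun _ => hpc) ?_ ?_
      · refine ⟨fun z => hps2.1 z.1, ?_⟩
        rw [Fintype.sum_prod_type]
        simpa using hps2.2
      · intro c x
        have h1 : (∏ t : Fin m, ∑ a : S2, ∑ s, ps (s, a)) = 1 :=
          Finset.prod_eq_one fun t _ => hps2.2
        dsimp only
        rw [h1, one_mul, ← delta_sum x pc]
        refine Finset.sum_congr rfl fun a _ => ?_
        rw [mul_comm]
        congr 1
        unfold delta
        by_cases hxa : x = a
        · rw [if_pos hxa, if_pos hxa.symm]
        · rw [if_neg hxa, if_neg (fun h => hxa h.symm)]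
      · intro g
        have h := hj (fun z => g (z.1, (), z.2))
        refine Eq.trans ?_ (h.trans ?_)
        · congr 1
          simp [Fintype.sum_prod_type]
        · refine Finset.sum_congr rfl fun c _ => ?_
          refine Eq.symm (Eq.trans (Fintype.sum_unique _) ?_)
          have e : ∀ (x : Fin m → S2), (∑ y, ∑ u : Fin m → US2,
              (∏ t, ∑ s, ps (s, c t)) * delta c x * kcomp px (margW2 (nFold W n)) x y * G2 y u *
                ∑ t, g (c t, (), u t)) = delta c x * ∑ y, ∑ u : Fin m → US2,
              (∏ t, ∑ s, ps (s, c t)) * kcomp px (margW2 (nFold W n)) x y * G2 y u *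
                ∑ t, g (c t, (), u t) := by
            intro x
            simp_rw [Finset.mul_sum]
            refine Finset.sum_congr rfl fun y _ => Finset.sum_congr rfl fun u _ =>
              Finset.sum_congr rfl fun t _ => by ring
          refine Eq.trans (Finset.sum_congr rfl fun x _ => e x) ?_
          rw [delta_sum]
    · have h := hj (fun _ => 1)
      simp only [mul_one, Finset.sum_const, Finset.card_univ, Fintype.card_fin,
        nsmul_eq_mul] at h
      apply mul_left_cancel₀ hm'
      rw [h, mul_one]
      simp_rw [← Finset.sum_mul]
      refine (congrArg (· * (m:ℝ)) ?_).trans (one_mul _)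
      refine Eq.trans (Finset.sum_congr rfl fun c _ => ?_) hpc.2
      refine Eq.trans (Finset.sum_congr rfl fun y _ => sum_mul_pmf (hG2 y) _) ?_
      exact sum_mul_pmf (hk2 c) _
  · refine (Jab_le hpc hpx hV1).trans (le_of_eq ?_)
    simp [Real.logb_pow]
  · rw [hJ2]
    refine (Jab_le ?_ (fun _ => hpc) hk2).trans (le_of_eq ?_)
    · refine sum_pi_prod_pmf (fun _ (c : Unit) => ∑ a : S2, ∑ s, ps (s, a)) fun _ => ?_
      refine ⟨fun _ => Finset.sum_nonneg fun a _ => hps2.1 a, ?_⟩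
      simpa using hps2.2
    · simp [Real.logb_pow]

end fwd


/-! ### Forward direction -/

section fin
variable {S1 S2 X Y1 Y2 US1 US2 : Type}
variable [Fintype S1] [Fintype S2] [Fintype X] [Fintype Y1] [Fintype Y2]
variable [Fintype US1] [Fintype US2]

lemma ach_zero [Nonempty X] (W : X → Y1 × Y2 → ℝ) : Ach1 W (0, 0) := by
  refine ⟨le_refl _, le_refl _, fun ε hε => ?_⟩
  refine ⟨1, 1, 1, one_pos, one_pos, one_pos, fun _ _ => Classical.arbitrary X, fun _ => 0,
    fun _ => 0, by simp, by simp, ?_⟩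
  refine le_trans (le_of_eq ?_) hε.le
  unfold errP1
  have : ∀ (a b : Fin 1), a = b := fun a b => Subsingleton.elim a b
  have e : ∀ (mm : Fin 1 × Fin 1), ((0 : Fin 1) = mm.1 ∧ (0 : Fin 1) = mm.2) := fun mm =>
    ⟨this _ _, this _ _⟩
  simp only [if_pos (e _), mul_zero, Finset.sum_const_zero]

lemma ach_of_info {C : Type} [Fintype C] {W : X → Y1 × Y2 → ℝ} (hW : IsChannel W) {n : ℕ}
    (hn : 0 < n) {pc : C → ℝ} (hpc : IsPMF pc) {px : C → (Fin n → X) → ℝ} (hpx : IsChannel px)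
    {t1 t2 : ℝ} (ht1 : 0 ≤ t1) (ht2 : 0 ≤ t2)
    (h1 : (n:ℝ) * t1 < J1 pc px (nFold W n) ∨ (n:ℝ) * t1 = 0)
    (h2 : (n:ℝ) * t2 < J2 pc px (nFold W n) ∨ (n:ℝ) * t2 = 0) : Ach1 W (t1, t2) := by
  refine ⟨ht1, ht2, fun ε hε => ?_⟩
  have hn' : (0:ℝ) < n := by exact_mod_cast hn
  obtain ⟨N, k1, k2, hN, hk1, hk2, hl1, hl2, f, g1, g2, hg⟩ := channel_coding pc hpc px hpx
    (nFold W n) (nFold_channel hW n) (mul_nonneg hn'.le ht1) (mul_nonneg hn'.le ht2) h1 h2 hε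
  have hN' : (0:ℝ) < N := by exact_mod_cast hN
  refine ⟨N * n, k1, k2, Nat.mul_pos hN hn, hk1, hk2,
    fun mm => blkE N n X (f mm), fun b => g1 ((blkE N n Y1).symm b.1, b.2),
    fun b => g2 ((blkE N n Y2).symm b), ?_, ?_, ?_⟩
  rotate_left 2
  · rw [errP1_eq_gerr]
    exact (gerr_transport W N n f g1 g2).le.trans hg
  · dsimp only
    rw [le_div_iff₀ (by push_cast; positivity)]
    push_cast
    linarith
  · dsimp only
    rw [le_div_iff₀ (by push_cast; positivity)]
    push_cast
    linarith

lemma logb_card_nonneg (k : ℕ) : 0 ≤ Real.logb 2 (k : ℝ) := by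
  rcases Nat.eq_zero_or_pos k with h | h
  · simp [h]
  · exact Real.logb_nonneg (by norm_num) (by exact_mod_cast h)

lemma forward [Nonempty S1] [Nonempty S2] [Nonempty X] {ps : S1 × S2 → ℝ} (hps : IsPMF ps)
    {W : X → Y1 × Y2 → ℝ} (hW : IsChannel W) {κ : ℝ} (hκ : 0 ≤ κ)
    {Q1 : Set (S1 × S2 × US1 → ℝ)} {Q2 : Set (S2 × US2 → ℝ)}
    (hQ1c : IsCompact Q1) (hQ2c : IsCompact Q2) {R1 R2 : ℝ} (hR1 : 0 ≤ R1) (hR2 : 0 ≤ R2)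
    (h1 : ∀ q ∈ Q1, R1 ≤ cmiMid q) (h2 : ∀ q ∈ Q2, R2 ≤ MI q)
    (H : InGammaTilde ps W Q1 Q2 κ) : (R1, R2) ∈ scaleSet κ (Cap1 W) := by
  have key : ∀ e : ℝ, 0 < e → ∃ (m n : ℕ), 0 < m ∧ (n:ℝ) ≤ (κ + e) * m ∧
      ∃ (pc : (Fin m → S2) → ℝ) (px : (Fin m → S2) → (Fin n → X) → ℝ), IsPMF pc ∧ IsChannel px ∧
      (m:ℝ) * (R1 - e) < J1 pc px (nFold W n) ∧ (m:ℝ) * (R2 - e) < J2 pc px (nFold W n) ∧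
      J1 pc px (nFold W n) ≤ n * Real.logb 2 (Fintype.card Y1) ∧
      J2 pc px (nFold W n) ≤ n * Real.logb 2 (Fintype.card Y2) := by
    intro e he
    obtain ⟨d1, hd1, hc1⟩ := compact_cont_lower Q1 hQ1c cmiMid cmiMid_continuous R1 e h1 he
    obtain ⟨d2, hd2, hc2⟩ := compact_cont_lower Q2 hQ2c MI MI_continuous R2 e h2 he
    obtain ⟨m, n, hm, F, G1, G2, hF, hG1, hG2, hnm, ⟨q1, hq1, hl1⟩, ⟨q2, hq2, hl2⟩⟩ :=
      H (min e (min d1 d2)) (lt_min he (lt_min hd1 hd2))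
    have hm' : (0:ℝ) < m := by exact_mod_cast hm
    obtain ⟨pc, px, hpc, hpx, b1, b2, b3, b4⟩ := conv_code hps hW hm hF hG1 hG2
    have a1 := hc1 _ ⟨q1, hq1, hl1.trans ((min_le_right _ _).trans (min_le_left _ _))⟩
    have a2 := hc2 _ ⟨q2, hq2, hl2.trans ((min_le_right _ _).trans (min_le_right _ _))⟩
    refine ⟨m, n, hm, ?_, pc, px, hpc, hpx, lt_of_lt_of_le (mul_lt_mul_of_pos_left a1 hm') b1,
      lt_of_lt_of_le (mul_lt_mul_of_pos_left a2 hm') b2, b3, b4⟩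
    rw [div_le_iff₀ hm'] at hnm
    refine hnm.trans (mul_le_mul_of_nonneg_right ?_ hm'.le)
    have := min_le_left e (min d1 d2)
    linarith
  rcases hκ.eq_or_lt with h0 | h0
  · subst h0
    have hz : ∀ (R L : ℝ), 0 ≤ R → 0 ≤ L → (∀ e : ℝ, 0 < e → R - e ≤ e * L) → R = 0 := by
      intro R L hR hL h
      apply le_antisymm _ hR
      by_contra hc
      push Not at hc
      have := h (R / (2 * (1 + L))) (by positivity)
      have e1 : R / (2 * (1 + L)) * (1 + L) = R / 2 := by field_simp
      nlinarith
    have z1 : R1 = 0 := hz R1 _ hR1 (logb_card_nonneg (Fintype.card Y1)) (by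
      intro e he
      obtain ⟨m, n, hm, hn, pc, px, _, _, b1, b2, b3, b4⟩ := key e he
      have hm' : (0:ℝ) < m := by exact_mod_cast hm
      have hL := logb_card_nonneg (Fintype.card Y1)
      have := mul_le_mul_of_nonneg_right hn hL
      refine le_of_mul_le_mul_left ?_ hm'
      linarith)
    have z2 : R2 = 0 := hz R2 _ hR2 (logb_card_nonneg (Fintype.card Y2)) (by
      intro e he
      obtain ⟨m, n, hm, hn, pc, px, _, _, b1, b2, b3, b4⟩ := key e he
      have hm' : (0:ℝ) < m := by exact_mod_cast hm
      have hL := logb_card_nonneg (Fintype.card Y2)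
      have := mul_le_mul_of_nonneg_right hn hL
      refine le_of_mul_le_mul_left ?_ hm'
      linarith)
    refine ⟨(0, 0), subset_closure (ach_zero W), ?_⟩
    simp [z1, z2]
  · refine ⟨(R1 / κ, R2 / κ), ?_, ?_⟩
    swap
    · simp only [Prod.mk.injEq]
      constructor <;> field_simp
    have hach : ∀ e : ℝ, 0 < e → Ach1 W (max 0 (R1 - e) / (κ + e), max 0 (R2 - e) / (κ + e)) := by
      intro e he
      obtain ⟨m, n, hm, hn, pc, px, hpc, hpx, b1, b2, b3, b4⟩ := key e he
      have hm' : (0:ℝ) < m := by exact_mod_cast hm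
      have hke : 0 < κ + e := by linarith
      rcases Nat.eq_zero_or_pos n with hn0 | hn0
      · subst hn0
        simp only [Nat.cast_zero, zero_mul] at b3 b4
        have c1 : R1 - e ≤ 0 := by
          by_contra hc
          push Not at hc
          have := mul_pos hm' hc
          linarith
        have c2 : R2 - e ≤ 0 := by
          by_contra hc
          push Not at hc
          have := mul_pos hm' hc
          linarith
        rw [max_eq_left c1, max_eq_left c2, zero_div]
        exact ach_zero W
      · have hb : ∀ R J : ℝ, (m:ℝ) * (R - e) < J →
            ((n:ℝ) * (max 0 (R - e) / (κ + e)) < J ∨ (n:ℝ) * (max 0 (R - e) / (κ + e)) = 0) := by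
          intro R J hJ
          rcases le_total (R - e) 0 with h | h
          · right
            rw [max_eq_left h]
            simp
          · left
            rw [max_eq_right h]
            refine lt_of_le_of_lt ?_ hJ
            rw [← mul_div_assoc, div_le_iff₀ hke]
            nlinarith
        exact ach_of_info hW hn0 hpc hpx (div_nonneg (le_max_left _ _) hke.le)
          (div_nonneg (le_max_left _ _) hke.le) (hb _ _ b1) (hb _ _ b2)
    have hcont : ∀ R : ℝ, 0 ≤ R → Filter.Tendsto (fun e : ℝ => max 0 (R - e) / (κ + e))
        (nhdsWithin 0 (Set.Ioi 0)) (nhds (R / κ)) := by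
      intro R hR
      have hc : ContinuousAt (fun e : ℝ => max 0 (R - e) / (κ + e)) 0 := by
        refine ContinuousAt.div (by fun_prop) (by fun_prop) ?_
        simpa using h0.ne'
      have := hc.tendsto
      simp only [sub_zero, add_zero, max_eq_right hR] at this
      exact this.mono_left nhdsWithin_le_nhds
    refine mem_closure_of_tendsto ((hcont R1 hR1).prodMk_nhds (hcont R2 hR2)) ?_
    filter_upwards [self_mem_nhdsWithin] with e he
    exact hach e he

end fin

/-- **Theorem 1 (source–channel separation for System Π̃).**
`(κ̃, 𝒬̃₁, 𝒬̃₂)` is achievable for System Π̃ iff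
`(R_{S̃1|S̃2}(𝒬̃₁), R_{S̃2}(𝒬̃₂)) ∈ κ̃·𝒞₁(p_{Y1,Y2|X})`. -/
theorem systemPiTilde_separation
    {S1 S2 X Y1 Y2 US1 US2 : Type}
    [Fintype S1] [Fintype S2] [Fintype X] [Fintype Y1] [Fintype Y2]
    [Fintype US1] [Fintype US2]
    [Nonempty S1] [Nonempty S2] [Nonempty X] [Nonempty US1] [Nonempty US2]
    (ps : S1 × S2 → ℝ) (hps : IsPMF ps)
    (W : X → Y1 × Y2 → ℝ) (hW : IsChannel W)
    (κ : ℝ) (hκ : 0 ≤ κ)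
    (Q1 : Set (S1 × S2 × US1 → ℝ)) (Q2 : Set (S2 × US2 → ℝ))
    (hQ1ne : Q1.Nonempty) (hQ1c : IsCompact Q1)
    (hQ1m : ∀ q ∈ Q1, IsPMF q ∧ ∀ s12 : S1 × S2, ∑ u, q (s12.1, s12.2, u) = ps s12)
    (hQ2ne : Q2.Nonempty) (hQ2c : IsCompact Q2)
    (hQ2m : ∀ q ∈ Q2, IsPMF q ∧ ∀ s2, ∑ u, q (s2, u) = ∑ s1, ps (s1, s2)) :
    InGammaTilde ps W Q1 Q2 κ ↔
      (sInf {r : ℝ | ∃ q ∈ Q1,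
          r = CMI (fun a : S1 × US1 × S2 => q (a.1, a.2.2, a.2.1))},
       sInf {r : ℝ | ∃ q ∈ Q2, r = MI q}) ∈ scaleSet κ (Cap1 W) := by
  obtain ⟨q1, hq1, hmin1⟩ := hQ1c.exists_isMinOn hQ1ne cmiMid_continuous.continuousOn
  obtain ⟨q2, hq2, hmin2⟩ := hQ2c.exists_isMinOn hQ2ne MI_continuous.continuousOn
  have e1 : sInf {r : ℝ | ∃ q ∈ Q1, r = CMI (fun a : S1 × US1 × S2 => q (a.1, a.2.2, a.2.1))} =
      cmiMid q1 := by
    refine IsLeast.csInf_eq ⟨⟨q1, hq1, rfl⟩, ?_⟩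
    rintro r ⟨q, hq, rfl⟩
    exact hmin1 hq
  have e2 : sInf {r : ℝ | ∃ q ∈ Q2, r = MI q} = MI q2 := by
    refine IsLeast.csInf_eq ⟨⟨q2, hq2, rfl⟩, ?_⟩
    rintro r ⟨q, hq, rfl⟩
    exact hmin2 hq
  rw [e1, e2]
  constructor
  · intro H
    exact forward hps hW hκ hQ1c hQ2c (cmiMid_nonneg q1 (hQ1m q1 hq1).1)
      (MI_nonneg q2 (hQ2m q2 hq2).1) (fun q hq => hmin1 hq) (fun q hq => hmin2 hq) H
  · rintro ⟨r, hr, he⟩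
    simp only [Prod.mk.injEq] at he
    exact backward hps hW hκ hq1 (hQ1m q1 hq1).1 (hQ1m q1 hq1).2 hq2 (hQ2m q2 hq2).1
      (hQ2m q2 hq2).2 hr he.1.symm he.2.symm

end
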